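/- arXiv:2304.09223 — 2 statements merged into one kernel-verified Lean document; each statement's English description precedes it below -/
import Mathlib

section
/- Let $k$ and $\ell$ be multiplicatively independent integers, each at least $2$, let $s \ge 1$ and $t \ge 1$ be integers, let $v_0, \ldots, v_s, w_1, \ldots, w_s$ be words over $\Sigma_k$ with each $w_i$ nonempty, and let $u_0, \ldots, u_t, y_1, \ldots, y_t$ be words over $\Sigma_\ell$ with each $y_j$ nonempty. If $X = \{[v_0 w_1^{n_1} v_1 w_2^{n_2} \cdots v_{s-1} w_s^{n_s} v_s]_k : n_1, \ldots, n_s \ge 0\}$ and $Y = \{[u_0 y_1^{m_1} u_1 y_2^{m_2} \cdots u_{t-1} y_t^{m_t} u_t]_\ell : m_1, \ldots, m_t \ge 0\}$, then $|X \cap Y| \le (8(s+t+1))^{10(s+t+2)^5 - (s+t+2)}$. -/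
/-- `wordPow w n` is the `n`-fold concatenation `w^n` of the word `w`. -/
def wordPow {α : Type*} (w : List α) (n : ℕ) : List α :=
  (List.replicate n w).flatten

/-- `[·]_k` : the natural number represented by a word of base-`k` digits,
most significant digit first. -/
def wordVal (k : ℕ) (w : List (Fin k)) : ℕ :=
  w.foldl (fun a c => k * a + (c : ℕ)) 0

/-- The word `v₀ w₁^{n₁} v₁ w₂^{n₂} ⋯ v_{s-1} w_s^{n_s} v_s`
(here `v` is indexed by `0, …, s` and `w` by `1, …, s`). -/
def patternWord {α : Type*} (s : ℕ) (v w : ℕ → List α) (n : ℕ → ℕ) : List α :=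
  v 0 ++ ((List.range s).map fun i => wordPow (w (i + 1)) (n (i + 1)) ++ v (i + 1)).flatten

/-- Two natural numbers `k, ℓ ≥ 2` are multiplicatively independent if
`k^a = ℓ^b` with integers `a, b` implies `a = b = 0`. -/
def MultIndep (k l : ℕ) : Prop :=
  ∀ a b : ℤ, (k : ℚ) ^ a = (l : ℚ) ^ b → a = 0 ∧ b = 0

section ZeroEstimate
open Polynomial

/-- The operator `p ↦ X p' + e p`, i.e. the Euler operator conjugated by `X ^ e`. -/
noncomputable def twistedEuler (e : ℕ) (p : ℚ[X]) : ℚ[X] :=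
  X * derivative p + C (e : ℚ) * p

lemma coeff_twistedEuler (e : ℕ) (p : ℚ[X]) (i : ℕ) :
    (twistedEuler e p).coeff i = ((i : ℚ) + e) * p.coeff i := by
  unfold twistedEuler
  rw [coeff_add, coeff_C_mul]
  cases i with
  | zero => simp
  | succ i => rw [coeff_X_mul, coeff_derivative]; push_cast; ring

lemma coeff_iterate_twistedEuler (e : ℕ) (p : ℚ[X]) (k i : ℕ) :
    ((twistedEuler e)^[k] p).coeff i = ((i : ℚ) + e) ^ k * p.coeff i := by
  induction k with
  | zero => simp
  | succ k ih => rw [Function.iterate_succ_apply', coeff_twistedEuler, ih]; ring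

lemma natDegree_iterate_twistedEuler_le (e : ℕ) (p : ℚ[X]) (k : ℕ) :
    ((twistedEuler e)^[k] p).natDegree ≤ p.natDegree := by
  rw [natDegree_le_iff_coeff_eq_zero]
  intro N hN
  rw [coeff_iterate_twistedEuler, coeff_eq_zero_of_natDegree_lt hN, mul_zero]

lemma X_pow_mul_twistedEuler (e : ℕ) (p : ℚ[X]) :
    twistedEuler 0 (X ^ e * p) = X ^ e * twistedEuler e p := by
  unfold twistedEuler
  cases e with
  | zero => simp
  | succ e => simp [derivative_mul]; ring

lemma iterate_twistedEuler_sum {n : ℕ} (c : Fin n → ℚ) (e : Fin n → ℕ) (p : Fin n → ℚ[X]) (k : ℕ) :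
    (twistedEuler 0)^[k] (∑ j, C (c j) * (X ^ e j * p j)) =
      ∑ j, C (c j) * (X ^ e j * (twistedEuler (e j))^[k] (p j)) := by
  induction k with
  | zero => simp
  | succ k ih =>
    rw [Function.iterate_succ_apply', ih]
    have : ∀ q : Fin n → ℚ[X], twistedEuler 0 (∑ j, C (c j) * q j)
        = ∑ j, C (c j) * twistedEuler 0 (q j) := by
      intro q
      simp [twistedEuler, Finset.mul_sum]
      refine Finset.sum_congr rfl fun j _ => by ring
    rw [this]
    refine Finset.sum_congr rfl fun j _ => ?_
    rw [X_pow_mul_twistedEuler, Function.iterate_succ_apply']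

lemma X_sub_C_pow_dvd_twistedEuler (a : ℚ) (K : ℕ) (F : ℚ[X]) (h : (X - C a) ^ K ∣ F) (k : ℕ) :
    (X - C a) ^ (K - k) ∣ (twistedEuler 0)^[k] F := by
  induction k with
  | zero => simpa using h
  | succ k ih =>
    rw [Function.iterate_succ_apply']
    simp only [twistedEuler, Nat.cast_zero, C_0, zero_mul, add_zero]
    refine Dvd.dvd.mul_left ?_ _
    have := pow_sub_one_dvd_derivative_of_pow_dvd ih
    rwa [Nat.sub_sub] at this

lemma coeff_prod_sum_natDegree {ι : Type*} (s : Finset ι) (f : ι → ℚ[X]) (d : ι → ℕ)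
    (h : ∀ i ∈ s, (f i).natDegree ≤ d i) :
    (∏ i ∈ s, f i).coeff (∑ i ∈ s, d i) = ∏ i ∈ s, (f i).coeff (d i) := by
  classical
  induction s using Finset.induction_on with
  | empty => simp
  | insert a s ha ih =>
    rw [Finset.prod_insert ha, Finset.sum_insert ha, Finset.prod_insert ha,
      ← ih fun i hi => h i (Finset.mem_insert_of_mem hi)]
    refine coeff_mul_add_eq_of_natDegree_le (h a (Finset.mem_insert_self _ _)) ?_
    refine (natDegree_prod_le _ _).trans (Finset.sum_le_sum fun i hi => ?_)
    exact h i (Finset.mem_insert_of_mem hi)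

/-- A zero estimate for lacunary sums `∑ X ^ e j * p j` and `∑ c j X ^ e j * p j`. -/
theorem zero_estimate {b A : ℕ} (p : Fin (b + 1) → ℚ[X]) (hp : ∀ j, p j ≠ 0)
    (hA : ∀ j, (p j).natDegree ≤ A) (e : Fin (b + 1) → ℕ)
    (he : Function.Injective fun j => (p j).natDegree + e j)
    (c : Fin (b + 1) → ℚ) (hc : ∀ j, c j ≠ 0) (x : ℚ) (hx0 : x ≠ 0) (hx1 : x ≠ 1) (T K : ℕ)
    (hT : (X - C 1) ^ T ∣ ∑ j, X ^ e j * p j)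
    (hK : (X - C x) ^ K ∣ ∑ j, C (c j) * (X ^ e j * p j)) :
    T + K ≤ A * (b + 1) + 2 * b := by
  classical
  set M : Matrix (Fin (b + 1)) (Fin (b + 1)) ℚ[X] :=
    Matrix.of fun k j => (twistedEuler (e j))^[(k : ℕ)] (p j) with hM
  have hMe : ∀ k j, M k j = (twistedEuler (e j))^[(k : ℕ)] (p j) := fun k j => rfl
  have hcoef : M.det.coeff (∑ j, (p j).natDegree) =
      (∏ j, (p j).leadingCoeff) *
        (Matrix.vandermonde fun j => (((p j).natDegree + e j : ℕ) : ℚ)).det := by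
    rw [← Matrix.det_transpose (Matrix.vandermonde _), ← Matrix.det_mul_row,
      Matrix.det_apply', Matrix.det_apply', finsetSum_coeff]
    refine Finset.sum_congr rfl fun σ _ => ?_
    have h1 : (((Equiv.Perm.sign σ : ℤ) : ℚ[X])) = C (((Equiv.Perm.sign σ : ℤ) : ℚ)) := by simp
    rw [h1, coeff_C_mul, coeff_prod_sum_natDegree]
    · congr 1
      refine Finset.prod_congr rfl fun j _ => ?_
      rw [hMe, coeff_iterate_twistedEuler]
      simp [Matrix.vandermonde_apply, mul_comm]
    · intro j _
      exact natDegree_iterate_twistedEuler_le _ _ _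
  have hne : M.det ≠ 0 := by
    intro h0
    rw [h0, coeff_zero] at hcoef
    have h1 : (∏ j, (p j).leadingCoeff) ≠ 0 :=
      Finset.prod_ne_zero_iff.2 fun j _ => leadingCoeff_ne_zero.2 (hp j)
    have h2 : (Matrix.vandermonde fun j => (((p j).natDegree + e j : ℕ) : ℚ)).det ≠ 0 := by
      rw [Matrix.det_vandermonde_ne_zero_iff]
      intro i j hij
      exact he (Nat.cast_injective (R := ℚ) hij)
    exact mul_ne_zero h1 h2 hcoef.symm
  have hdeg : M.det.natDegree ≤ A * (b + 1) := by
    rw [Matrix.det_apply']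
    refine natDegree_sum_le_of_forall_le _ _ fun σ _ => ?_
    have h1 : (((Equiv.Perm.sign σ : ℤ) : ℚ[X])) = C (((Equiv.Perm.sign σ : ℤ) : ℚ)) := by simp
    rw [h1]
    refine (natDegree_C_mul_le _ _).trans ((natDegree_prod_le _ _).trans ?_)
    calc ∑ j, (M (σ j) j).natDegree ≤ ∑ _j : Fin (b + 1), A :=
          Finset.sum_le_sum fun j _ => (natDegree_iterate_twistedEuler_le _ _ _).trans (hA j)
      _ = A * (b + 1) := by simp [mul_comm]
  have key : ∀ (c : Fin (b + 1) → ℚ), (∀ j, c j ≠ 0) → ∀ a : ℚ, a ≠ 0 → ∀ K : ℕ,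
      (X - C a) ^ K ∣ ∑ j, C (c j) * (X ^ e j * p j) → (X - C a) ^ (K - b) ∣ M.det := by
    intro c hc a ha K hK
    set v : Fin (b + 1) → ℚ[X] := fun j => C (c j) * X ^ e j with hv
    have h1 : M.adjugate.mulVec (M.mulVec v) = M.det • v := by
      rw [Matrix.mulVec_mulVec, Matrix.adjugate_mul, Matrix.smul_mulVec, Matrix.one_mulVec]
    have h2 : ∀ k, (X - C a) ^ (K - b) ∣ (M.mulVec v) k := by
      intro k
      have h3 : (M.mulVec v) k = (twistedEuler 0)^[(k : ℕ)] (∑ j, C (c j) * (X ^ e j * p j)) := by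
        rw [iterate_twistedEuler_sum]
        simp only [Matrix.mulVec, dotProduct, hMe, hv]
        exact Finset.sum_congr rfl fun j _ => by ring
      rw [h3]
      refine (pow_dvd_pow _ ?_).trans (X_sub_C_pow_dvd_twistedEuler a K _ hK k)
      have := k.2
      omega
    have h4 : (X - C a) ^ (K - b) ∣ M.det * v 0 := by
      have := congrFun h1 0
      rw [Pi.smul_apply, smul_eq_mul] at this
      rw [← this]
      rw [Matrix.mulVec, dotProduct]
      exact Finset.dvd_sum fun k _ => (h2 k).mul_left _
    have h5 : IsCoprime ((X - C a) ^ (K - b)) (v 0) := by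
      refine IsCoprime.mul_right ?_ (IsCoprime.pow ?_)
      · exact isCoprime_one_right.of_isCoprime_of_dvd_right
          (isUnit_C.2 (hc 0).isUnit).dvd
      · have := isCoprime_X_sub_C_of_isUnit_sub (R := ℚ) (a := a) (b := 0)
          (by simpa using ha)
        simpa using this
    exact h5.dvd_of_dvd_mul_right h4
  have k1 : (X - C (1 : ℚ)) ^ (T - b) ∣ M.det :=
    key (fun _ => 1) (fun _ => one_ne_zero) 1 one_ne_zero T (by simpa using hT)
  have k2 := key c hc x hx0 K hK
  have hcop : IsCoprime ((X - C (1 : ℚ)) ^ (T - b)) ((X - C x) ^ (K - b)) :=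
    IsCoprime.pow (isCoprime_X_sub_C_of_isUnit_sub (sub_ne_zero.2 hx1.symm).isUnit)
  have k3 := natDegree_le_of_dvd (hcop.mul_dvd k1 k2) hne
  rw [natDegree_mul (pow_ne_zero _ (X_sub_C_ne_zero _)) (pow_ne_zero _ (X_sub_C_ne_zero _)),
    natDegree_pow, natDegree_pow, natDegree_X_sub_C, natDegree_X_sub_C] at k3
  omega

end ZeroEstimate

section TwoSolutions
open Polynomial

/-- Version of `zero_estimate` allowing some of the coefficient polynomials to vanish. -/
theorem zero_estimate_of_exists {B A : ℕ} (p : Fin (B + 1) → ℚ[X]) (hp : ∃ j, p j ≠ 0)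
    (hA : ∀ j, (p j).natDegree ≤ A) (e : Fin (B + 1) → ℕ)
    (he : ∀ i j, ∀ a ≤ A, ∀ a' ≤ A, a + e i = a' + e j → i = j)
    (c : Fin (B + 1) → ℚ) (hc : ∀ j, c j ≠ 0) (x : ℚ) (hx0 : x ≠ 0) (hx1 : x ≠ 1) (T K : ℕ)
    (hT : (X - C 1) ^ T ∣ ∑ j, X ^ e j * p j)
    (hK : (X - C x) ^ K ∣ ∑ j, C (c j) * (X ^ e j * p j)) :
    T + K ≤ A * (B + 1) + 2 * B := by
  classical
  set J : Finset (Fin (B + 1)) := Finset.univ.filter fun j => p j ≠ 0 with hJ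
  have hJpos : 0 < J.card := by
    obtain ⟨j, hj⟩ := hp
    exact Finset.card_pos.2 ⟨j, by simp [hJ, hj]⟩
  obtain ⟨b, hb⟩ : ∃ b, J.card = b + 1 := ⟨J.card - 1, by omega⟩
  have hbB : b ≤ B := by
    have := Finset.card_le_univ J
    rw [Fintype.card_fin] at this
    omega
  let φ := (J.equivFinOfCardEq hb).symm
  have hsum : ∀ f : Fin (B + 1) → ℚ[X], (∀ j, p j = 0 → f j = 0) →
      ∑ j, f j = ∑ i, f (φ i : Fin (B + 1)) := by
    intro f hf
    rw [Equiv.sum_comp φ (fun j : J => f j), Finset.sum_coe_sort J f, hJ, Finset.sum_filter]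
    refine Finset.sum_congr rfl fun j _ => ?_
    split_ifs with h
    · rfl
    · exact hf j (not_not.1 h)
  rw [hsum _ (fun j hj => by simp [hj])] at hT hK
  have := zero_estimate (fun i => p (φ i : Fin (B + 1)))
    (fun i => (Finset.mem_filter.1 (φ i).2).2) (fun i => hA _) (fun i => e (φ i))
    (fun i j hij => φ.injective (Subtype.ext (he _ _ _ (hA _) _ (hA _) hij)))
    (fun i => c (φ i)) (fun i => hc _) x hx0 hx1 T K hT hK
  have h2 : A * (b + 1) ≤ A * (B + 1) := Nat.mul_le_mul_left _ (by omega)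
  omega

open scoped Matrix.Norms.Elementwise in
/-- Siegel's lemma for the vanishing of an exponential sum to high order at `1`. -/
lemma exists_small_binomial_relation {β : Type*} [Fintype β] [DecidableEq β] (T B W : ℕ)
    (hT : 0 < T) (hcard : T < Fintype.card β) (hB : T ≤ B * (Fintype.card β - T))
    (hW : Fintype.card β ≤ 2 ^ W) (lam : β → ℕ) (hlam : ∀ i, lam i ≤ W) :
    ∃ c : β → ℤ, c ≠ 0 ∧ (∀ k < T, ∑ i, c i * ((lam i).choose k : ℤ) = 0) ∧
      ∀ i, |c i| ≤ (2 ^ W) ^ (2 * B) := by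
  let M : Matrix (Fin T) β ℤ := Matrix.of fun k i => ((lam i).choose k : ℤ)
  obtain ⟨t, ht0, ht, hnorm⟩ := Int.Matrix.exists_ne_zero_int_vec_norm_le M
    (by simpa using hcard) (by simpa using hT)
  refine ⟨t, ht0, ?_, ?_⟩
  · intro k hk
    have := congrFun ht ⟨k, hk⟩
    simp only [Matrix.mulVec, dotProduct, Pi.zero_apply] at this
    rw [← this]
    exact Finset.sum_congr rfl fun i _ => mul_comm _ _
  · intro i
    have hU : (1 : ℝ) ≤ 2 ^ W := one_le_pow₀ (by norm_num)
    have hM : ‖M‖ ≤ 2 ^ W := by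
      rw [Matrix.norm_le_iff (by positivity)]
      intro k i
      have h1 : (lam i).choose k ≤ 2 ^ W :=
        (Nat.choose_le_two_pow _ _).trans (Nat.pow_le_pow_right (by norm_num) (hlam i))
      simp only [M, Matrix.of_apply, Int.norm_natCast]
      exact_mod_cast h1
    have h2 : (Fintype.card β : ℝ) * max 1 ‖M‖ ≤ (2 ^ W) ^ 2 := by
      have h3 : max 1 ‖M‖ ≤ (2 : ℝ) ^ W := max_le hU hM
      have h4 : (Fintype.card β : ℝ) ≤ 2 ^ W := by exact_mod_cast hW
      rw [pow_two]
      gcongr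
    have h5 : (1 : ℝ) ≤ (Fintype.card β : ℝ) * max 1 ‖M‖ := by
      have h6 : (1 : ℝ) ≤ Fintype.card β := by exact_mod_cast (by omega : 1 ≤ Fintype.card β)
      nlinarith [le_max_left 1 ‖M‖]
    have h7 : ((Fintype.card (Fin T) : ℝ)) / (Fintype.card β - Fintype.card (Fin T)) ≤ B := by
      rw [Fintype.card_fin, div_le_iff₀ (by
        have : (T : ℝ) < Fintype.card β := by exact_mod_cast hcard
        linarith)]
      have h8 : ((T : ℕ) : ℝ) ≤ ((B * (Fintype.card β - T) : ℕ) : ℝ) := by exact_mod_cast hB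
      rwa [Nat.cast_mul, Nat.cast_sub hcard.le] at h8
    have h9 : ‖t‖ ≤ ((2 : ℝ) ^ W) ^ (2 * B) := by
      refine hnorm.trans ((Real.rpow_le_rpow_of_exponent_le h5 h7).trans ?_)
      rw [Real.rpow_natCast, pow_mul]
      exact pow_le_pow_left₀ (by positivity) h2 _
    have h10 := (norm_le_pi_norm t i).trans h9
    rw [Int.norm_eq_abs] at h10
    exact_mod_cast h10

lemma X_sub_C_pow_dvd_iff_taylor (a : ℚ) (n : ℕ) (F : ℚ[X]) :
    (X - C a) ^ n ∣ F ↔ ∀ k < n, (taylor a F).coeff k = 0 := by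
  rw [X_sub_C_pow_dvd_iff, X_pow_dvd_iff, taylor_apply]

lemma abs_pow_sub_one_le (c δ : ℚ) (hc : |c - 1| ≤ δ) (hδ : δ ≤ 1) (j : ℕ) :
    |c ^ j - 1| ≤ 2 ^ j * δ := by
  have h0 : 0 ≤ δ := (abs_nonneg _).trans hc
  have h2 : |c| ≤ 2 := by
    rw [abs_le] at hc ⊢
    constructor <;> linarith [hc.1, hc.2]
  have : |c ^ j - 1| ≤ (2 ^ j - 1) * δ := by
    induction j with
    | zero => simp
    | succ j ih =>
      have e : c ^ (j + 1) - 1 = c * (c ^ j - 1) + (c - 1) := by ring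
      rw [e]
      refine (abs_add_le _ _).trans ?_
      rw [abs_mul]
      have := mul_le_mul h2 ih (abs_nonneg _) (by norm_num)
      calc _ ≤ 2 * ((2 ^ j - 1) * δ) + δ := add_le_add this hc
        _ = _ := by ring
  nlinarith

lemma one_le_abs_mul_den {β : Type*} (s : Finset β) (A B : ℕ) (i j : β → ℕ) (hi : ∀ b, i b ≤ A)
    (hj : ∀ b, j b ≤ B) (c : β → ℤ) (x y : ℚ) (h : ∑ b ∈ s, (c b : ℚ) * x ^ i b * y ^ j b ≠ 0) :
    1 ≤ (x.den : ℚ) ^ A * (y.den : ℚ) ^ B * |∑ b ∈ s, (c b : ℚ) * x ^ i b * y ^ j b| := by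
  have hz : ∃ z : ℤ, (z : ℚ) = (x.den : ℚ) ^ A * (y.den : ℚ) ^ B *
      ∑ b ∈ s, (c b : ℚ) * x ^ i b * y ^ j b := by
    refine ⟨∑ b ∈ s, c b * (x.num ^ i b * x.den ^ (A - i b)) *
      (y.num ^ j b * y.den ^ (B - j b)), ?_⟩
    push_cast
    rw [Finset.mul_sum]
    refine Finset.sum_congr rfl fun b _ => ?_
    have key : ∀ (z : ℚ) (m n : ℕ), m ≤ n →
        (z.num : ℚ) ^ m * (z.den : ℚ) ^ (n - m) = (z.den : ℚ) ^ n * z ^ m := by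
      intro z m n hmn
      have h1 : (z.num : ℚ) = z.den * z := (Rat.den_mul_eq_num z).symm
      rw [h1, mul_pow]
      calc _ = (z.den : ℚ) ^ (m + (n - m)) * z ^ m := by rw [pow_add]; ring
        _ = _ := by rw [Nat.add_sub_cancel' hmn]
    rw [key _ _ _ (hi b), key _ _ _ (hj b)]
    ring
  obtain ⟨z, hz⟩ := hz
  have hden : (0 : ℚ) < (x.den : ℚ) ^ A * (y.den : ℚ) ^ B := by
    have := x.den_pos
    have := y.den_pos
    positivity
  have hz0 : z ≠ 0 := by
    rintro rfl
    rw [Int.cast_zero] at hz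
    exact (mul_ne_zero hden.ne' h) hz.symm
  rw [← abs_of_pos hden, ← abs_mul, ← hz]
  exact_mod_cast Int.one_le_abs hz0

lemma taylor_coeff_sum {β : Type*} (s : Finset β) (a : β → ℚ) (m : β → ℕ) (r : ℚ) (k : ℕ) :
    (taylor r (∑ b ∈ s, C (a b) * X ^ m b)).coeff k =
      ∑ b ∈ s, a b * (m b).choose k * r ^ (m b - k) := by
  rw [taylor_coeff, map_sum, eval_finsetSum]
  refine Finset.sum_congr rfl fun b _ => ?_
  rw [C_mul_X_pow_eq_monomial, hasseDeriv_monomial, eval_monomial]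
  ring

lemma abs_eval_hasseDeriv_le (F : ℚ[X]) (W T K : ℕ) (V x : ℚ) (hF : F.natDegree ≤ W) (hKT : K ≤ T)
    (hT : ∀ k < T, (taylor 1 F).coeff k = 0) (hV0 : 0 ≤ V) (hV : ∀ k, |(taylor 1 F).coeff k| ≤ V)
    (hx : |x - 1| ≤ 1) :
    |(hasseDeriv K F).eval x| ≤ (W + 1) * (2 ^ W * V * |x - 1| ^ (T - K)) := by
  have h1 : (hasseDeriv K F).eval x = (taylor 1 (hasseDeriv K F)).eval (x - 1) := by
    rw [taylor_eval]; simp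
  have h2 : (taylor 1 (hasseDeriv K F)).natDegree < W + 1 := by
    rw [natDegree_taylor]
    have := natDegree_hasseDeriv_le F K
    omega
  have hc : ∀ n, (taylor 1 (hasseDeriv K F)).coeff n =
      ((n + K).choose n : ℚ) * (taylor 1 F).coeff (n + K) := by
    intro n
    rw [taylor_coeff, taylor_coeff]
    have := congrFun (congrArg DFunLike.coe (hasseDeriv_comp (R := ℚ) n K)) F
    simp only [LinearMap.comp_apply, LinearMap.smul_apply] at this
    rw [this]
    simp
  rw [h1, eval_eq_sum_range' h2]
  refine (Finset.abs_sum_le_sum_abs _ _).trans ?_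
  have : ∀ n ∈ Finset.range (W + 1),
      |(taylor 1 (hasseDeriv K F)).coeff n * (x - 1) ^ n| ≤ 2 ^ W * V * |x - 1| ^ (T - K) := by
    intro n _
    rw [hc, abs_mul, abs_mul, abs_pow]
    by_cases h3 : n + K < T
    · rw [hT _ h3]
      simp only [abs_zero, mul_zero, zero_mul]
      positivity
    by_cases h4 : W < n + K
    · rw [coeff_eq_zero_of_natDegree_lt (by rw [natDegree_taylor]; omega)]
      simp only [abs_zero, mul_zero, zero_mul]
      positivity
    · have h5 : |((n + K).choose n : ℚ)| ≤ 2 ^ W := by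
        rw [abs_of_nonneg (by positivity)]
        exact_mod_cast (Nat.choose_le_two_pow _ _).trans
          (Nat.pow_le_pow_right (by norm_num) (by omega))
      have h6 : |x - 1| ^ n ≤ |x - 1| ^ (T - K) :=
        pow_le_pow_of_le_one (abs_nonneg _) hx (by omega)
      have := hV (n + K)
      gcongr
  refine (Finset.sum_le_sum this).trans ?_
  simp

set_option maxHeartbeats 2000000 in
/-- The arithmetic heart: two rationals `x` and `y x ^ q` close to `1` cannot both have small
denominators. -/
theorem two_solutions_core (A B q : ℕ) (hA : 1 ≤ A) (hB : 1 ≤ B) (hAq : A < q)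
    (hABq : A + 2 * B ≤ q) (hAB : A + 2 * B ≤ A * B) (x y δ : ℚ) (hx1 : x ≠ 1)
    (hx : |x - 1| ≤ 1 / 2) (hδ : δ ≤ 1) (hy0 : y ≠ 0) (hy : |y * x ^ q - 1| ≤ δ) :
    1 ≤ (x.den : ℚ) ^ A * (y.den : ℚ) ^ B * (2 ^ (q * (B + 1))) ^ (2 * B + 5) *
      (|x - 1| ^ (A * B - (A + 2 * B)) + δ) := by
  classical
  have hxl : 1 / 2 ≤ x := by have := (abs_le.1 hx).1; linarith
  have hxu : x ≤ 2 := by have := (abs_le.1 hx).2; linarith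
  have hx0 : 0 < x := by linarith
  have hδ0 : 0 ≤ δ := (abs_nonneg _).trans hy
  set W := q * (B + 1) with hW
  set T := A * B with hT
  let lam : Fin (A + 1) × Fin (B + 1) → ℕ := fun b => b.1 + q * (B - b.2)
  have hqB : q * B + q = W := by rw [hW]; ring
  have hlam : ∀ b, lam b ≤ A + q * B := by
    intro b
    have h1 := b.1.2
    have h2 : q * (B - b.2) ≤ q * B := Nat.mul_le_mul_left _ (Nat.sub_le _ _)
    simp only [lam]
    omega
  have hlamW : ∀ b, lam b ≤ W := fun b => (hlam b).trans (by omega)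
  have hcard : Fintype.card (Fin (A + 1) × Fin (B + 1)) = T + (A + B + 1) := by
    simp only [Fintype.card_prod, Fintype.card_fin, hT]; ring
  have hqW : (A + 1) * (B + 1) ≤ W := Nat.mul_le_mul_right _ hAq
  have hcardW : T + (A + B + 1) ≤ W := by
    refine le_trans (le_of_eq ?_) hqW
    rw [hT]; ring
  have hWU : W + 1 ≤ 2 ^ W := Nat.lt_two_pow_self
  obtain ⟨c, hc0, hcT, hcU⟩ := exists_small_binomial_relation T B W (by positivity)
    (by omega) (by
      rw [hcard, Nat.add_sub_cancel_left, hT]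
      nlinarith) (by omega) lam hlamW
  set U : ℚ := 2 ^ W with hU
  have hU1 : 1 ≤ U := one_le_pow₀ (by norm_num)
  have hcU' : ∀ b, |(c b : ℚ)| ≤ U ^ (2 * B) := fun b => by
    rw [hU]; exact_mod_cast hcU b
  have hchoose : ∀ b k, ((lam b).choose k : ℚ) ≤ U := by
    intro b k
    rw [hU]
    exact_mod_cast (Nat.choose_le_two_pow _ _).trans
      (Nat.pow_le_pow_right (by norm_num) (hlamW b))
  have hcardU : (Fintype.card (Fin (A + 1) × Fin (B + 1)) : ℚ) ≤ U := by
    rw [hcard, hU]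
    exact_mod_cast (by omega : T + (A + B + 1) ≤ 2 ^ W)
  set F : ℚ[X] := ∑ b, C (c b : ℚ) * X ^ lam b with hF
  set z := y * x ^ q with hz
  have hz0 : z ≠ 0 := mul_ne_zero hy0 (pow_ne_zero _ hx0.ne')
  set G : ℚ[X] := ∑ b, C (z ^ (b.2 : ℕ) * c b) * X ^ lam b with hG
  let p : Fin (B + 1) → ℚ[X] := fun j => ∑ i : Fin (A + 1), C (c (i, j) : ℚ) * X ^ (i : ℕ)
  let e : Fin (B + 1) → ℕ := fun j => q * (B - j)
  have hFp : F = ∑ j, X ^ e j * p j := by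
    rw [hF, Fintype.sum_prod_type_right]
    refine Finset.sum_congr rfl fun j _ => ?_
    rw [Finset.mul_sum]
    refine Finset.sum_congr rfl fun i _ => ?_
    simp only [lam, e, pow_add]; ring
  have hGp : G = ∑ j : Fin (B + 1), C (z ^ (j : ℕ)) * (X ^ e j * p j) := by
    rw [hG, Fintype.sum_prod_type_right]
    refine Finset.sum_congr rfl fun j _ => ?_
    rw [Finset.mul_sum, Finset.mul_sum]
    refine Finset.sum_congr rfl fun i _ => ?_
    simp only [lam, e, pow_add, C_mul]; ring
  have hp : ∃ j, p j ≠ 0 := by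
    obtain ⟨⟨i, j⟩, hij⟩ := Function.ne_iff.1 hc0
    refine ⟨j, fun h => hij ?_⟩
    have := congrArg (fun f => coeff f (i : ℕ)) h
    simp only [p, finsetSum_coeff, coeff_C_mul, coeff_X_pow, coeff_zero] at this
    rw [Finset.sum_eq_single i] at this
    · simpa using this
    · intro i' _ hi'
      rw [if_neg (fun h => hi' (Fin.ext h.symm)), mul_zero]
    · simp
  have hpA : ∀ j, (p j).natDegree ≤ A := by
    intro j
    refine natDegree_sum_le_of_forall_le _ _ fun i _ => ?_
    refine (natDegree_C_mul_X_pow_le _ _).trans ?_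
    have := i.2
    omega
  have he : ∀ i j, ∀ a ≤ A, ∀ a' ≤ A, a + e i = a' + e j → i = j := by
    intro i j a ha a' ha' h
    simp only [e] at h
    have hi := i.2
    have hj := j.2
    have h1 : (a + q * (B - i)) / q = B - i := by
      rw [Nat.add_mul_div_left _ _ (by omega), Nat.div_eq_of_lt (by omega), zero_add]
    have h2 : (a' + q * (B - j)) / q = B - j := by
      rw [Nat.add_mul_div_left _ _ (by omega), Nat.div_eq_of_lt (by omega), zero_add]
    rw [h, h2] at h1
    ext
    omega
  have hFT : ∀ k < T, (taylor 1 F).coeff k = 0 := by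
    intro k hk
    rw [hF, taylor_coeff_sum]
    simp only [one_pow, mul_one]
    exact_mod_cast hcT k hk
  have hFdvd := (X_sub_C_pow_dvd_iff_taylor 1 T F).2 hFT
  have hzero : ∀ K, (X - C x) ^ K ∣ G → T + K ≤ A * (B + 1) + 2 * B := by
    intro K hK
    refine zero_estimate_of_exists p hp hpA e he (fun j => z ^ (j : ℕ))
      (fun j => pow_ne_zero _ hz0) x hx0.ne' hx1 T K (hFp ▸ hFdvd) (hGp ▸ hK)
  have hG0 : G ≠ 0 := by
    intro h
    have := hzero (A * (B + 1) + 2 * B + 1) (h ▸ dvd_zero _)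
    omega
  set K := rootMultiplicity x G with hK
  have hKle : K ≤ A + 2 * B := by
    have h1 := hzero K (pow_rootMultiplicity_dvd _ _)
    have : A * (B + 1) = T + A := by rw [hT]; ring
    omega
  have hS0 : (taylor x G).coeff K ≠ 0 := by
    intro h
    refine pow_rootMultiplicity_not_dvd hG0 x ((X_sub_C_pow_dvd_iff_taylor x _ G).2 fun k hk => ?_)
    rcases Nat.lt_succ_iff_lt_or_eq.1 hk with h1 | h1
    · exact (X_sub_C_pow_dvd_iff_taylor x _ G).1 (pow_rootMultiplicity_dvd _ _) k h1
    · rw [h1]; exact h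
  set S := (taylor x G).coeff K with hS
  have hSsum : S = ∑ b, z ^ (b.2 : ℕ) * c b * (lam b).choose K * x ^ (lam b - K) := by
    rw [hS, hG, taylor_coeff_sum]
  have hSS : S * x ^ K = x ^ (q * B) *
      ∑ b, ((c b * (lam b).choose K : ℤ) : ℚ) * x ^ (b.1 : ℕ) * y ^ (b.2 : ℕ) := by
    rw [hSsum, Finset.sum_mul, Finset.mul_sum]
    refine Finset.sum_congr rfl fun b _ => ?_
    rcases lt_or_ge (lam b) K with h1 | h1
    · rw [Nat.choose_eq_zero_of_lt h1]; simp
    · have h2 : x ^ (lam b - K) * x ^ K = x ^ (b.1 : ℕ) * x ^ (q * (B - b.2)) := by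
        rw [← pow_add, Nat.sub_add_cancel h1, ← pow_add]
      have h3 : x ^ (q * (b.2 : ℕ)) * x ^ (q * (B - b.2)) = x ^ (q * B) := by
        rw [← pow_add, ← mul_add, Nat.add_sub_cancel' (Nat.lt_succ_iff.1 b.2.2)]
      calc _ = z ^ (b.2 : ℕ) * c b * (lam b).choose K * (x ^ (lam b - K) * x ^ K) := by ring
        _ = y ^ (b.2 : ℕ) * c b * (lam b).choose K * x ^ (b.1 : ℕ) *
            (x ^ (q * (b.2 : ℕ)) * x ^ (q * (B - b.2))) := by
          rw [h2, hz, mul_pow, ← pow_mul]; ring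
        _ = _ := by rw [h3]; push_cast; ring
  set S' := ∑ b, ((c b * (lam b).choose K : ℤ) : ℚ) * x ^ (b.1 : ℕ) * y ^ (b.2 : ℕ) with hS'
  have hS'0 : S' ≠ 0 := by
    intro h
    rw [h, mul_zero] at hSS
    exact (mul_ne_zero hS0 (pow_ne_zero _ hx0.ne')) hSS
  have hlow := one_le_abs_mul_den Finset.univ A B
    (fun b : Fin (A + 1) × Fin (B + 1) => (b.1 : ℕ)) (fun b => (b.2 : ℕ))
    (fun b => Nat.lt_succ_iff.1 b.1.2) (fun b => Nat.lt_succ_iff.1 b.2.2) _ x y hS'0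
  rw [← hS'] at hlow
  have hS'S : |S'| ≤ U * |S| := by
    have h1 : |S| * x ^ K = x ^ (q * B) * |S'| := by
      have := congrArg abs hSS
      rwa [abs_mul, abs_mul, abs_of_pos (pow_pos hx0 K), abs_of_pos (pow_pos hx0 (q * B))] at this
    have h2 : x ^ K ≤ 2 ^ K := pow_le_pow_left₀ hx0.le hxu _
    have h3 : (1 / 2 : ℚ) ^ (q * B) ≤ x ^ (q * B) := pow_le_pow_left₀ (by norm_num) hxl _
    have h4 : (1 / 2 : ℚ) ^ (q * B) * |S'| ≤ |S| * 2 ^ K := by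
      calc _ ≤ x ^ (q * B) * |S'| := by gcongr
        _ = |S| * x ^ K := h1.symm
        _ ≤ _ := by gcongr
    have h5 : (2 : ℚ) ^ (q * B) * 2 ^ K ≤ U := by
      rw [← pow_add, hU]
      exact pow_le_pow_right₀ (by norm_num) (by omega)
    calc |S'| = 2 ^ (q * B) * ((1 / 2 : ℚ) ^ (q * B) * |S'|) := by
          rw [← mul_assoc, ← mul_pow]; norm_num
      _ ≤ 2 ^ (q * B) * (|S| * 2 ^ K) := by gcongr
      _ = (2 ^ (q * B) * 2 ^ K) * |S| := by ring
      _ ≤ _ := by gcongr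
  have hFdeg : F.natDegree ≤ A + q * B := by
    refine natDegree_sum_le_of_forall_le _ _ fun b _ => ?_
    exact (natDegree_C_mul_X_pow_le _ _).trans (hlam b)
  have hFV : ∀ k, |(taylor 1 F).coeff k| ≤ U ^ (2 * B + 2) := by
    intro k
    rw [hF, taylor_coeff_sum]
    refine (Finset.abs_sum_le_sum_abs _ _).trans ?_
    calc _ ≤ ∑ _b : Fin (A + 1) × Fin (B + 1), U ^ (2 * B) * U := by
          refine Finset.sum_le_sum fun b _ => ?_
          rw [one_pow, mul_one, abs_mul, Nat.abs_cast]
          exact mul_le_mul (hcU' b) (hchoose b k) (by positivity) (by positivity)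
      _ = (Fintype.card (Fin (A + 1) × Fin (B + 1)) : ℚ) * (U ^ (2 * B) * U) := by
          rw [Finset.sum_const, nsmul_eq_mul, Finset.card_univ]
      _ ≤ U * (U ^ (2 * B) * U) := by gcongr
      _ = _ := by ring
  have hFK := abs_eval_hasseDeriv_le F (A + q * B) T K (U ^ (2 * B + 2)) x hFdeg (by omega) hFT
    (by positivity) hFV (by linarith)
  have hFKsum : (hasseDeriv K F).eval x = ∑ b, (c b : ℚ) * (lam b).choose K * x ^ (lam b - K) := by
    rw [← taylor_coeff, hF, taylor_coeff_sum]
  have hFK2 : |(hasseDeriv K F).eval x| ≤ U ^ (2 * B + 4) * |x - 1| ^ (T - (A + 2 * B)) := by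
    refine hFK.trans ?_
    have h1 : |x - 1| ^ (T - K) ≤ |x - 1| ^ (T - (A + 2 * B)) :=
      pow_le_pow_of_le_one (abs_nonneg _) (by linarith) (by omega)
    have h2 : (((A + q * B : ℕ) : ℚ) + 1) ≤ U := by
      rw [hU]
      exact_mod_cast (by omega : A + q * B + 1 ≤ 2 ^ W)
    have h3 : (2 : ℚ) ^ (A + q * B) ≤ U := pow_le_pow_right₀ (by norm_num) (by omega)
    calc _ ≤ U * (U * U ^ (2 * B + 2) * |x - 1| ^ (T - (A + 2 * B))) := by gcongr
      _ = _ := by ring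
  have hSup : |S| ≤ U ^ (2 * B + 4) * (|x - 1| ^ (T - (A + 2 * B)) + δ) := by
    have h1 : S = (hasseDeriv K F).eval x +
        ∑ b, (z ^ (b.2 : ℕ) - 1) * (c b * (lam b).choose K * x ^ (lam b - K)) := by
      rw [hFKsum, hSsum, ← Finset.sum_add_distrib]
      exact Finset.sum_congr rfl fun b _ => by ring
    rw [h1, mul_add]
    refine (abs_add_le _ _).trans (add_le_add hFK2 ?_)
    refine (Finset.abs_sum_le_sum_abs _ _).trans ?_
    calc _ ≤ ∑ b : Fin (A + 1) × Fin (B + 1), 2 ^ B * δ * (U ^ (2 * B) * U * 2 ^ (A + q * B)) := by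
          refine Finset.sum_le_sum fun b _ => ?_
          rw [abs_mul, abs_mul, abs_mul, Nat.abs_cast, abs_of_pos (pow_pos hx0 _)]
          have h2 : |z ^ (b.2 : ℕ) - 1| ≤ 2 ^ B * δ := by
            refine (abs_pow_sub_one_le z δ hy hδ _).trans ?_
            gcongr
            · norm_num
            · exact Nat.lt_succ_iff.1 b.2.2
          have h3 : x ^ (lam b - K) ≤ 2 ^ (A + q * B) :=
            (pow_le_pow_left₀ hx0.le hxu _).trans
              (pow_le_pow_right₀ (by norm_num) ((Nat.sub_le _ _).trans (hlam b)))
          have h4 := hcU' b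
          have h5 := hchoose b K
          gcongr
      _ = (Fintype.card (Fin (A + 1) × Fin (B + 1)) : ℚ) *
          (U ^ (2 * B) * U * δ * (2 ^ B * 2 ^ (A + q * B))) := by
          rw [Finset.sum_const, nsmul_eq_mul, Finset.card_univ]; ring
      _ ≤ U * (U ^ (2 * B) * U * δ * U) := by
          have h6 : (2 : ℚ) ^ B * 2 ^ (A + q * B) ≤ U := by
            rw [← pow_add]
            exact pow_le_pow_right₀ (by norm_num) (by omega)
          gcongr
      _ = U ^ (2 * B + 3) * δ := by ring
      _ ≤ U ^ (2 * B + 4) * δ := by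
          gcongr
          norm_num
  calc (1 : ℚ) ≤ (x.den : ℚ) ^ A * (y.den : ℚ) ^ B * |S'| := hlow
    _ ≤ (x.den : ℚ) ^ A * (y.den : ℚ) ^ B *
        (U * (U ^ (2 * B + 4) * (|x - 1| ^ (T - (A + 2 * B)) + δ))) := by
      gcongr
      exact hS'S.trans (by gcongr)
    _ = _ := by ring

end TwoSolutions

section GapPrinciple
open Real

set_option maxHeartbeats 1000000 in
/-- Gap principle: `x` and `y x ^ q` cannot both be exponentially close to `1` relative to the
heights of `x` and `y`. -/
theorem two_solutions_false (x y : ℚ) (ε τ h : ℝ) (q : ℕ) (hε0 : 0 < ε) (hε1 : ε ≤ 1)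
    (hτ : τ ≤ ε ^ 2 / 144) (hq : 160 / ε ≤ q) (hh : 10 ^ 4 / ε ^ 3 ≤ h) (hx1 : x ≠ 1)
    (hx : |(x : ℝ) - 1| ≤ exp (-(ε * h))) (hy0 : y ≠ 0)
    (hxd : (x.den : ℝ) ≤ exp h) (hyd : (y.den : ℝ) ≤ exp (τ * q * h))
    (hxy : |(y : ℝ) * (x : ℝ) ^ q - 1| ≤ exp (-(ε * q * h))) : False := by
  have hεq : 160 ≤ ε * q := by
    rw [div_le_iff₀ hε0] at hq; linarith
  have hε3 : 10 ^ 4 ≤ h * ε ^ 3 := by rwa [div_le_iff₀ (by positivity)] at hh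
  have hh0 : 0 < h := lt_of_lt_of_le (by positivity) hh
  have hεh : 10 ^ 4 ≤ ε * h := by
    have : ε ^ 3 ≤ ε := by nlinarith [mul_le_mul hε1 hε1 hε0.le zero_le_one]
    nlinarith
  obtain ⟨B, hB1, hB2⟩ : ∃ B : ℕ, 8 ≤ ε * B ∧ ε * B ≤ 9 := by
    refine ⟨⌈8 / ε⌉₊, ?_, ?_⟩
    · have := Nat.le_ceil (8 / ε)
      rw [div_le_iff₀ hε0] at this; linarith
    · have := (Nat.ceil_lt_add_one (show 0 ≤ 8 / ε by positivity)).le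
      have h2 := mul_le_mul_of_nonneg_left this hε0.le
      rw [mul_add, mul_div_cancel₀ _ hε0.ne'] at h2
      linarith
  obtain ⟨A, hA1, hA2⟩ : ∃ A : ℕ, ε * q / 8 - 1 ≤ A ∧ (A : ℝ) ≤ ε * q / 8 :=
    ⟨⌊ε * q / 8⌋₊, (Nat.sub_one_lt_floor _).le, Nat.floor_le (by positivity)⟩
  have hA18 : (18 : ℝ) ≤ A := by linarith
  have hA16 : ε * q ≤ 16 * A := by linarith
  have hq0 : (0 : ℝ) < q := by
    by_contra hc
    have : (q : ℝ) = 0 := le_antisymm (not_lt.1 hc) (Nat.cast_nonneg _)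
    rw [this] at hεq; norm_num at hεq
  have hAq : (A : ℝ) ≤ q / 8 := by nlinarith
  have hBq : 2 * (B : ℝ) ≤ q / 8 := by
    have : ε * (2 * B) ≤ ε * (q / 8) := by linarith
    exact le_of_mul_le_mul_left this hε0
  have hB8 : (8 : ℝ) ≤ B := by nlinarith
  have hABq : A + 2 * B ≤ q := by
    have : ((A : ℝ) + 2 * B) ≤ q := by linarith
    exact_mod_cast this
  have hAB : A + 2 * B ≤ A * B := by
    have : ((A : ℝ) + 2 * B) ≤ A * B := by nlinarith
    exact_mod_cast this
  have hn : 6 * (A : ℝ) ≤ ε * ((A * B - (A + 2 * B) : ℕ) : ℝ) := by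
    rw [Nat.cast_sub hAB]
    push_cast
    nlinarith
  have hxhalf : |x - 1| ≤ 1 / 2 := by
    have h1 : exp (-(ε * h)) ≤ 1 / 2 := by
      rw [exp_neg, one_div]
      exact inv_anti₀ (by norm_num) (by linarith [add_one_le_exp (ε * h)])
    have h2 := hx.trans h1
    have : ((|x - 1| : ℚ) : ℝ) ≤ ((1 / 2 : ℚ) : ℝ) := by push_cast; exact h2
    exact_mod_cast this
  have hδ1 : |y * x ^ q - 1| ≤ 1 := by
    have h1 : exp (-(ε * q * h)) ≤ 1 := by
      rw [exp_le_one_iff]; simp only [Left.neg_nonpos_iff]; positivity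
    have h2 := hxy.trans h1
    have : ((|y * x ^ q - 1| : ℚ) : ℝ) ≤ ((1 : ℚ) : ℝ) := by push_cast; exact h2
    exact_mod_cast this
  have core := two_solutions_core A B q (by exact_mod_cast (by linarith : (1 : ℝ) ≤ A))
    (by exact_mod_cast (by linarith : (1 : ℝ) ≤ B))
    (by exact_mod_cast (by linarith : (A : ℝ) < q)) hABq hAB x y _ hx1 hxhalf hδ1 hy0 le_rfl
  have core' : (1 : ℝ) ≤ (x.den : ℝ) ^ A * (y.den : ℝ) ^ B * (2 ^ (q * (B + 1))) ^ (2 * B + 5) *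
      (|(x : ℝ) - 1| ^ (A * B - (A + 2 * B)) + |(y : ℝ) * (x : ℝ) ^ q - 1|) := by
    exact_mod_cast core
  have e1 : (x.den : ℝ) ^ A ≤ exp (A * h) := by
    rw [exp_nat_mul]
    exact pow_le_pow_left₀ (by positivity) hxd _
  have e2 : (y.den : ℝ) ^ B ≤ exp (A * h) := by
    refine (pow_le_pow_left₀ (by positivity) hyd _).trans ?_
    rw [← exp_nat_mul]
    refine exp_le_exp.2 ?_
    have h1 : τ * B ≤ ε / 16 := by
      have : τ * B ≤ ε ^ 2 / 144 * B := by gcongr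
      nlinarith
    have h2 : (τ * B) * (q * h) ≤ ε / 16 * (q * h) := by gcongr
    nlinarith
  have e3 : ((2 : ℝ) ^ (q * (B + 1))) ^ (2 * B + 5) ≤ exp (4 * A * h - 1) := by
    have h1 : (2 : ℝ) ≤ exp 1 := by linarith [add_one_le_exp (1 : ℝ)]
    rw [← pow_mul]
    refine (pow_le_pow_left₀ (by norm_num) h1 _).trans ?_
    rw [← exp_nat_mul, mul_one]
    refine exp_le_exp.2 ?_
    push_cast
    have h2 : ε * (B + 1 : ℝ) ≤ 10 := by linarith
    have h3 : ε * (2 * B + 5 : ℝ) ≤ 23 := by linarith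
    have h4 : (ε * (B + 1 : ℝ)) * (ε * (2 * B + 5 : ℝ)) ≤ 10 * 23 := by gcongr
    have h5 : ε * q * 10 ^ 4 ≤ 16 * A * (h * ε ^ 3) := by gcongr
    have h6 : q * 10 ^ 4 ≤ 16 * A * h * ε ^ 2 := by
      have : ε * (q * 10 ^ 4) ≤ ε * (16 * A * h * ε ^ 2) := by
        calc _ = ε * q * 10 ^ 4 := by ring
          _ ≤ _ := h5
          _ = _ := by ring
      exact le_of_mul_le_mul_left this hε0
    have h7 : ε ^ 2 * (q * (B + 1) * (2 * B + 5)) ≤ ε ^ 2 * (4 * A * h - 1) := by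
      have h8 : ε ^ 2 * (q * (B + 1) * (2 * B + 5)) ≤ q * 230 := by
        calc _ = q * ((ε * (B + 1 : ℝ)) * (ε * (2 * B + 5 : ℝ))) := by ring
          _ ≤ q * (10 * 23) := by gcongr
          _ = _ := by norm_num
      have h9 : (1 : ℝ) ≤ q := by exact_mod_cast (by exact_mod_cast hq0 : 0 < q)
      have h10 : ε ^ 2 ≤ 1 := pow_le_one₀ hε0.le hε1
      have h11 : ε ^ 2 * (4 * A * h - 1) = (16 * A * h * ε ^ 2) / 4 - ε ^ 2 := by ring
      linarith
    exact le_of_mul_le_mul_left h7 (by positivity)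
  have e4 : |(x : ℝ) - 1| ^ (A * B - (A + 2 * B)) ≤ exp (-(6 * A * h)) := by
    refine (pow_le_pow_left₀ (abs_nonneg _) hx _).trans ?_
    rw [← exp_nat_mul]
    refine exp_le_exp.2 ?_
    nlinarith
  have e5 : |(y : ℝ) * (x : ℝ) ^ q - 1| ≤ exp (-(6 * A * h)) := by
    refine hxy.trans (exp_le_exp.2 ?_)
    have : 6 * (A : ℝ) ≤ ε * q := by linarith
    nlinarith
  have : (1 : ℝ) ≤ exp (A * h) * exp (A * h) * exp (4 * A * h - 1) *
      (exp (-(6 * A * h)) + exp (-(6 * A * h))) := by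
    refine core'.trans ?_
    gcongr
  rw [← two_mul, mul_left_comm, ← exp_add, ← exp_add, ← exp_add] at this
  have h1 : A * h + A * h + (4 * A * h - 1) + -(6 * A * h) = -1 := by ring
  rw [h1] at this
  have h2 : exp (-1 : ℝ) < 1 / 2 := by
    rw [exp_neg, one_div]
    refine inv_strictAnti₀ (by norm_num) ?_
    linarith [add_one_lt_exp one_ne_zero]
  linarith

end GapPrinciple

section Size
open Real

/-- The logarithmic size `log |num| + log den` of a rational number. -/
noncomputable def logSize (q : ℚ) : ℝ := log q.num.natAbs + log q.den

lemma logSize_nonneg (q : ℚ) : 0 ≤ logSize q :=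
  add_nonneg (log_natCast_nonneg _) (log_natCast_nonneg _)

lemma log_den_le_logSize (q : ℚ) : log q.den ≤ logSize q :=
  le_add_of_nonneg_left (log_natCast_nonneg _)

lemma den_le_exp_logSize (q : ℚ) : (q.den : ℝ) ≤ exp (logSize q) := by
  rw [← log_le_iff_le_exp (by exact_mod_cast q.den_pos)]
  exact log_den_le_logSize q

lemma logSize_one : logSize 1 = 0 := by simp [logSize]

lemma logSize_zero : logSize 0 = 0 := by simp [logSize]

lemma logSize_neg (q : ℚ) : logSize (-q) = logSize q := by simp [logSize]

lemma logSize_div_le (a b : ℤ) (ha : a ≠ 0) (hb : b ≠ 0) :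
    logSize ((a : ℚ) / b) ≤ log a.natAbs + log b.natAbs := by
  have h1 : ((a : ℚ) / b).num ∣ a := by
    rw [← Rat.divInt_eq_div]; exact Rat.num_dvd _ hb
  have h2 : (((a : ℚ) / b).den : ℤ) ∣ b := by
    rw [← Rat.divInt_eq_div]; exact Rat.den_dvd _ _
  refine add_le_add (log_le_log ?_ ?_) (log_le_log ?_ ?_)
  · have : ((a : ℚ) / b).num ≠ 0 := by
      rw [Rat.num_ne_zero]
      exact div_ne_zero (by exact_mod_cast ha) (by exact_mod_cast hb)
    exact_mod_cast Int.natAbs_pos.2 this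
  · exact_mod_cast Nat.le_of_dvd (Int.natAbs_pos.2 ha) (Int.natAbs_dvd_natAbs.2 h1)
  · exact_mod_cast Rat.den_pos _
  · have := Int.natAbs_dvd_natAbs.2 h2
    rw [Int.natAbs_natCast] at this
    exact_mod_cast Nat.le_of_dvd (Int.natAbs_pos.2 hb) this

lemma logSize_mul_le (q r : ℚ) : logSize (q * r) ≤ logSize q + logSize r := by
  by_cases hq : q = 0
  · simpa [hq, logSize_zero] using logSize_nonneg r
  by_cases hr : r = 0
  · simpa [hr, logSize_zero] using logSize_nonneg q
  have e : q * r = ((q.num * r.num : ℤ) : ℚ) / ((q.den * r.den : ℕ) : ℤ) := by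
    conv_lhs => rw [← Rat.num_div_den q, ← Rat.num_div_den r]
    push_cast
    rw [div_mul_div_comm]
  have hq' := Rat.num_ne_zero.2 hq
  have hr' := Rat.num_ne_zero.2 hr
  have hqd := q.den_ne_zero
  have hrd := r.den_ne_zero
  rw [e]
  refine (logSize_div_le _ _ (mul_ne_zero hq' hr') (by exact_mod_cast mul_ne_zero hqd hrd)).trans ?_
  rw [Int.natAbs_mul, Int.natAbs_natCast, Nat.cast_mul, Nat.cast_mul,
    log_mul (by simpa using hq) (by simpa using hr),
    log_mul (by exact_mod_cast hqd) (by exact_mod_cast hrd)]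
  unfold logSize
  linarith

lemma logSize_inv (q : ℚ) : logSize q⁻¹ = logSize q := by
  by_cases hq : q = 0
  · simp [hq]
  · unfold logSize
    rw [Rat.num_inv, Rat.den_inv]
    simp [hq, Int.natAbs_mul, Int.natAbs_sign_of_ne_zero, add_comm]

lemma logSize_div_le_add (q r : ℚ) : logSize (q / r) ≤ logSize q + logSize r := by
  rw [div_eq_mul_inv, ← logSize_inv r]
  exact logSize_mul_le _ _

lemma logSize_div_comm (q r : ℚ) : logSize (q / r) = logSize (r / q) := by
  rw [← logSize_inv, inv_div]

lemma logSize_pow (q : ℚ) (n : ℕ) : logSize (q ^ n) = n * logSize q := by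
  unfold logSize
  rw [Rat.num_pow, Rat.den_pow, Int.natAbs_pow]
  push_cast
  rw [log_pow, log_pow]; ring

lemma logSize_zpow (q : ℚ) (n : ℤ) : logSize (q ^ n) = |(n : ℝ)| * logSize q := by
  obtain ⟨n, rfl | rfl⟩ := n.eq_nat_or_neg
  · rw [zpow_natCast, logSize_pow]; simp
  · rw [zpow_neg, zpow_natCast, logSize_inv, logSize_pow]; simp

lemma logSize_natCast (n : ℕ) : logSize n = log n := by simp [logSize]

lemma logSize_natCast_zpow (b : ℕ) (E : ℤ) :
    logSize ((b : ℚ) ^ E) = |log (((b : ℚ) ^ E : ℚ) : ℝ)| := by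
  rw [logSize_zpow, logSize_natCast]
  push_cast
  rw [log_zpow, abs_mul, abs_of_nonneg (log_natCast_nonneg b)]

lemma abs_log_le_logSize (q : ℚ) : |log (q : ℝ)| ≤ logSize q := by
  by_cases hq : q = 0
  · simp [hq, logSize_zero]
  have e : log (q : ℝ) = log q.num.natAbs - log q.den := by
    conv_lhs => rw [← Rat.num_div_den q]
    push_cast
    rw [log_div (by simpa using hq) (by exact_mod_cast q.den_ne_zero), Nat.cast_natAbs,
      Int.cast_abs,
      log_abs]
  rw [e, abs_le]
  have h1 : 0 ≤ log (q.num.natAbs : ℝ) := log_natCast_nonneg _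
  have h2 : 0 ≤ log (q.den : ℝ) := log_natCast_nonneg _
  unfold logSize
  constructor <;> linarith

lemma le_exp_logSize (q : ℚ) (hq : q ≠ 0) : |(q : ℝ)| ≤ exp (logSize q) := by
  rw [← log_le_iff_le_exp (abs_pos.2 (by exact_mod_cast hq)), log_abs]
  exact (le_abs_self _).trans (abs_log_le_logSize q)

lemma exp_neg_logSize_le (q : ℚ) (hq : q ≠ 0) : exp (-logSize q) ≤ |(q : ℝ)| := by
  rw [← le_log_iff_exp_le (abs_pos.2 (by exact_mod_cast hq)), log_abs]
  exact (abs_le.1 (abs_log_le_logSize q)).1 |>.trans le_rfl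

lemma log_two_le_logSize (q : ℚ) (hq : 0 < q) (hq1 : q ≠ 1) : log 2 ≤ logSize q := by
  have hn : 0 < q.num := Rat.num_pos.2 hq
  by_cases hd : q.den = 1
  · have h2 : 2 ≤ q.num.natAbs := by
      have : q.num ≠ 1 := by
        intro h
        apply hq1
        rw [← Rat.num_div_den q, h, hd]; simp
      omega
    have h3 : log 2 ≤ log q.num.natAbs := log_le_log (by norm_num) (by exact_mod_cast h2)
    have := log_natCast_nonneg q.den
    unfold logSize
    linarith
  · have h2 : 2 ≤ q.den := by
      have := q.den_pos
      omega
    have h3 : log 2 ≤ log q.den := log_le_log (by norm_num) (by exact_mod_cast h2)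
    exact h3.trans (log_den_le_logSize q)

lemma logSize_sum_le {σ : Type*} (s : Finset σ) (hs : s.Nonempty) (f : σ → ℚ) :
    logSize (∑ i ∈ s, f i) ≤ log s.card + 2 * ∑ i ∈ s, logSize (f i) := by
  classical
  have key : ∀ s : Finset σ, ∃ (a b : ℤ), b ≠ 0 ∧ ∑ i ∈ s, f i = (a : ℚ) / b ∧
      (|b| : ℝ) ≤ exp (∑ i ∈ s, logSize (f i)) ∧
      (|a| : ℝ) ≤ s.card * exp (∑ i ∈ s, logSize (f i)) := by
    intro s
    induction s using Finset.induction_on with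
    | empty => exact ⟨0, 1, by simp⟩
    | insert i s hi ih =>
      obtain ⟨a, b, hb, hab, h1, h2⟩ := ih
      refine ⟨a * (f i).den + (f i).num * b, b * (f i).den,
        mul_ne_zero hb (by exact_mod_cast (f i).den_ne_zero), ?_, ?_, ?_⟩
      · rw [Finset.sum_insert hi, hab]
        conv_lhs => rw [← Rat.num_div_den (f i)]
        have := (f i).den_ne_zero
        push_cast
        field_simp
        ring
      · rw [Finset.sum_insert hi, exp_add]
        push_cast
        rw [abs_mul, Nat.abs_cast, mul_comm]
        exact mul_le_mul (den_le_exp_logSize _) h1 (abs_nonneg _) (exp_pos _).le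
      · rw [Finset.sum_insert hi, exp_add, Finset.card_insert_of_notMem hi]
        push_cast
        have h3 := den_le_exp_logSize (f i)
        have h4 : (|((f i).num : ℝ)|) ≤ exp (logSize (f i)) := by
          by_cases h0 : f i = 0
          · rw [h0]; simpa using (exp_pos _).le
          · have : (|((f i).num : ℝ)|) = ((f i).num.natAbs : ℝ) := by
              rw [Nat.cast_natAbs, Int.cast_abs]
            rw [this, ← log_le_iff_le_exp (by
              exact_mod_cast Int.natAbs_pos.2 (Rat.num_ne_zero.2 h0))]
            exact le_add_of_nonneg_right (log_natCast_nonneg _)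
        refine (abs_add_le _ _).trans ?_
        rw [abs_mul, abs_mul, Nat.abs_cast]
        calc _ ≤ (s.card * exp (∑ i ∈ s, logSize (f i))) * exp (logSize (f i)) +
              exp (logSize (f i)) * exp (∑ i ∈ s, logSize (f i)) := by gcongr
          _ = _ := by ring
  obtain ⟨a, b, hb, hab, h1, h2⟩ := key s
  have hcard : (1 : ℝ) ≤ s.card := by exact_mod_cast hs.card_pos
  have hS : 0 ≤ ∑ i ∈ s, logSize (f i) := Finset.sum_nonneg fun i _ => logSize_nonneg _
  rw [hab]
  by_cases ha : a = 0
  · rw [ha, Int.cast_zero, zero_div, logSize_zero]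
    have := log_nonneg hcard
    linarith
  refine (logSize_div_le a b ha hb).trans ?_
  rw [Nat.cast_natAbs, Nat.cast_natAbs, Int.cast_abs, Int.cast_abs]
  have h3 : log |(b : ℝ)| ≤ ∑ i ∈ s, logSize (f i) := by
    rwa [log_le_iff_le_exp (abs_pos.2 (by exact_mod_cast hb))]
  have h4 : log |(a : ℝ)| ≤ log s.card + ∑ i ∈ s, logSize (f i) := by
    rw [log_le_iff_le_exp (abs_pos.2 (by exact_mod_cast ha)), exp_add, exp_log (by linarith)]
    exact h2
  linarith

lemma logSize_prod_le {σ : Type*} (s : Finset σ) (f : σ → ℚ) :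
    logSize (∏ i ∈ s, f i) ≤ ∑ i ∈ s, logSize (f i) := by
  classical
  induction s using Finset.induction_on with
  | empty => simp [logSize_one]
  | insert i s hi ih =>
    rw [Finset.prod_insert hi, Finset.sum_insert hi]
    exact (logSize_mul_le _ _).trans (by linarith)

/-- Comparison of sizes of two quotients `b ^ E / b' ^ F` and `b ^ E₀ / b' ^ F₀` in terms of
their logarithms. -/
lemma logSize_quotient_compare (b b' : ℕ) (hb : 2 ≤ b) (hb' : 2 ≤ b') (E F E₀ F₀ : ℤ) :
    |(E₀ : ℝ)| * logSize ((b : ℚ) ^ E / (b' : ℚ) ^ F) ≤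
      |(E : ℝ)| * logSize ((b : ℚ) ^ E₀ / (b' : ℚ) ^ F₀) +
      |(E₀ : ℝ)| * |log (((b : ℚ) ^ E / (b' : ℚ) ^ F : ℚ) : ℝ)| +
      |(E : ℝ)| * |log (((b : ℚ) ^ E₀ / (b' : ℚ) ^ F₀ : ℚ) : ℝ)| := by
  have hb0 : (b : ℚ) ≠ 0 := by positivity
  have hb0' : (b' : ℚ) ≠ 0 := by positivity
  set x : ℚ := (b : ℚ) ^ E / (b' : ℚ) ^ F with hx
  set x₀ : ℚ := (b : ℚ) ^ E₀ / (b' : ℚ) ^ F₀ with hx₀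
  have hx0 : (x : ℝ) ≠ 0 := by
    exact_mod_cast div_ne_zero (zpow_ne_zero _ hb0) (zpow_ne_zero _ hb0')
  have hx00 : (x₀ : ℝ) ≠ 0 := by
    exact_mod_cast div_ne_zero (zpow_ne_zero _ hb0) (zpow_ne_zero _ hb0')
  have h1 : x ^ E₀ = x₀ ^ E * (b' : ℚ) ^ (F₀ * E - F * E₀) := by
    rw [hx, hx₀, div_zpow, div_zpow, ← zpow_mul, ← zpow_mul, ← zpow_mul, ← zpow_mul,
      zpow_sub₀ hb0', mul_comm E₀ E]
    have := zpow_ne_zero (F₀ * E) hb0'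
    field_simp
  have h2 : logSize ((b' : ℚ) ^ (F₀ * E - F * E₀)) ≤
      |(E₀ : ℝ)| * |log (x : ℝ)| + |(E : ℝ)| * |log (x₀ : ℝ)| := by
    rw [logSize_natCast_zpow]
    have h3 : (b' : ℚ) ^ (F₀ * E - F * E₀) = x ^ E₀ / x₀ ^ E := by
      rw [h1, mul_div_cancel_left₀]
      exact zpow_ne_zero _ (by exact_mod_cast hx00)
    rw [h3]
    push_cast
    rw [log_div (zpow_ne_zero _ hx0) (zpow_ne_zero _ hx00), log_zpow, log_zpow,
      ← abs_mul, ← abs_mul]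
    exact abs_sub _ _
  rw [← logSize_zpow, ← logSize_zpow, h1]
  exact (logSize_mul_le _ _).trans (by linarith)

end Size

section Framework

variable {ι : Type*}

/-- The values `β i ^ e i`. -/
def expVal (β : ι → ℕ) (e : ι → ℤ) (i : ι) : ℚ := (β i : ℚ) ^ e i

/-- `e` gives a solution of `∑ a i * β i ^ e i = 0` over `I` without vanishing proper subsums. -/
def IsNondegSol (β : ι → ℕ) (I : Finset ι) (a : ι → ℚ) (e : ι → ℤ) : Prop :=
  ∑ i ∈ I, a i * expVal β e i = 0 ∧
    ∀ J, J ⊂ I → J.Nonempty → ∑ i ∈ J, a i * expVal β e i ≠ 0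

/-- Two exponent vectors give proportional values over `I`. -/
def IsPropOn (β : ι → ℕ) (I : Finset ι) (e e' : ι → ℤ) : Prop :=
  ∀ i ∈ I, ∀ j ∈ I, expVal β e i * expVal β e' j = expVal β e j * expVal β e' i

/-- A finite family of pairwise non-proportional nondegenerate solutions. -/
def IsSolFamily (β : ι → ℕ) (I : Finset ι) (a : ι → ℚ) (F : Finset (ι → ℤ)) : Prop :=
  (∀ e ∈ F, IsNondegSol β I a e) ∧ ∀ e ∈ F, ∀ e' ∈ F, IsPropOn β I e e' → e = e'

/-- Families of pairwise non-proportional solutions of `n`-term equations have size at most `c`. -/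
def SolBound (β : ι → ℕ) (n c : ℕ) : Prop :=
  ∀ I : Finset ι, I.card = n → ∀ (a : ι → ℚ) (F : Finset (ι → ℤ)), IsSolFamily β I a F → F.card ≤ c

/-- The linear relations of the family are not all proportional to `a`. -/
def IsNonspanning (β : ι → ℕ) (I : Finset ι) (a : ι → ℚ) (p : Finset (ι → ℤ)) : Prop :=
  ∃ b : ι → ℚ, (∀ e ∈ p, ∑ i ∈ I, b i * expVal β e i = 0) ∧
    ∃ i ∈ I, ∃ j ∈ I, a i * b j ≠ a j * b i

variable {β : ι → ℕ}

lemma expVal_pos (hβ : ∀ i, 2 ≤ β i) (e : ι → ℤ) (i : ι) : 0 < expVal β e i :=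
  zpow_pos (by have := hβ i; positivity) _

lemma expVal_ne_zero (hβ : ∀ i, 2 ≤ β i) (e : ι → ℤ) (i : ι) : expVal β e i ≠ 0 :=
  (expVal_pos hβ e i).ne'

lemma expVal_sub (hβ : ∀ i, 2 ≤ β i) (e e' : ι → ℤ) (i : ι) :
    expVal β (e - e') i = expVal β e i / expVal β e' i :=
  zpow_sub₀ (by have := hβ i; positivity) _ _

lemma IsPropOn.refl (I : Finset ι) (e : ι → ℤ) : IsPropOn β I e e :=
  fun _ _ _ _ => mul_comm _ _

lemma IsPropOn.symm {I : Finset ι} {e e' : ι → ℤ} (h : IsPropOn β I e e') : IsPropOn β I e' e :=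
  fun i hi j hj => by linear_combination -h i hi j hj

lemma IsPropOn.trans (hβ : ∀ i, 2 ≤ β i) {I : Finset ι} {e e' e'' : ι → ℤ}
    (h : IsPropOn β I e e') (h' : IsPropOn β I e' e'') : IsPropOn β I e e'' := by
  intro i hi j hj
  have h1 := h i hi j hj
  have h2 := h' i hi j hj
  refine mul_right_cancel₀ (mul_ne_zero (expVal_ne_zero hβ e' i) (expVal_ne_zero hβ e' j)) ?_
  linear_combination (expVal β e' i * expVal β e'' j) * h1 + (expVal β e j * expVal β e' i) * h2

lemma IsNondegSol.coeff_ne_zero {I : Finset ι} {a : ι → ℚ} {e : ι → ℤ} (h : IsNondegSol β I a e)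
    (hI : 2 ≤ I.card) {i : ι} (hi : i ∈ I) : a i ≠ 0 := by
  intro h0
  refine h.2 {i} ?_ (Finset.singleton_nonempty i) (by simp [h0])
  refine (Finset.ssubset_iff_subset_ne).2 ⟨Finset.singleton_subset_iff.2 hi, ?_⟩
  rintro rfl
  simp at hI

lemma IsSolFamily.mono {I : Finset ι} {a : ι → ℚ} {F G : Finset (ι → ℤ)} (h : IsSolFamily β I a F)
    (hG : G ⊆ F) : IsSolFamily β I a G :=
  ⟨fun e he => h.1 e (hG he), fun e he e' he' => h.2 e (hG he) e' (hG he')⟩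

lemma SolBound.mono {n c d : ℕ} (h : SolBound β n c) (hcd : c ≤ d) : SolBound β n d :=
  fun I hI a F hF => (h I hI a F hF).trans hcd

lemma IsNonspanning.mono {I : Finset ι} {a : ι → ℚ} {p q : Finset (ι → ℤ)}
    (h : IsNonspanning β I a q) (hpq : p ⊆ q) : IsNonspanning β I a p := by
  obtain ⟨b, hb, h⟩ := h
  exact ⟨b, fun e he => hb e (hpq he), h⟩

/-- Every finite family has a pairwise unrelated subfamily that covers it. -/
lemma exists_unrelated_cover {α : Type*} (r : α → α → Prop) (hr : ∀ x, r x x)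
    (hsymm : ∀ x y, r x y → r y x) (F : Finset α) :
    ∃ G ⊆ F, (∀ x ∈ G, ∀ y ∈ G, r x y → x = y) ∧ ∀ x ∈ F, ∃ y ∈ G, r x y := by
  classical
  induction F using Finset.induction_on with
  | empty => exact ⟨∅, by simp⟩
  | insert x F hx ih =>
    obtain ⟨G, hGF, hG, hcov⟩ := ih
    by_cases h : ∃ y ∈ G, r x y
    · refine ⟨G, hGF.trans (Finset.subset_insert _ _), hG, fun z hz => ?_⟩
      rcases Finset.mem_insert.1 hz with rfl | hz
      · exact h
      · exact hcov z hz
    · push Not at h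
      refine ⟨insert x G, Finset.insert_subset_insert _ hGF, ?_, fun z hz => ?_⟩
      · intro y hy z hz hyz
        rcases Finset.mem_insert.1 hy with h1 | h1 <;> rcases Finset.mem_insert.1 hz with h2 | h2
        · rw [h1, h2]
        · exact absurd (h1 ▸ hyz) (h z h2)
        · exact absurd (hsymm _ _ (h2 ▸ hyz)) (h y h1)
        · exact hG y h1 z h2 hyz
      · rcases Finset.mem_insert.1 hz with rfl | hz
        · exact ⟨z, Finset.mem_insert_self _ _, hr z⟩
        · obtain ⟨y, hy, hzy⟩ := hcov z hz
          exact ⟨y, Finset.mem_insert_of_mem hy, hzy⟩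

/-- A covered family is at most as large as the sum of its pieces. -/
lemma card_le_mul_of_cover {α γ : Type*} (F : Finset α) (G : Finset γ) (r : α → γ → Prop)
    (c : ℕ) (hcov : ∀ x ∈ F, ∃ y ∈ G, r x y)
    (hc : ∀ y ∈ G, ∀ p ⊆ F, (∀ x ∈ p, r x y) → p.card ≤ c) : F.card ≤ G.card * c := by
  classical
  have h1 : F ⊆ G.biUnion fun y => F.filter fun x => r x y := by
    intro x hx
    obtain ⟨y, hy, h⟩ := hcov x hx
    exact Finset.mem_biUnion.2 ⟨y, hy, Finset.mem_filter.2 ⟨hx, h⟩⟩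
  refine (Finset.card_le_card h1).trans (Finset.card_biUnion_le_card_mul _ _ _ fun y hy => ?_)
  exact hc y hy _ (Finset.filter_subset _ _) fun x hx => (Finset.mem_filter.1 hx).2

/-- A nonempty vanishing sum contains a minimal one. -/
lemma exists_minimal_vanishing (S : Finset ι) (hS : S.Nonempty) (a : ι → ℚ) (e : ι → ℤ)
    (h : ∑ i ∈ S, a i * expVal β e i = 0) :
    ∃ J ⊆ S, J.Nonempty ∧ IsNondegSol β J a e := by
  induction S using Finset.strongInduction with
  | H S ih =>
    by_cases hmin : IsNondegSol β S a e
    · exact ⟨S, subset_rfl, hS, hmin⟩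
    · simp only [IsNondegSol, h, true_and, not_forall, not_not] at hmin
      obtain ⟨J, hJ, hJ0, hJs⟩ := hmin
      obtain ⟨J', hJ', h1⟩ := ih J hJ hJ0 hJs
      exact ⟨J', hJ'.trans hJ.1, h1⟩

variable [DecidableEq ι]

/-- Merging the terms of `J`, on which all members are proportional to `ω`, into a single term. -/
lemma card_le_of_isPropOn (hβ : ∀ i, 2 ≤ β i) {I J : Finset ι} {a : ι → ℚ} {F : Finset (ι → ℤ)}
    (hF : IsSolFamily β I a F) (hJI : J ⊆ I) (hJ : 1 ≤ J.card) (ω : ι → ℤ)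
    (hω : ∀ e ∈ F, IsPropOn β J e ω) {c : ℕ} (hc : SolBound β (I.card - J.card + 1) c) :
    F.card ≤ c := by
  obtain ⟨j, hj⟩ := Finset.card_pos.1 hJ
  have hjI := hJI hj
  set a' : ι → ℚ := Function.update a j (∑ i ∈ J, a i * expVal β ω i / expVal β ω j) with ha'
  have hjJ : j ∉ I \ J := fun h => (Finset.mem_sdiff.1 h).2 hj
  have hcard : (insert j (I \ J)).card = I.card - J.card + 1 := by
    rw [Finset.card_insert_of_notMem hjJ, Finset.card_sdiff_of_subset hJI]
  have hmerge : ∀ e ∈ F, a' j * expVal β e j = ∑ i ∈ J, a i * expVal β e i := by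
    intro e he
    rw [ha', Function.update_self, Finset.sum_mul]
    refine Finset.sum_congr rfl fun i hi => ?_
    have := hω e he i hi j hj
    rw [div_mul_eq_mul_div, div_eq_iff (expVal_ne_zero hβ ω j)]
    linear_combination -(a i) * this
  have hother : ∀ i, i ≠ j → a' i = a i := fun i hi => Function.update_of_ne hi _ _
  have hsum1 : ∀ e, ∀ S, j ∉ S → ∑ i ∈ S, a' i * expVal β e i = ∑ i ∈ S, a i * expVal β e i :=
    fun e S hS => Finset.sum_congr rfl fun i hi => by
      rw [hother i (fun h => hS (h ▸ hi))]
  have hsum2 : ∀ e ∈ F, ∀ S, j ∉ S → Disjoint J S →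
      ∑ i ∈ insert j S, a' i * expVal β e i = ∑ i ∈ J ∪ S, a i * expVal β e i := by
    intro e he S hS hd
    rw [Finset.sum_insert hS, hsum1 e S hS, hmerge e he, Finset.sum_union hd]
  refine hc (insert j (I \ J)) hcard a' F
    ⟨fun e he => ⟨?_, fun S hS hS0 => ?_⟩, fun e he e' he' h => ?_⟩
  · rw [hsum2 e he _ hjJ Finset.disjoint_sdiff, Finset.union_sdiff_of_subset hJI]
    exact (hF.1 e he).1
  · by_cases hjS : j ∈ S
    · obtain ⟨S', hjS', rfl⟩ : ∃ S', j ∉ S' ∧ insert j S' = S :=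
        ⟨S.erase j, Finset.notMem_erase _ _, Finset.insert_erase hjS⟩
      have hS'sub : S' ⊂ I \ J := by
        refine ⟨fun i hi => ?_, fun h => hS.2 (Finset.insert_subset_insert _ h)⟩
        rcases Finset.mem_insert.1 (hS.1 (Finset.mem_insert_of_mem hi)) with rfl | h
        · exact absurd hi hjS'
        · exact h
      have hd : Disjoint J S' := Finset.disjoint_sdiff.mono_right hS'sub.1
      rw [hsum2 e he _ hjS' hd]
      refine (hF.1 e he).2 _ ⟨?_, fun h => ?_⟩ ⟨j, Finset.mem_union_left _ hj⟩
      · exact Finset.union_subset hJI (hS'sub.1.trans Finset.sdiff_subset)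
      · refine hS'sub.2 fun i hi => ?_
        rcases Finset.mem_union.1 (h (Finset.mem_sdiff.1 hi).1) with h | h
        · exact absurd h (Finset.mem_sdiff.1 hi).2
        · exact h
    · rw [hsum1 e S hjS]
      have hsub : S ⊆ I \ J := fun i hi => by
        rcases Finset.mem_insert.1 (hS.1 hi) with rfl | h
        · exact absurd hi hjS
        · exact h
      refine (hF.1 e he).2 _ ⟨hsub.trans Finset.sdiff_subset, fun h => ?_⟩ hS0
      exact hjS (h hjI)
  · refine hF.2 e he e' he' ?_
    have hJe : IsPropOn β J e e' := (hω e he).trans hβ (hω e' he').symm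
    have hlink : ∀ i ∈ I, expVal β e i * expVal β e' j = expVal β e j * expVal β e' i := by
      intro i hi
      by_cases hiJ : i ∈ J
      · exact hJe i hiJ j hj
      · exact h i (Finset.mem_insert_of_mem (Finset.mem_sdiff.2 ⟨hi, hiJ⟩)) j
          (Finset.mem_insert_self _ _)
    intro i hi i' hi'
    have h1 := hlink i hi
    have h2 := hlink i' hi'
    refine mul_right_cancel₀ (mul_ne_zero (expVal_ne_zero hβ e j) (expVal_ne_zero hβ e' j)) ?_
    linear_combination (expVal β e' i' * expVal β e j) * h1 - (expVal β e' i * expVal β e j) * h2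

/-- Non-spanning families are controlled by equations with fewer terms. -/
lemma card_le_of_isNonspanning (hβ : ∀ i, 2 ≤ β i) {N K : ℕ} (hN : 3 ≤ N)
    (ih : ∀ n, 2 ≤ n → n < N → SolBound β n (K ^ (n - 2))) {I : Finset ι} (hI : I.card = N)
    {a : ι → ℚ} {F : Finset (ι → ℤ)} (hF : IsSolFamily β I a F) (hns : IsNonspanning β I a F) :
    F.card ≤ 2 ^ N * K ^ (N - 3) := by
  obtain ⟨b, hb, i₀, hi₀, j₀, hj₀, hij⟩ := hns
  set b' : ι → ℚ := fun i => a i₀ * b i - b i₀ * a i with hb'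
  have hb'i : b' i₀ = 0 := by simp only [hb']; ring
  have hb'j : b' j₀ ≠ 0 := by
    simp only [hb']; intro h; apply hij; linear_combination h
  set S := I.filter fun i => b' i ≠ 0 with hS
  have hSI : S ⊆ I.erase i₀ := by
    intro i hi
    rw [hS, Finset.mem_filter] at hi
    refine Finset.mem_erase.2 ⟨?_, hi.1⟩
    rintro rfl
    exact hi.2 hb'i
  have hcov : ∀ e ∈ F, ∃ J ∈ I.powerset, J ⊆ S ∧ J.Nonempty ∧ IsNondegSol β J b' e := by
    intro e he
    have h0 : ∑ i ∈ S, b' i * expVal β e i = 0 := by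
      have h1 : ∑ i ∈ I, b' i * expVal β e i = 0 := by
        have h2 : ∑ i ∈ I, b' i * expVal β e i =
            a i₀ * ∑ i ∈ I, b i * expVal β e i - b i₀ * ∑ i ∈ I, a i * expVal β e i := by
          rw [Finset.mul_sum, Finset.mul_sum, ← Finset.sum_sub_distrib]
          exact Finset.sum_congr rfl fun i _ => by simp only [hb']; ring
        rw [h2, hb e he, (hF.1 e he).1, mul_zero, mul_zero, sub_zero]
      rw [← h1, hS, Finset.sum_filter]
      refine Finset.sum_congr rfl fun i _ => ?_
      split_ifs with h
      · rfl
      · rw [not_not.1 h, zero_mul]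
    obtain ⟨J, hJ, h1, h2⟩ := exists_minimal_vanishing S
      ⟨j₀, Finset.mem_filter.2 ⟨hj₀, hb'j⟩⟩ b' e h0
    exact ⟨J, Finset.mem_powerset.2 (hJ.trans (Finset.filter_subset _ _)), hJ, h1, h2⟩
  have := card_le_mul_of_cover F I.powerset
    (fun e J => J ⊆ S ∧ J.Nonempty ∧ IsNondegSol β J b' e) (K ^ (N - 3)) hcov ?_
  · rwa [Finset.card_powerset, hI] at this
  intro J hJ p hp hpJ
  rcases p.eq_empty_or_nonempty with rfl | ⟨e₀, he₀⟩
  · simp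
  obtain ⟨hJS, hJ0, hJe⟩ := hpJ e₀ he₀
  have hJcard : J.card ≤ N - 1 := by
    have := Finset.card_le_card (hJS.trans hSI)
    rwa [Finset.card_erase_of_mem hi₀, hI] at this
  have hJ2 : 2 ≤ J.card := by
    by_contra hlt
    have h1 : J.card = 1 := by
      have := hJ0.card_pos
      omega
    obtain ⟨j, rfl⟩ := Finset.card_eq_one.1 h1
    have h2 := hJe.1
    rw [Finset.sum_singleton] at h2
    exact mul_ne_zero (Finset.mem_filter.1 (hJS (Finset.mem_singleton_self j))).2
      (expVal_ne_zero hβ _ _) h2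
  obtain ⟨Ω, hΩp, hΩ, hΩcov⟩ := exists_unrelated_cover (IsPropOn β J) (IsPropOn.refl J)
    (fun _ _ => IsPropOn.symm) p
  have hΩcard : Ω.card ≤ K ^ (J.card - 2) :=
    ih J.card hJ2 (by omega) J rfl b' Ω ⟨fun e he => (hpJ e (hΩp he)).2.2, hΩ⟩
  have h1 := card_le_mul_of_cover p Ω (IsPropOn β J) (K ^ (N - J.card - 1)) hΩcov (by
    intro ω _ q hq hqω
    refine card_le_of_isPropOn hβ (hF.mono (hq.trans hp)) (Finset.mem_powerset.1 hJ) (by omega) ω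
      hqω ?_
    have := ih (N - J.card + 1) (by omega) (by omega)
    rwa [hI, show N - J.card - 1 = N - J.card + 1 - 2 by omega])
  calc p.card ≤ _ := h1
    _ ≤ K ^ (J.card - 2) * K ^ (N - J.card - 1) := Nat.mul_le_mul_right _ hΩcard
    _ = K ^ (N - 3) := by rw [← pow_add]; congr 1; omega

end Framework

section Heights
open Real

lemma logSize_det_le {κ : Type*} [Fintype κ] [DecidableEq κ] (A : Matrix κ κ ℚ) (d : ℝ)
    (hA : ∀ i j, logSize (A i j) ≤ d) :
    logSize A.det ≤ log (Fintype.card κ).factorial +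
      2 * ((Fintype.card κ).factorial * (Fintype.card κ * d)) := by
  rw [Matrix.det_apply']
  refine (logSize_sum_le _ Finset.univ_nonempty _).trans ?_
  have h1 : ∀ σ ∈ (Finset.univ : Finset (Equiv.Perm κ)),
      logSize (((Equiv.Perm.sign σ : ℤ) : ℚ) * ∏ i, A (σ i) i) ≤ Fintype.card κ * d := by
    intro σ _
    have h2 : logSize (((Equiv.Perm.sign σ : ℤ) : ℚ) * ∏ i, A (σ i) i) =
        logSize (∏ i, A (σ i) i) := by
      rcases Int.units_eq_one_or (Equiv.Perm.sign σ) with h | h <;> simp [h, logSize_neg]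
    rw [h2]
    refine (logSize_prod_le _ _).trans ((Finset.sum_le_sum fun i _ => hA (σ i) i).trans ?_)
    simp
  have h3 := Finset.sum_le_sum h1
  rw [Finset.sum_const, nsmul_eq_mul, Finset.card_univ, Fintype.card_perm] at h3
  rw [Finset.card_univ, Fintype.card_perm]
  linarith

variable {ι : Type*} {β : ι → ℕ}

/-- If a family of solutions spans, then the coefficients are bounded in terms of the values. -/
lemma logSize_coeff_ratio_le [DecidableEq ι] (hβ : ∀ i, 2 ≤ β i) {I : Finset ι} {a : ι → ℚ}
    (ha : ∀ i ∈ I, a i ≠ 0) {p : Finset (ι → ℤ)} (hp : ∀ e ∈ p, ∑ i ∈ I, a i * expVal β e i = 0)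
    (f : ι → ℤ) {d : ℝ} (hd0 : 0 ≤ d)
    (hd : ∀ e ∈ p, ∀ i ∈ I, ∀ j ∈ I, logSize (expVal β (e - f) i / expVal β (e - f) j) ≤ d)
    (hns : ¬ IsNonspanning β I a p) {M : ℕ} (hM : I.card ≤ M) {i j : ι} (hi : i ∈ I) (hj : j ∈ I) :
    logSize ((a i * expVal β f i) / (a j * expVal β f j)) ≤
      4 * (M.factorial * M) * d + 2 * (M.factorial * M) := by
  classical
  have hγ : ∀ i ∈ I, a i * expVal β f i ≠ 0 :=
    fun i hi => mul_ne_zero (ha i hi) (expVal_ne_zero hβ f i)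
  by_cases hij : i = j
  · rw [hij, div_self (hγ j hj), logSize_one]; positivity
  let κ := {i // i ∈ I.erase j}
  let r : (ι → ℤ) → κ → ℚ := fun e i => expVal β (e - f) i / expVal β (e - f) j
  have hspan : Submodule.span ℚ (r '' (p : Set (ι → ℤ))) = ⊤ := by
    by_contra hne
    obtain ⟨φ, hφ0, hφ⟩ := Submodule.exists_le_ker_of_lt_top _ (lt_top_iff_ne_top.2 hne)
    apply hns
    let b : ι → ℚ := fun i => if h : i ∈ I.erase j then φ (Pi.single ⟨i, h⟩ 1) / expVal β f i else 0
    have hbj : b j = 0 := by simp [b]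
    have hbk : ∀ k : κ, b k = φ (Pi.single k 1) / expVal β f k := fun k => by
      simp only [b]; rw [dif_pos k.2]
    refine ⟨b, fun e he => ?_, ?_⟩
    · have h1 : φ (r e) = 0 := hφ (Submodule.subset_span ⟨e, he, rfl⟩)
      rw [LinearMap.pi_apply_eq_sum_univ φ (r e)] at h1
      rw [← Finset.add_sum_erase I _ hj, hbj, zero_mul, zero_add, ← Finset.sum_coe_sort]
      have h2 : ∀ k : κ, b k * expVal β e k =
          (r e k • φ fun m => if k = m then 1 else 0) * expVal β (e - f) j := by
        intro k
        have h3 : (fun m => if k = m then (1 : ℚ) else 0) = Pi.single k 1 := by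
          ext m
          by_cases h : k = m
          · subst h; simp
          · simp [h, Ne.symm h]
        rw [hbk, h3, smul_eq_mul]
        simp only [r]
        have h4 := expVal_ne_zero hβ f (k : ι)
        have h5 := expVal_ne_zero hβ (e - f) j
        rw [expVal_sub hβ e f k]
        field_simp
      rw [Finset.sum_congr rfl fun k _ => h2 k, ← Finset.sum_mul, h1, zero_mul]
    · obtain ⟨k, hk⟩ : ∃ k : κ, φ (Pi.single k 1) ≠ 0 := by
        by_contra hall
        push Not at hall
        apply hφ0
        refine LinearMap.pi_ext' fun k => LinearMap.ext_ring ?_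
        simpa using hall k
      refine ⟨j, hj, k, Finset.mem_of_mem_erase k.2, ?_⟩
      rw [hbj, mul_zero, hbk]
      exact mul_ne_zero (ha j hj) (div_ne_zero hk (expVal_ne_zero hβ f _))
  obtain ⟨g, hg, -, hgl⟩ := Submodule.exists_fun_fin_finrank_span_eq ℚ (r '' (p : Set (ι → ℤ)))
  have hfin : Module.finrank ℚ (Submodule.span ℚ (r '' (p : Set (ι → ℤ)))) = Fintype.card κ := by
    rw [hspan, finrank_top, Module.finrank_fintype_fun_eq_card]
  let ψ : κ ≃ Fin (Module.finrank ℚ (Submodule.span ℚ (r '' (p : Set (ι → ℤ))))) :=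
    (Fintype.equivFin κ).trans (finCongr hfin.symm)
  choose h hh1 hh2 using hg
  let A : Matrix κ κ ℚ := Matrix.of fun k m => r (h (ψ k)) m
  have hAdet : A.det ≠ 0 := by
    have : LinearIndependent ℚ A.row := by
      have h1 : A.row = g ∘ ψ := by
        ext k m
        change r (h (ψ k)) m = g (ψ k) m
        rw [hh2]
      rw [h1]
      exact hgl.comp _ ψ.injective
    exact ((Matrix.isUnit_iff_isUnit_det _).1
      (Matrix.linearIndependent_rows_iff_isUnit.1 this)).ne_zero
  have hAd : ∀ k m, logSize (A k m) ≤ d := fun k m =>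
    hd _ (hh1 _) _ (Finset.mem_of_mem_erase m.2) _ hj
  let x : κ → ℚ := fun k => (a k * expVal β f k) / (a j * expVal β f j)
  have hAx : A.mulVec x = fun _ => -1 := by
    ext k
    have h1 := hp _ (hh1 (ψ k))
    rw [← Finset.add_sum_erase I _ hj, ← Finset.sum_coe_sort] at h1
    have h2 : ∀ m : κ, A k m * x m =
        (a m * expVal β (h (ψ k)) m) / (a j * expVal β (h (ψ k)) j) := by
      intro m
      change expVal β (h (ψ k) - f) m / expVal β (h (ψ k) - f) j * _ = _
      rw [expVal_sub hβ, expVal_sub hβ]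
      have h4 := expVal_ne_zero hβ f (m : ι)
      have h5 := expVal_ne_zero hβ f j
      have h6 := expVal_ne_zero hβ (h (ψ k)) j
      have h7 := ha j hj
      simp only [x]
      field_simp
    rw [Matrix.mulVec, dotProduct, Finset.sum_congr rfl fun m _ => h2 m, ← Finset.sum_div,
      div_eq_iff (mul_ne_zero (ha j hj) (expVal_ne_zero hβ _ _))]
    linarith
  have hcr : ∀ k, x k = (A.updateCol k fun _ => -1).det / A.det := by
    intro k
    rw [eq_div_iff hAdet, ← Matrix.cramer_apply, ← hAx, Matrix.cramer_eq_adjugate_mulVec,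
      Matrix.mulVec_mulVec, Matrix.adjugate_mul, Matrix.smul_mulVec, Matrix.one_mulVec]
    simp [mul_comm]
  have hik : i ∈ I.erase j := Finset.mem_erase.2 ⟨hij, hi⟩
  have hx := hcr ⟨i, hik⟩
  change (a i * expVal β f i) / (a j * expVal β f j) = _ at hx
  rw [hx]
  refine (logSize_div_le_add _ _).trans ?_
  have hd1 := logSize_det_le A d hAd
  have hd2 := logSize_det_le (A.updateCol ⟨i, hik⟩ fun _ => -1) d (by
    intro k m
    rw [Matrix.updateCol_apply]
    split_ifs
    · rw [logSize_neg, logSize_one]; exact hd0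
    · exact hAd k m)
  have hn : Fintype.card κ ≤ M := by
    rw [Fintype.card_coe]
    exact (Finset.card_le_card (Finset.erase_subset _ _)).trans hM
  have hM1 : 1 ≤ M := le_trans (Finset.card_pos.2 ⟨i, hi⟩) hM
  have hf1 : ((Fintype.card κ).factorial : ℝ) ≤ M.factorial := by
    exact_mod_cast Nat.factorial_le hn
  have hf2 : (Fintype.card κ : ℝ) ≤ M := by exact_mod_cast hn
  have hf3 : ((Fintype.card κ).factorial * (Fintype.card κ * d) : ℝ) ≤ M.factorial * (M * d) := by
    gcongr
  have hf4 : log (Fintype.card κ).factorial ≤ M.factorial * M := by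
    refine (log_le_self (by positivity)).trans (hf1.trans ?_)
    have : (1 : ℝ) ≤ M := by exact_mod_cast hM1
    nlinarith [(Nat.cast_nonneg M.factorial : (0 : ℝ) ≤ _)]
  linarith

end Heights

section Spread
open Real

variable {ι : Type*} {β : ι → ℕ}

/-- The largest size of a quotient of two of the values `β i ^ e i`, `i ∈ I`. -/
noncomputable def spread (β : ι → ℕ) (I : Finset ι) (e : ι → ℤ) : ℝ :=
  sSup ((fun p : ι × ι => logSize (expVal β e p.1 / expVal β e p.2)) ''
    ((I ×ˢ I : Finset _) : Set _))

lemma logSize_le_spread {I : Finset ι} (e : ι → ℤ) {i j : ι} (hi : i ∈ I) (hj : j ∈ I) :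
    logSize (expVal β e i / expVal β e j) ≤ spread β I e :=
  le_csSup ((Finset.finite_toSet _).image _).bddAbove
    ⟨(i, j), by simp [hi, hj], rfl⟩

lemma exists_eq_spread {I : Finset ι} (hI : I.Nonempty) (e : ι → ℤ) :
    ∃ i ∈ I, ∃ j ∈ I, spread β I e = logSize (expVal β e i / expVal β e j) := by
  obtain ⟨⟨i, j⟩, hij, h⟩ := Set.Nonempty.csSup_mem
    (s := (fun p : ι × ι => logSize (expVal β e p.1 / expVal β e p.2)) ''
      ((I ×ˢ I : Finset _) : Set _))
    (by
      obtain ⟨i, hi⟩ := hI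
      exact ⟨_, (i, i), by simp [hi], rfl⟩) ((Finset.finite_toSet _).image _)
  simp only [Finset.coe_product, Set.mem_prod, Finset.mem_coe] at hij
  exact ⟨i, hij.1, j, hij.2, h.symm⟩

lemma spread_le {I : Finset ι} (hI : I.Nonempty) {e : ι → ℤ} {d : ℝ}
    (h : ∀ i ∈ I, ∀ j ∈ I, logSize (expVal β e i / expVal β e j) ≤ d) : spread β I e ≤ d := by
  obtain ⟨i, hi, j, hj, hij⟩ := exists_eq_spread (β := β) hI e
  rw [hij]; exact h i hi j hj

lemma isPropOn_of_spread_lt (hβ : ∀ i, 2 ≤ β i) {I : Finset ι} {e f : ι → ℤ}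
    (h : spread β I (e - f) < log 2) : IsPropOn β I e f := by
  intro i hi j hj
  have h1 : expVal β (e - f) i / expVal β (e - f) j = 1 := by
    by_contra hne
    have := log_two_le_logSize _ (div_pos (expVal_pos hβ _ _) (expVal_pos hβ _ _)) hne
    linarith [logSize_le_spread (β := β) (e - f) hi hj]
  rw [div_eq_one_iff_eq (expVal_ne_zero hβ _ _), expVal_sub hβ, expVal_sub hβ,
    div_eq_div_iff (expVal_ne_zero hβ _ _) (expVal_ne_zero hβ _ _)] at h1
  exact h1

lemma isNonspanning_singleton [DecidableEq ι] (hβ : ∀ i, 2 ≤ β i) {I : Finset ι} (hI : 3 ≤ I.card)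
    {a : ι → ℚ} (ha : ∀ i ∈ I, a i ≠ 0) (e : ι → ℤ) : IsNonspanning β I a {e} := by
  obtain ⟨i, j, k, hi, hj, hk, hij, hik, hjk⟩ := Finset.two_lt_card_iff.1 (show 2 < I.card from hI)
  refine ⟨Pi.single i (expVal β e j) - Pi.single j (expVal β e i), fun f hf => ?_, k, hk, i, hi, ?_⟩
  · rw [Finset.mem_singleton.1 hf]
    simp only [Pi.sub_apply, sub_mul, Finset.sum_sub_distrib]
    rw [Finset.sum_eq_single i (by intro m _ hm; simp [hm]) (fun h => absurd hi h),
      Finset.sum_eq_single j (by intro m _ hm; simp [hm]) (fun h => absurd hj h)]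
    simp [mul_comm]
  · simp [hij, hik.symm, hjk.symm, ha k hk, expVal_ne_zero hβ]

open Classical in
/-- A spanning family contains a smallest spanning ball. -/
lemma exists_minimal_spanning_ball [DecidableEq ι] (hβ : ∀ i, 2 ≤ β i) {I : Finset ι}
    (hI : 3 ≤ I.card) {a : ι → ℚ} {F : Finset (ι → ℤ)} (hF0 : F.Nonempty) (hF : IsSolFamily β I a F)
    (hns : ¬ IsNonspanning β I a F) :
    ∃ f ∈ F, ∃ R, log 2 ≤ R ∧ ¬ IsNonspanning β I a (F.filter fun e => spread β I (e - f) ≤ R) ∧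
      ∀ p ⊆ F, ¬ IsNonspanning β I a p → ∀ e ∈ p, ∃ e' ∈ p, R ≤ spread β I (e' - e) := by
  have hI0 : I.Nonempty := Finset.card_pos.1 (by omega)
  set ball : (ι → ℤ) → ℝ → Finset (ι → ℤ) := fun f R => F.filter fun e => spread β I (e - f) ≤ R
    with hball
  have hmax : ∀ p ⊆ F, ¬ IsNonspanning β I a p → ∀ e ∈ p, ∃ e' ∈ p,
      ¬ IsNonspanning β I a (ball e (spread β I (e' - e))) := by
    intro p hp hpns e he
    obtain ⟨e', he', hmax⟩ := p.exists_max_image (fun e' => spread β I (e' - e)) ⟨e, he⟩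
    refine ⟨e', he', fun h => hpns (h.mono fun x hx => ?_)⟩
    exact Finset.mem_filter.2 ⟨hp hx, hmax x hx⟩
  set P := (F ×ˢ F).filter fun q =>
    ¬ IsNonspanning β I a (ball q.1 (spread β I (q.2 - q.1))) with hP
  have hP0 : P.Nonempty := by
    obtain ⟨e, he⟩ := hF0
    obtain ⟨e', he', h⟩ := hmax F subset_rfl hns e he
    exact ⟨(e, e'), by simp [hP, he, he', h]⟩
  obtain ⟨⟨f, g⟩, hfg, hmin⟩ := P.exists_min_image (fun q => spread β I (q.2 - q.1)) hP0
  rw [hP, Finset.mem_filter, Finset.mem_product] at hfg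
  obtain ⟨⟨hf, hg⟩, hfg⟩ := hfg
  refine ⟨f, hf, spread β I (g - f), ?_, hfg, fun p hp hpns e he => ?_⟩
  · by_contra hlt
    push Not at hlt
    refine hfg ((isNonspanning_singleton hβ hI
      (fun i hi => (hF.1 f hf).coeff_ne_zero (by omega) hi) f).mono fun e he => ?_)
    obtain ⟨he, hle⟩ := Finset.mem_filter.1 he
    exact Finset.mem_singleton.2
      (hF.2 e he f hf (isPropOn_of_spread_lt hβ (hle.trans_lt hlt)))
  · obtain ⟨e', he', h⟩ := hmax p hp hpns e he
    refine ⟨e', he', hmin (e, e') ?_⟩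
    rw [hP, Finset.mem_filter, Finset.mem_product]
    exact ⟨⟨hp he, hp he'⟩, h⟩

lemma floor_mem_Icc {x : ℝ} {m : ℕ} (hx : |x| ≤ m) : ⌊x⌋ ∈ Finset.Icc (-(m : ℤ)) m := by
  have := abs_le.1 hx
  rw [Finset.mem_Icc]
  constructor
  · rw [Int.le_floor]; push_cast; exact this.1
  · have h : (⌊x⌋ : ℝ) ≤ m := (Int.floor_le x).trans this.2
    exact_mod_cast h

/-- A family of bounded spread is partitioned into few cells of small diameter. -/
lemma exists_cells [Fintype ι] (hβ : ∀ i, 2 ≤ β i) (I : Finset ι) {Q : ℝ} (hQ : 0 < Q) {m : ℕ}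
    (hm : 1 ≤ m) (p : Finset (ι → ℤ)) (hp : ∀ e ∈ p, spread β I e ≤ Q) :
    ∃ col : (ι → ℤ) → (ι → ℤ) × (ι → ℤ), (p.image col).card ≤ (2 * m + 1) ^ (2 * Fintype.card ι) ∧
      ∀ e ∈ p, ∀ e' ∈ p, col e = col e' → ∀ i ∈ I, ∀ j ∈ I,
        logSize (expVal β (e - e') i / expVal β (e - e') j) ≤ 4 * Q / m := by
  classical
  have hm0 : (0 : ℝ) < m := by exact_mod_cast hm
  rcases p.eq_empty_or_nonempty with rfl | hp0
  · exact ⟨fun _ => (0, 0), by simp, by simp⟩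
  rcases I.eq_empty_or_nonempty with rfl | ⟨i₀, hi₀⟩
  · refine ⟨fun _ => (0, 0), ?_, by simp⟩
    refine (Finset.card_le_one.2 fun x hx y hy => ?_).trans (Nat.one_le_pow _ _ (by omega))
    obtain ⟨_, _, rfl⟩ := Finset.mem_image.1 hx
    obtain ⟨_, _, rfl⟩ := Finset.mem_image.1 hy
    rfl
  choose top htop htopmax using fun i : ι => p.exists_max_image (fun e => |(e i : ℝ)|) hp0
  let lg : (ι → ℤ) → ι → ℝ := fun e i => log ((expVal β e i / expVal β e i₀ : ℚ) : ℝ)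
  let u : (ι → ℤ) → ι → ℝ := fun e i => if i ∈ I then lg e i * m / Q else 0
  let t : (ι → ℤ) → ι → ℝ := fun e i => e i * m / |(top i i : ℝ)|
  have hlg : ∀ e ∈ p, ∀ i ∈ I, |lg e i| ≤ Q := fun e he i hi =>
    (abs_log_le_logSize _).trans ((logSize_le_spread e hi hi₀).trans (hp e he))
  have hu : ∀ e ∈ p, ∀ i, |u e i| ≤ m := by
    intro e he i
    simp only [u]
    split_ifs with hi
    · rw [abs_div, abs_mul, abs_of_pos hQ, abs_of_pos hm0, div_le_iff₀ hQ, mul_comm]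
      exact mul_le_mul_of_nonneg_left (hlg e he i hi) hm0.le
    · simp
  have ht : ∀ e ∈ p, ∀ i, |t e i| ≤ m := by
    intro e he i
    simp only [t]
    rw [abs_div, abs_mul, abs_abs, abs_of_pos hm0]
    exact div_le_of_le_mul₀ (abs_nonneg _) hm0.le (by
      rw [mul_comm]; exact mul_le_mul_of_nonneg_left (htopmax i e he) hm0.le)
  refine ⟨fun e => (fun i => ⌊u e i⌋, fun i => ⌊t e i⌋), ?_, ?_⟩
  · have hsub : p.image (fun e => ((fun i => ⌊u e i⌋, fun i => ⌊t e i⌋) : (ι → ℤ) × (ι → ℤ))) ⊆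
        (Fintype.piFinset fun _ => Finset.Icc (-(m : ℤ)) m) ×ˢ
          (Fintype.piFinset fun _ => Finset.Icc (-(m : ℤ)) m) := by
      intro x hx
      obtain ⟨e, he, rfl⟩ := Finset.mem_image.1 hx
      rw [Finset.mem_product, Fintype.mem_piFinset, Fintype.mem_piFinset]
      exact ⟨fun i => floor_mem_Icc (hu e he i), fun i => floor_mem_Icc (ht e he i)⟩
    refine (Finset.card_le_card hsub).trans ?_
    have hm2 : ((m : ℤ) + 1 - -(m : ℤ)).toNat = 2 * m + 1 := by omega
    rw [Finset.card_product, Fintype.card_piFinset, Finset.prod_const, Finset.card_univ,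
      Int.card_Icc, hm2, ← pow_add, ← two_mul]
  · intro e he e' he' hcol i hi j hj
    rw [Prod.mk.injEq] at hcol
    have hu' : ∀ i, |u e i - u e' i| < 1 := fun i =>
      Int.abs_sub_lt_one_of_floor_eq_floor (congrFun hcol.1 i)
    have ht' : |t e i - t e' i| < 1 := Int.abs_sub_lt_one_of_floor_eq_floor (congrFun hcol.2 i)
    have hlg' : ∀ i ∈ I, |lg e i - lg e' i| ≤ Q / m := by
      intro i hi
      have := hu' i
      simp only [u, if_pos hi] at this
      rw [← sub_div, ← sub_mul, abs_div, abs_mul, abs_of_pos hQ, abs_of_pos hm0,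
        div_lt_one hQ] at this
      rw [le_div_iff₀ hm0]
      exact this.le
    have hpos : ∀ (e : ι → ℤ) i, (expVal β e i : ℝ) ≠ 0 := fun e i => by
      exact_mod_cast expVal_ne_zero hβ e i
    have hlogw : |log ((expVal β (e - e') i / expVal β (e - e') j : ℚ) : ℝ)| ≤ 2 * Q / m := by
      have h1 : log ((expVal β (e - e') i / expVal β (e - e') j : ℚ) : ℝ) =
          (lg e i - lg e' i) - (lg e j - lg e' j) := by
        simp only [lg]
        rw [expVal_sub hβ, expVal_sub hβ]
        push_cast
        rw [log_div (div_ne_zero (hpos _ _) (hpos _ _)) (div_ne_zero (hpos _ _) (hpos _ _)),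
          log_div (hpos _ _) (hpos _ _), log_div (hpos _ _) (hpos _ _),
          log_div (hpos _ _) (hpos _ _),
          log_div (hpos _ _) (hpos _ _), log_div (hpos _ _) (hpos _ _),
          log_div (hpos _ _) (hpos _ _)]
        ring
      rw [h1]
      refine (abs_sub _ _).trans ((add_le_add (hlg' i hi) (hlg' j hj)).trans (le_of_eq (by ring)))
    have hpar := logSize_quotient_compare (β i) (β j) (hβ i) (hβ j) ((e - e') i) ((e - e') j)
      (top i i) (top i j)
    change _ * logSize (expVal β (e - e') i / expVal β (e - e') j) ≤
      _ * logSize (expVal β (top i) i / expVal β (top i) j) +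
      _ * |log ((expVal β (e - e') i / expVal β (e - e') j : ℚ) : ℝ)| +
      _ * |log ((expVal β (top i) i / expVal β (top i) j : ℚ) : ℝ)| at hpar
    have hQm : 0 < Q / m := div_pos hQ hm0
    by_cases h0 : (top i i : ℝ) = 0
    · have hz : ∀ f ∈ p, f i = 0 := by
        intro f hf
        have := htopmax i f hf
        rw [h0, abs_zero] at this
        exact_mod_cast abs_eq_zero.1 (le_antisymm this (abs_nonneg _))
      have h1 : expVal β (e - e') i = 1 := by
        unfold expVal
        rw [Pi.sub_apply, hz e he, hz e' he', sub_zero, zpow_zero]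
      rw [h1, one_div, logSize_inv, expVal, logSize_natCast_zpow]
      rw [h1, expVal, one_div] at hlogw
      push_cast at hlogw ⊢
      rw [log_inv, abs_neg] at hlogw
      refine hlogw.trans ?_
      rw [mul_div_assoc, mul_div_assoc]
      linarith
    · have hE : 0 < |(top i i : ℝ)| := abs_pos.2 h0
      have h1 : |(((e - e') i : ℤ) : ℝ)| ≤ |(top i i : ℝ)| / m := by
        simp only [t] at ht'
        rw [← sub_div, ← sub_mul, abs_div, abs_mul, abs_abs, abs_of_pos hm0, div_lt_one hE] at ht'
        rw [le_div_iff₀ hm0, Pi.sub_apply]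
        push_cast
        exact ht'.le
      have h2 : logSize (expVal β (top i) i / expVal β (top i) j) ≤ Q :=
        (logSize_le_spread _ hi hj).trans (hp _ (htop i))
      have h3 := (abs_log_le_logSize (expVal β (top i) i / expVal β (top i) j)).trans h2
      refine le_of_mul_le_mul_left (hpar.trans ?_) hE
      calc _ ≤ |(top i i : ℝ)| / m * Q + |(top i i : ℝ)| * (2 * Q / m) +
            |(top i i : ℝ)| / m * Q := by
            gcongr
            exact logSize_nonneg _
        _ = _ := by field_simp; ring

end Spread

section Windows
open Real

variable {ι : Type*} {β : ι → ℕ}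

/-- A solution family whose spanning subfamilies have diameter at least `R`, with coefficients of
quotient size at most `9 * L * R`. -/
structure IsNormalFamily (β : ι → ℕ) (I : Finset ι) (a : ι → ℚ) (F : Finset (ι → ℤ)) (L : ℕ)
    (R : ℝ) : Prop where
  isSolFamily : IsSolFamily β I a F
  log_two_le : log 2 ≤ R
  exists_le_spread : ∀ p ⊆ F, ¬ IsNonspanning β I a p → ∀ e ∈ p, ∃ e' ∈ p, R ≤ spread β I (e' - e)
  logSize_coeff_le : ∀ i ∈ I, ∀ j ∈ I, logSize (a i / a j) ≤ 9 * L * R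

lemma expVal_add (hβ : ∀ i, 2 ≤ β i) (e e' : ι → ℤ) (i : ι) :
    expVal β (e + e') i = expVal β e i * expVal β e' i :=
  zpow_add₀ (by have := hβ i; positivity) _ _

lemma exists_isNormalFamily [DecidableEq ι] (hβ : ∀ i, 2 ≤ β i) {I : Finset ι} (hI : 3 ≤ I.card)
    {M : ℕ} (hM : I.card ≤ M) {a : ι → ℚ} {F : Finset (ι → ℤ)} (hF0 : F.Nonempty)
    (hF : IsSolFamily β I a F) (hns : ¬ IsNonspanning β I a F) :
    ∃ (a' : ι → ℚ) (F' : Finset (ι → ℤ)) (R : ℝ), F'.card = F.card ∧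
      IsNormalFamily β I a' F' (M.factorial * M) R := by
  classical
  obtain ⟨f, hf, R, hR, hball, hmin⟩ := exists_minimal_spanning_ball hβ hI hF0 hF hns
  have ha : ∀ i ∈ I, a i ≠ 0 := fun i hi => (hF.1 f hf).coeff_ne_zero (by omega) hi
  have hterm : ∀ (e : ι → ℤ) i, a i * expVal β f i * expVal β (e - f) i = a i * expVal β e i := by
    intro e i
    rw [expVal_sub hβ]
    field_simp [expVal_ne_zero hβ f i]
  have hR0 : 1 / 2 ≤ R := by linarith [Real.log_two_gt_d9]
  refine ⟨fun i => a i * expVal β f i, F.image fun e => e - f, R,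
    Finset.card_image_of_injective _ (sub_left_injective), ⟨⟨?_, ?_⟩, hR, ?_, ?_⟩⟩
  · intro e he
    obtain ⟨e, he₁, rfl⟩ := Finset.mem_image.1 he
    simpa only [IsNondegSol, hterm] using hF.1 e he₁
  · intro e he e' he' h
    obtain ⟨e, he₁, rfl⟩ := Finset.mem_image.1 he
    obtain ⟨e', he₁', rfl⟩ := Finset.mem_image.1 he'
    rw [hF.2 e he₁ e' he₁' fun i hi j hj => ?_]
    have := h i hi j hj
    simp only [expVal_sub hβ] at this
    field_simp [expVal_ne_zero hβ f i, expVal_ne_zero hβ f j] at this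
    linear_combination this
  · intro p hp hpn e he
    have hsub : p.image (fun e => e + f) ⊆ F := by
      intro x hx
      obtain ⟨e, he, rfl⟩ := Finset.mem_image.1 hx
      obtain ⟨e', he', rfl⟩ := Finset.mem_image.1 (hp he)
      simpa using he'
    obtain ⟨e', he', h⟩ := hmin _ hsub (by
      rintro ⟨b, hb, i, hi, j, hj, hij⟩
      refine hpn ⟨fun i => b i * expVal β f i, fun e he => ?_, i, hi, j, hj, fun h => hij ?_⟩
      · rw [← hb (e + f) (Finset.mem_image_of_mem _ he)]
        refine Finset.sum_congr rfl fun i _ => ?_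
        rw [expVal_add hβ]; ring
      · refine mul_right_cancel₀ (mul_ne_zero (expVal_ne_zero hβ f i) (expVal_ne_zero hβ f j)) ?_
        linear_combination h) (e + f) (Finset.mem_image_of_mem _ he)
    obtain ⟨e', he₁', rfl⟩ := Finset.mem_image.1 he'
    exact ⟨e', he₁', by simpa using h⟩
  · intro i hi j hj
    have := logSize_coeff_ratio_le hβ ha
      (p := F.filter fun e => spread β I (e - f) ≤ R)
      (fun e he => (hF.1 e (Finset.mem_filter.1 he).1).1) f (d := R) (by linarith)
      (fun e he i hi j hj => (logSize_le_spread _ hi hj).trans (Finset.mem_filter.1 he).2)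
      hball hM hi hj
    refine this.trans ?_
    push_cast
    have hL : (0 : ℝ) ≤ (M.factorial : ℝ) * M := by positivity
    nlinarith

variable {I : Finset ι} {a : ι → ℚ} {F : Finset (ι → ℤ)} {c L : ℕ} {R : ℝ}

/-- If all cells of small diameter are nonspanning, a family of bounded spread is small. -/
lemma card_le_of_cells [Fintype ι] (hβ : ∀ i, 2 ≤ β i)
    (hc : ∀ p ⊆ F, IsNonspanning β I a p → p.card ≤ c) {Q : ℝ} (hQ : 0 < Q) {m : ℕ} (hm : 1 ≤ m)
    {p : Finset (ι → ℤ)} (hpF : p ⊆ F) (hp : ∀ e ∈ p, spread β I e ≤ Q)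
    (hcell : ∀ q ⊆ p, q.Nonempty → (∀ e ∈ q, ∀ e' ∈ q, ∀ i ∈ I, ∀ j ∈ I,
      logSize (expVal β (e - e') i / expVal β (e - e') j) ≤ 4 * Q / m) → IsNonspanning β I a q) :
    p.card ≤ (2 * m + 1) ^ (2 * Fintype.card ι) * c := by
  classical
  obtain ⟨col, hcol, hd⟩ := exists_cells hβ I hQ hm p hp
  refine (card_le_mul_of_cover p (p.image col) (fun e y => col e = y) c
    (fun e he => ⟨col e, Finset.mem_image_of_mem _ he, rfl⟩) fun y _ q hq hy => ?_).trans
    (Nat.mul_le_mul_right c hcol)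
  rcases q.eq_empty_or_nonempty with rfl | hq0
  · simp
  exact hc q (hq.trans hpF) (hcell q hq hq0 fun e he e' he' =>
    hd e (hq he) e' (hq he') ((hy e he).trans (hy e' he').symm))

lemma card_le_of_spread_lt [Fintype ι] (hβ : ∀ i, 2 ≤ β i) (hF : IsNormalFamily β I a F L R)
    (hI : I.Nonempty) (hL : 1 ≤ L) (hc : ∀ p ⊆ F, IsNonspanning β I a p → p.card ≤ c)
    {p : Finset (ι → ℤ)} (hpF : p ⊆ F) (hp : ∀ e ∈ p, spread β I e ≤ 40 * L * R) :
    p.card ≤ (2 * (400 * L) + 1) ^ (2 * Fintype.card ι) * c := by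
  have hL0 : (0 : ℝ) < L := by exact_mod_cast hL
  have hR : 0 < R := (log_pos one_lt_two).trans_le hF.log_two_le
  refine card_le_of_cells hβ hc (by positivity) (by omega) hpF hp fun q hq ⟨e, he⟩ hd => ?_
  by_contra hns
  obtain ⟨e', he', h⟩ := hF.exists_le_spread q (hq.trans hpF) hns e he
  have h1 := spread_le hI (hd e' he' e he)
  have h2 : 4 * (40 * L * R) / ((400 * L : ℕ) : ℝ) = 2 / 5 * R := by
    push_cast; field_simp; ring
  rw [h2] at h1
  linarith

lemma card_le_of_spread_window [Fintype ι] [DecidableEq ι] (hβ : ∀ i, 2 ≤ β i)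
    (hM : L = (Fintype.card ι).factorial * Fintype.card ι)
    (hF : IsNormalFamily β I a F L R) (hI : 2 ≤ I.card) (hL : 1 ≤ L)
    (hc : ∀ p ⊆ F, IsNonspanning β I a p → p.card ≤ c) {Q : ℝ} (hQ : 40 * L * R ≤ Q)
    {p : Finset (ι → ℤ)} (hpF : p ⊆ F) (hp : ∀ e ∈ p, Q ≤ spread β I e ∧ spread β I e ≤ 2 * Q) :
    p.card ≤ (2 * (400 * L) + 1) ^ (2 * Fintype.card ι) * c := by
  have hL0 : (1 : ℝ) ≤ L := by exact_mod_cast hL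
  have hR : 1 / 2 ≤ R := by linarith [hF.log_two_le, Real.log_two_gt_d9]
  have hQ0 : 0 < Q := lt_of_lt_of_le (by positivity) hQ
  have hI0 : I.Nonempty := Finset.card_pos.1 (by omega)
  refine card_le_of_cells hβ hc (Q := 2 * Q) (by positivity) (by omega) hpF
    (fun e he => (hp e he).2) fun q hq ⟨e, he⟩ hd => ?_
  by_contra hns
  have hd2 : 4 * (2 * Q) / ((400 * L : ℕ) : ℝ) = Q / (50 * L) := by
    push_cast; field_simp; ring
  rw [hd2] at hd
  obtain ⟨i, hi, j, hj, hij⟩ := exists_eq_spread (β := β) hI0 e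
  have ha : ∀ i ∈ I, a i ≠ 0 :=
    fun i hi => (hF.isSolFamily.1 e (hpF (hq he))).coeff_ne_zero hI hi
  have h1 := logSize_coeff_ratio_le hβ ha (p := q)
    (fun e he => (hF.isSolFamily.1 e (hpF (hq he))).1) e (d := Q / (50 * L)) (by positivity)
    (fun e' he' => hd e' he' e he) hns (Finset.card_le_univ I) hi hj
  have h2 := hF.logSize_coeff_le j hj i hi
  have h3 : expVal β e i / expVal β e j =
      (a i * expVal β e i) / (a j * expVal β e j) * (a j / a i) := by
    have := ha i hi
    have := ha j hj
    have := expVal_ne_zero hβ e j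
    field_simp
  have h4 := logSize_mul_le ((a i * expVal β e i) / (a j * expVal β e j)) (a j / a i)
  rw [← h3, ← hij] at h4
  have hL' : ((Fintype.card ι).factorial : ℝ) * Fintype.card ι = L := by rw [hM]; push_cast; rfl
  rw [hL'] at h1
  have h5 : 4 * (L : ℝ) * (Q / (50 * L)) = 2 / 25 * Q := by field_simp; ring
  have h6 := (hp e (hq he)).1
  rw [h5] at h1
  have h7 : (L : ℝ) ≤ 2 * L * R := by nlinarith
  nlinarith

end Windows

section ApproxRelations
open Real

lemma exp_neg_logSize_le_abs_sub_one {x : ℚ} (hx : x ≠ 1) :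
    exp (-logSize x) ≤ |(x : ℝ) - 1| := by
  have hd : (0 : ℝ) < x.den := by exact_mod_cast x.den_pos
  have h1 : (1 : ℝ) ≤ |(x : ℝ) - 1| * x.den := by
    have h2 : (x.num - x.den : ℤ) ≠ 0 := by
      intro h
      apply hx
      rw [← Rat.num_div_den x, div_eq_one_iff_eq (by exact_mod_cast x.den_ne_zero)]
      exact_mod_cast sub_eq_zero.1 h
    have h3 : (1 : ℝ) ≤ |((x.num - x.den : ℤ) : ℝ)| := by
      exact_mod_cast Int.one_le_abs h2
    have h4 : ((x : ℝ) - 1) * x.den = ((x.num - x.den : ℤ) : ℝ) := by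
      have : (x : ℝ) * x.den = x.num := by exact_mod_cast Rat.mul_den_eq_num x
      push_cast
      linear_combination this
    rwa [← h4, abs_mul, abs_of_pos hd] at h3
  rw [exp_neg, inv_le_iff_one_le_mul₀ (exp_pos _)]
  exact h1.trans (mul_le_mul_of_nonneg_left (den_le_exp_logSize x) (abs_nonneg _))

/-- `u = k ^ E / l ^ F` is, up to a factor of small size, extremely close to `1`. -/
structure IsApproxRelation (ε η H : ℝ) (u : ℚ) : Prop where
  exists_factor : ∃ c : ℚ, c * u ≠ 1 ∧ |((c * u : ℚ) : ℝ) - 1| ≤ exp (-(ε * H / 2)) ∧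
    logSize c ≤ η * H
  le_logSize : ε * H / 4 ≤ logSize u
  logSize_le : logSize u ≤ H
  abs_log_le : |log (u : ℝ)| ≤ η * H

variable {k l : ℕ} {ε η H₁ H₂ : ℝ} {E₁ F₁ E₂ F₂ : ℤ}

lemma IsApproxRelation.exponent_ne_zero (hε0 : 0 < ε) (hη : η ≤ ε / 8) (hH : 0 < H₁)
    (h : IsApproxRelation ε η H₁ ((k : ℚ) ^ E₁ / (l : ℚ) ^ F₁)) : E₁ ≠ 0 := by
  rintro rfl
  have h1 := h.le_logSize
  have h2 := h.abs_log_le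
  rw [zpow_zero, one_div] at h1 h2
  rw [logSize_inv, logSize_natCast_zpow] at h1
  push_cast at h1 h2
  rw [log_inv, abs_neg] at h2
  nlinarith

/-- Comparison of exponents and sizes for two approximate relations. -/
lemma IsApproxRelation.exponent_compare (hk : 2 ≤ k) (hl : 2 ≤ l) (hη : η ≤ ε / 12)
    (hH₁ : 0 < H₁) (hH₂ : 0 < H₂)
    (h₁ : IsApproxRelation ε η H₁ ((k : ℚ) ^ E₁ / (l : ℚ) ^ F₁))
    (h₂ : IsApproxRelation ε η H₂ ((k : ℚ) ^ E₂ / (l : ℚ) ^ F₂)) :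
    |(E₁ : ℝ)| * (ε * H₂) ≤ |(E₂ : ℝ)| * (8 * H₁) := by
  have h := logSize_quotient_compare k l hk hl E₂ F₂ E₁ F₁
  set s₁ := logSize ((k : ℚ) ^ E₁ / (l : ℚ) ^ F₁)
  set s₂ := logSize ((k : ℚ) ^ E₂ / (l : ℚ) ^ F₂)
  have ha := h₁.le_logSize
  have hb := h₂.le_logSize
  have h1 : |log (((k : ℚ) ^ E₁ / (l : ℚ) ^ F₁ : ℚ) : ℝ)| ≤ s₁ / 3 :=
    h₁.abs_log_le.trans (by change η * H₁ ≤ _ / 3; nlinarith)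
  have h2 : |log (((k : ℚ) ^ E₂ / (l : ℚ) ^ F₂ : ℚ) : ℝ)| ≤ s₂ / 3 :=
    h₂.abs_log_le.trans (by change η * H₂ ≤ _ / 3; nlinarith)
  have h3 : |(E₁ : ℝ)| * s₂ ≤ |(E₂ : ℝ)| * (2 * s₁) := by
    have h4 := mul_le_mul_of_nonneg_left h2 (abs_nonneg (E₁ : ℝ))
    have h5 := mul_le_mul_of_nonneg_left h1 (abs_nonneg (E₂ : ℝ))
    linarith
  have h4 : |(E₁ : ℝ)| * (ε * H₂ / 4) ≤ |(E₁ : ℝ)| * s₂ :=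
    mul_le_mul_of_nonneg_left hb (abs_nonneg _)
  have h5 : |(E₂ : ℝ)| * (2 * s₁) ≤ |(E₂ : ℝ)| * (2 * H₁) :=
    mul_le_mul_of_nonneg_left (by linarith [h₁.logSize_le]) (abs_nonneg _)
  linarith

/-- Size of `u₂ * u₁ ^ (-q)` when `q` is the integer quotient of the exponents. -/
lemma logSize_quotient_residue (hk : 2 ≤ k) (hl : 2 ≤ l) (hE₁ : E₁ ≠ 0) (q : ℕ)
    (hq : |((E₂ - q * E₁ : ℤ) : ℝ)| ≤ |(E₁ : ℝ)|) :
    logSize (((k : ℚ) ^ E₂ / (l : ℚ) ^ F₂) / ((k : ℚ) ^ E₁ / (l : ℚ) ^ F₁) ^ q) ≤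
      logSize ((k : ℚ) ^ E₁ / (l : ℚ) ^ F₁) + |log (((k : ℚ) ^ E₂ / (l : ℚ) ^ F₂ : ℚ) : ℝ)| +
        (q + 1) * |log (((k : ℚ) ^ E₁ / (l : ℚ) ^ F₁ : ℚ) : ℝ)| := by
  have hk0 : (k : ℚ) ≠ 0 := by positivity
  have hl0 : (l : ℚ) ≠ 0 := by positivity
  have h := logSize_quotient_compare k l hk hl (E₂ - q * E₁) (F₂ - q * F₁) E₁ F₁
  have hu : (k : ℚ) ^ (E₂ - q * E₁) / (l : ℚ) ^ (F₂ - q * F₁) =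
      ((k : ℚ) ^ E₂ / (l : ℚ) ^ F₂) / ((k : ℚ) ^ E₁ / (l : ℚ) ^ F₁) ^ q := by
    rw [zpow_sub₀ hk0, zpow_sub₀ hl0, mul_comm (q : ℤ), mul_comm (q : ℤ), zpow_mul, zpow_mul,
      zpow_natCast, zpow_natCast, div_pow]
    field_simp
  rw [hu] at h
  set u₁ : ℚ := (k : ℚ) ^ E₁ / (l : ℚ) ^ F₁ with hu₁
  set u₂ : ℚ := (k : ℚ) ^ E₂ / (l : ℚ) ^ F₂ with hu₂
  have hu₁0 : (u₁ : ℝ) ≠ 0 := by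
    have : u₁ ≠ 0 := by positivity
    exact_mod_cast this
  have hu₂0 : (u₂ : ℝ) ≠ 0 := by
    have : u₂ ≠ 0 := by positivity
    exact_mod_cast this
  have hlog : |log ((u₂ / u₁ ^ q : ℚ) : ℝ)| ≤ |log (u₂ : ℝ)| + q * |log (u₁ : ℝ)| := by
    push_cast
    rw [log_div hu₂0 (pow_ne_zero _ hu₁0), log_pow]
    refine (abs_sub _ _).trans ?_
    rw [abs_mul, Nat.abs_cast]
  have hE : 0 < |(E₁ : ℝ)| := abs_pos.2 (by exact_mod_cast hE₁)
  refine le_of_mul_le_mul_left (h.trans ?_) hE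
  have h1 := mul_le_mul_of_nonneg_right hq (logSize_nonneg u₁)
  have h2 := mul_le_mul_of_nonneg_right hq (abs_nonneg (log (u₁ : ℝ)))
  have h3 := mul_le_mul_of_nonneg_left hlog hE.le
  linarith

lemma exists_floor_quotient (hE₁ : E₁ ≠ 0) (hs : 0 ≤ E₁ * E₂) :
    ∃ q : ℕ, |((E₂ - q * E₁ : ℤ) : ℝ)| ≤ |(E₁ : ℝ)| ∧ q * |(E₁ : ℝ)| ≤ |(E₂ : ℝ)| ∧
      |(E₂ : ℝ)| ≤ (q + 1) * |(E₁ : ℝ)| := by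
  have hq : ((E₂.natAbs / E₁.natAbs : ℕ) : ℤ) = |E₂| / |E₁| := by simp
  refine ⟨E₂.natAbs / E₁.natAbs, ?_⟩
  have hpos : 0 < |E₁| := abs_pos.2 hE₁
  have h1 := Int.mul_ediv_add_emod |E₂| |E₁|
  have h2 := Int.emod_nonneg |E₂| hpos.ne'
  have h3 := Int.emod_lt_of_pos |E₂| hpos
  rw [← hq] at h1
  set q := E₂.natAbs / E₁.natAbs
  set rem := |E₂| % |E₁|
  have h4 : |E₂ - q * E₁| = |E₂| - q * |E₁| := by
    rcases lt_or_gt_of_ne hE₁ with h | h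
    · have h5 : E₂ ≤ 0 := by nlinarith
      rw [abs_of_neg h, abs_of_nonpos h5] at *
      rw [abs_of_nonpos (by linarith)]
      ring
    · have h5 : 0 ≤ E₂ := by nlinarith
      rw [abs_of_pos h, abs_of_nonneg h5] at *
      rw [abs_of_nonneg (by linarith)]
  have h5 : |E₂ - q * E₁| ≤ |E₁| := by rw [h4]; linarith
  have h6 : q * |E₁| ≤ |E₂| := by linarith
  have h7 : |E₂| ≤ (q + 1) * |E₁| := by linarith
  refine ⟨by exact_mod_cast h5, by exact_mod_cast h6, by exact_mod_cast h7⟩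

set_option maxHeartbeats 1000000 in
/-- Two approximate relations with exponents of equal sign have comparable heights. -/
theorem IsApproxRelation.lt_mul (hk : 2 ≤ k) (hl : 2 ≤ l) (hε0 : 0 < ε) (hε1 : ε ≤ 1)
    (hη0 : 0 ≤ η) (hη : η ≤ ε ^ 5 / 10 ^ 7) (hH₁ : 10 ^ 10 / ε ^ 6 ≤ H₁)
    (h₁ : IsApproxRelation ε η H₁ ((k : ℚ) ^ E₁ / (l : ℚ) ^ F₁))
    (h₂ : IsApproxRelation ε η H₂ ((k : ℚ) ^ E₂ / (l : ℚ) ^ F₂)) (hs : 0 ≤ E₁ * E₂) :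
    H₂ < 10 ^ 9 / ε ^ 5 * H₁ := by
  by_contra! hH
  have hε5 : ε ^ 5 ≤ ε := by
    calc ε ^ 5 ≤ ε ^ 1 := pow_le_pow_of_le_one hε0.le hε1 (by norm_num)
      _ = ε := pow_one ε
  have hη1 : η ≤ ε / 10 ^ 7 := hη.trans (by gcongr)
  have hH₁0 : 0 < H₁ := lt_of_lt_of_le (by positivity) hH₁
  have hH₂0 : 0 < H₂ := lt_of_lt_of_le (by positivity) hH
  have hE₁ := h₁.exponent_ne_zero hε0 (by linarith) hH₁0
  obtain ⟨q, hq1, hq2, hq3⟩ := exists_floor_quotient hE₁ hs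
  have hE₁0 : 0 < |(E₁ : ℝ)| := abs_pos.2 (by exact_mod_cast hE₁)
  have hc1 := IsApproxRelation.exponent_compare hk hl (by linarith) hH₁0 hH₂0 h₁ h₂
  have hc2 := IsApproxRelation.exponent_compare hk hl (by linarith) hH₂0 hH₁0 h₂ h₁
  have hd1 : ε * H₂ ≤ (q + 1) * (8 * H₁) := by
    refine le_of_mul_le_mul_left (hc1.trans ?_) hE₁0
    calc |(E₂ : ℝ)| * (8 * H₁) ≤ ((q + 1) * |(E₁ : ℝ)|) * (8 * H₁) := by gcongr
      _ = _ := by ring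
  have hd2 : q * (ε * H₁) ≤ 8 * H₂ := by
    refine le_of_mul_le_mul_left (le_trans ?_ hc2) hE₁0
    calc |(E₁ : ℝ)| * (q * (ε * H₁)) = (q * |(E₁ : ℝ)|) * (ε * H₁) := by ring
      _ ≤ _ := by gcongr
  have hqbig : 10 ^ 8 / ε ^ 4 ≤ (q : ℝ) + 1 := by
    have h1 : 10 ^ 9 / ε ^ 4 * H₁ ≤ ε * H₂ := by
      calc 10 ^ 9 / ε ^ 4 * H₁ = ε * (10 ^ 9 / ε ^ 5 * H₁) := by field_simp
        _ ≤ _ := by gcongr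
    have h2 : 10 ^ 9 / ε ^ 4 ≤ (q + 1) * 8 := by
      refine le_of_mul_le_mul_right ((h1.trans hd1).trans (le_of_eq (by ring))) hH₁0
    have h3 : (10 : ℝ) ^ 8 / ε ^ 4 = 10 ^ 9 / ε ^ 4 / 10 := by ring
    rw [h3]
    linarith
  have hε4 : ε ^ 4 ≤ 1 := pow_le_one₀ hε0.le hε1
  have hbig : (10 : ℝ) ^ 8 ≤ 10 ^ 8 / ε ^ 4 := by
    rw [le_div_iff₀ (by positivity)]
    nlinarith
  have hq1' : (1 : ℝ) ≤ q := by linarith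
  have hqbig' : 10 ^ 7 / ε ^ 4 ≤ (q : ℝ) := by
    have h3 : (10 : ℝ) ^ 7 / ε ^ 4 = 10 ^ 8 / ε ^ 4 / 10 := by ring
    rw [h3]; linarith
  have hd3 : ε * H₂ ≤ 16 * (q * H₁) := by nlinarith
  obtain ⟨c₁, hx₁, hx₁', hc₁⟩ := h₁.exists_factor
  obtain ⟨c₂, hx₂, hx₂', hc₂⟩ := h₂.exists_factor
  have hres := logSize_quotient_residue (F₁ := F₁) (F₂ := F₂) hk hl hE₁ q hq1
  have hl1 := h₁.abs_log_le
  have hl2 := h₂.abs_log_le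
  have hs1 := h₁.logSize_le
  set u₁ : ℚ := (k : ℚ) ^ E₁ / (l : ℚ) ^ F₁ with hu₁
  set u₂ : ℚ := (k : ℚ) ^ E₂ / (l : ℚ) ^ F₂ with hu₂
  have hu₁0 : u₁ ≠ 0 := by positivity
  have hu₂0 : u₂ ≠ 0 := by positivity
  have hne : ∀ (x : ℚ) (H : ℝ), 0 < H → |(x : ℝ) - 1| ≤ exp (-(ε * H / 2)) → x ≠ 0 := by
    rintro x H hH h rfl
    have h1 : exp (-(ε * H / 2)) < 1 := by
      rw [← exp_zero, exp_lt_exp]; linarith [mul_pos hε0 hH]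
    norm_num at h
    linarith [mul_pos hε0 hH]
  have hx₁0 := hne _ _ hH₁0 hx₁'
  have hx₂0 := hne _ _ hH₂0 hx₂'
  have hy0 : c₂ * u₂ / (c₁ * u₁) ^ q ≠ 0 := div_ne_zero hx₂0 (pow_ne_zero _ hx₁0)
  have hyx : c₂ * u₂ / (c₁ * u₁) ^ q * (c₁ * u₁) ^ q = c₂ * u₂ :=
    div_mul_cancel₀ _ (pow_ne_zero _ hx₁0)
  have hysize : logSize (c₂ * u₂ / (c₁ * u₁) ^ q) ≤ ((ε ^ 2 / 32) ^ 2 / 144) * q * (2 * H₁) := by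
    have h1 : c₂ * u₂ / (c₁ * u₁) ^ q = c₂ / c₁ ^ q * (u₂ / u₁ ^ q) := by
      rw [mul_pow]; field_simp
    have h2 : logSize (c₂ / c₁ ^ q) ≤ η * H₂ + q * (η * H₁) := by
      refine (logSize_div_le_add _ _).trans ?_
      rw [logSize_pow]
      gcongr
    have h3 : logSize (c₂ * u₂ / (c₁ * u₁) ^ q) ≤
        (η * H₂ + q * (η * H₁)) + (H₁ + η * H₂ + (q + 1) * (η * H₁)) := by
      rw [h1]
      refine (logSize_mul_le _ _).trans (add_le_add h2 (hres.trans ?_))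
      gcongr
    have h4 : η * H₂ ≤ ε ^ 4 / 10 ^ 7 * (16 * (q * H₁)) := by
      calc η * H₂ ≤ ε ^ 5 / 10 ^ 7 * H₂ := by gcongr
        _ = ε ^ 4 / 10 ^ 7 * (ε * H₂) := by ring
        _ ≤ _ := by gcongr
    have h5 : η * H₁ ≤ ε ^ 4 / 10 ^ 7 * H₁ := by
      refine mul_le_mul_of_nonneg_right (hη.trans ?_) hH₁0.le
      gcongr ?_ / _
      exact pow_le_pow_of_le_one hε0.le hε1 (by norm_num)
    have h6 : H₁ ≤ ε ^ 4 / 10 ^ 7 * (q * H₁) := by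
      have : 1 ≤ ε ^ 4 / 10 ^ 7 * q := by
        rw [div_le_iff₀ (by positivity)] at hqbig'
        rw [div_mul_eq_mul_div, le_div_iff₀ (by positivity)]
        linarith
      nlinarith
    have h7 : q * (η * H₁) ≤ ε ^ 4 / 10 ^ 7 * (q * H₁) := by
      calc q * (η * H₁) ≤ q * (ε ^ 4 / 10 ^ 7 * H₁) := by gcongr
        _ = _ := by ring
    have h8 : η * H₁ ≤ q * (η * H₁) := le_mul_of_one_le_left (by positivity) hq1'
    have h9 : ((ε ^ 2 / 32) ^ 2 / 144) * q * (2 * H₁) = ε ^ 4 / 73728 * (q * H₁) := by ring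
    have h10 : ε ^ 4 / 10 ^ 7 * (40 * (q * H₁)) ≤ ε ^ 4 / 73728 * (q * H₁) := by
      have : 0 ≤ ε ^ 4 * (q * H₁) := by positivity
      linarith
    rw [h9]
    linarith
  have hε2 : ε ^ 2 ≤ ε := by nlinarith
  refine two_solutions_false (c₁ * u₁) (c₂ * u₂ / (c₁ * u₁) ^ q) (ε ^ 2 / 32)
    ((ε ^ 2 / 32) ^ 2 / 144) (2 * H₁) q (by positivity) (by nlinarith) le_rfl ?_ ?_ hx₁ ?_ hy0
    ?_ ?_ ?_
  · refine le_trans ?_ hqbig'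
    have h1 : (160 : ℝ) / (ε ^ 2 / 32) = 5120 * ε ^ 2 / ε ^ 4 := by field_simp; norm_num
    rw [h1]
    gcongr
    nlinarith
  · have h1 : (10 : ℝ) ^ 4 / (ε ^ 2 / 32) ^ 3 = 327680000 / ε ^ 6 := by field_simp; norm_num
    rw [h1]
    have h2 : (327680000 : ℝ) / ε ^ 6 ≤ 10 ^ 10 / ε ^ 6 := by gcongr; norm_num
    linarith
  · refine hx₁'.trans (exp_le_exp.2 ?_)
    nlinarith
  · refine (den_le_exp_logSize _).trans (exp_le_exp.2 ((logSize_mul_le _ _).trans ?_))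
    have : η * H₁ ≤ 1 * H₁ := by gcongr; linarith
    linarith
  · exact (den_le_exp_logSize _).trans (exp_le_exp.2 hysize)
  · have h1 : ((c₂ * u₂ / (c₁ * u₁) ^ q : ℚ) : ℝ) * ((c₁ * u₁ : ℚ) : ℝ) ^ q =
        ((c₂ * u₂ : ℚ) : ℝ) := by exact_mod_cast hyx
    rw [h1]
    refine hx₂'.trans (exp_le_exp.2 ?_)
    have := mul_le_mul_of_nonneg_left hd2 hε0.le
    nlinarith

end ApproxRelations

section Gap
open Real

variable {ι : Type*} {β : ι → ℕ}

/-- Pigeonhole: the values `x i` split along one of the given scales. -/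
lemma exists_gap {I : Finset ι} (hI : I.Nonempty) (x : ι → ℝ) {H : ℝ} (hH : 0 < H) (ε : ℕ → ℝ)
    (hε : Antitone ε) (hε0 : ∀ j, 0 < ε j) :
    ∃ r < I.card, ∃ T ⊆ I, T.Nonempty ∧ (∀ i ∈ T, ∀ j ∈ T, |x i - x j| ≤ ε (r + 1) * H) ∧
      ∀ i ∈ T, ∀ j ∈ I, j ∉ T → x j - x i ≤ -((ε r - ε (r + 1)) * H) := by
  classical
  obtain ⟨m, hm, hmax⟩ := I.exists_max_image x hI
  have key : ∃ r < I.card, ∀ i ∈ I, x m - x i < ε (r + 1) * H ∨ ε r * H ≤ x m - x i := by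
    by_contra! hcon
    have : Nonempty ι := ⟨m⟩
    choose! f hfI hf1 hf2 using hcon
    have hmem : ∀ r ∈ Finset.range I.card, f r ∈ I.erase m := by
      intro r hr
      rw [Finset.mem_range] at hr
      refine Finset.mem_erase.2 ⟨fun h => ?_, hfI r hr⟩
      have h1 := hf1 r hr
      rw [h, sub_self] at h1
      have := mul_pos (hε0 (r + 1)) hH
      linarith
    obtain ⟨r, hr, r', hr', hne, heq⟩ := Finset.exists_ne_map_eq_of_card_lt_of_maps_to
      (s := Finset.range I.card) (t := I.erase m) (f := f)
      (by rw [Finset.card_erase_of_mem hm, Finset.card_range]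
          have := Finset.card_pos.2 hI
          omega) hmem
    rw [Finset.mem_range] at hr hr'
    wlog hlt : r < r' generalizing r r'
    · exact this r' hr' r hr hne.symm heq.symm (by omega)
    have h1 := hf1 r hr
    have h2 := hf2 r' hr'
    rw [← heq] at h2
    have h3 : ε r' * H ≤ ε (r + 1) * H := by gcongr; exact hε hlt
    linarith
  obtain ⟨r, hr, hkey⟩ := key
  refine ⟨r, hr, I.filter fun i => x m - x i < ε (r + 1) * H, Finset.filter_subset _ _,
    ⟨m, by simp [hm, mul_pos (hε0 _) hH]⟩, ?_, ?_⟩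
  · intro i hi j hj
    rw [Finset.mem_filter] at hi hj
    rw [abs_le]
    constructor <;> linarith [hmax i hi.1, hmax j hj.1]
  · intro i hi j hj hjT
    rw [Finset.mem_filter] at hi hjT
    have h1 := (hkey j hj).resolve_left fun h => hjT ⟨hj, h⟩
    linarith [hmax i hi.1]

variable {I T : Finset ι} {a : ι → ℚ} {e : ι → ℤ} {B G : ℝ} {M : ℕ}

/-- Size of a sum over terms with a common base and comparable values. -/
lemma logSize_sum_ratio_le (hB : 1 ≤ B) {S : Finset ι} (hSM : S.card ≤ M) {i₀ : ι}
    (hi₀ : i₀ ∈ S) (hβ : ∀ i, 2 ≤ β i) (hbase : ∀ i ∈ S, β i = β i₀)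
    (ha : ∀ i ∈ S, logSize (a i / a i₀) ≤ B)
    (hlog : ∀ i ∈ S, |log (expVal β e i : ℝ) - log (expVal β e i₀ : ℝ)| ≤ B) :
    logSize (∑ i ∈ S, a i / a i₀ * (expVal β e i / expVal β e i₀)) ≤ 5 * M * B := by
  refine (logSize_sum_le S ⟨i₀, hi₀⟩ _).trans ?_
  have h1 : ∀ i ∈ S, logSize (a i / a i₀ * (expVal β e i / expVal β e i₀)) ≤ 2 * B := by
    intro i hi
    refine (logSize_mul_le _ _).trans ?_
    have h2 : logSize (expVal β e i / expVal β e i₀) ≤ B := by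
      refine le_trans (le_of_eq ?_) (hlog i hi)
      have hz : ((expVal β e i / expVal β e i₀ : ℚ)) = (β i₀ : ℚ) ^ (e i - e i₀) := by
        rw [expVal, expVal, hbase i hi, zpow_sub₀ (by have := hβ i₀; positivity)]
      rw [hz, logSize_natCast_zpow, ← hz]
      push_cast
      rw [log_div (by exact_mod_cast expVal_ne_zero hβ e i)
          (by exact_mod_cast expVal_ne_zero hβ e i₀)]
    linarith [ha i hi]
  have h2 := Finset.sum_le_card_nsmul S _ _ h1
  rw [nsmul_eq_mul] at h2
  have hM1 : (S.card : ℝ) ≤ M := by exact_mod_cast hSM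
  have hS : (0 : ℝ) < S.card := by exact_mod_cast Finset.card_pos.2 ⟨i₀, hi₀⟩
  have h3 := log_le_sub_one_of_pos hS
  have h4 : (S.card : ℝ) * (2 * B) ≤ M * (2 * B) := by gcongr
  have h5 : (M : ℝ) * 1 ≤ M * B := by gcongr
  linarith

/-- The terms outside the dominant set are negligible. -/
lemma abs_tail_le (hB : 1 ≤ B) (hβ : ∀ i, 2 ≤ β i) (ha0 : ∀ i ∈ I, a i ≠ 0)
    (ha : ∀ i ∈ I, ∀ j ∈ I, logSize (a i / a j) ≤ B) (hM : I.card ≤ M) (hTI : T ⊆ I) {i : ι}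
    (hi : i ∈ T) (hgap : ∀ j ∈ I, j ∉ T →
      log (expVal β e j : ℝ) - log (expVal β e i : ℝ) ≤ -G) [DecidableEq ι] :
    |((∑ j ∈ I \ T, a j / a i * (expVal β e j / expVal β e i) : ℚ) : ℝ)| ≤ exp (2 * M * B - G) := by
  push_cast
  refine (Finset.abs_sum_le_sum_abs _ _).trans ?_
  have hpos : ∀ i, 0 < (expVal β e i : ℝ) := fun i => by exact_mod_cast expVal_pos hβ e i
  have h1 : ∀ j ∈ I \ T, |(a j / a i * (expVal β e j / expVal β e i) : ℝ)| ≤ exp (B - G) := by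
    intro j hj
    rw [Finset.mem_sdiff] at hj
    rw [abs_mul, sub_eq_add_neg, exp_add]
    have h2 : |((a j : ℝ) / a i)| ≤ exp B := by
      have := le_exp_logSize (a j / a i) (div_ne_zero (ha0 j hj.1) (ha0 i (hTI hi)))
      push_cast at this
      exact this.trans (exp_le_exp.2 (ha j hj.1 i (hTI hi)))
    have h3 : |((expVal β e j : ℝ) / expVal β e i)| ≤ exp (-G) := by
      rw [abs_of_pos (div_pos (hpos j) (hpos i)), ← log_le_iff_le_exp (div_pos (hpos j) (hpos i)),
        log_div (hpos j).ne' (hpos i).ne']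
      exact hgap j hj.1 hj.2
    exact mul_le_mul h2 h3 (abs_nonneg _) (exp_pos _).le
  refine (Finset.sum_le_card_nsmul _ _ _ h1).trans ?_
  rw [nsmul_eq_mul]
  have hM1 : ((I \ T).card : ℝ) ≤ M := by
    exact_mod_cast (Finset.card_le_card Finset.sdiff_subset).trans hM
  have hM2 : (1 : ℝ) ≤ M := by
    have : 0 < I.card := Finset.card_pos.2 ⟨i, hTI hi⟩
    exact_mod_cast this.trans_le hM
  calc ((I \ T).card : ℝ) * exp (B - G) ≤ exp M * exp (B - G) := by
        gcongr
        linarith [add_one_le_exp (M : ℝ)]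
    _ = exp (M + (B - G)) := (exp_add _ _).symm
    _ ≤ _ := by
        apply exp_le_exp.2
        nlinarith

end Gap

section Structure
open Real

variable {ι : Type*} {β : ι → ℕ} {I T : Finset ι} {a : ι → ℚ} {e : ι → ℤ} {B G : ℝ} {M : ℕ}

lemma sum_eq_mul_sum_ratio (hβ : ∀ i, 2 ≤ β i) (S : Finset ι) {i₀ : ι} (ha : a i₀ ≠ 0) :
    ∑ i ∈ S, a i * expVal β e i =
      a i₀ * expVal β e i₀ * ∑ i ∈ S, a i / a i₀ * (expVal β e i / expVal β e i₀) := by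
  rw [Finset.mul_sum]
  refine Finset.sum_congr rfl fun i _ => ?_
  have := expVal_ne_zero hβ e i₀
  field_simp

lemma logSize_same_base (hβ : ∀ i, 2 ≤ β i) {i j : ι} (h : β i = β j) :
    logSize (expVal β e i / expVal β e j) =
      |log (expVal β e i : ℝ) - log (expVal β e j : ℝ)| := by
  have hz : ((expVal β e i / expVal β e j : ℚ)) = (β j : ℚ) ^ (e i - e j) := by
    rw [expVal, expVal, h, zpow_sub₀ (by have := hβ j; positivity)]
  rw [hz, logSize_natCast_zpow, ← hz]
  push_cast
  rw [log_div (by exact_mod_cast expVal_ne_zero hβ e i) (by exact_mod_cast expVal_ne_zero hβ e j)]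

/-- A dominant set of a nondegenerate solution involves both bases. -/
lemma dominant_mixed [DecidableEq ι] (hβ : ∀ i, 2 ≤ β i) (hI : 2 ≤ I.card) (hM : I.card ≤ M)
    (hnd : IsNondegSol β I a e) (hB : 1 ≤ B) (hG : 50 * M * B ≤ G)
    (hs : 20 * M * B < spread β I e) (ha : ∀ i ∈ I, ∀ j ∈ I, logSize (a i / a j) ≤ B)
    (hTI : T ⊆ I) (hin : ∀ i ∈ T, ∀ j ∈ T, |log (expVal β e i : ℝ) - log (expVal β e j : ℝ)| ≤ B)
    (hout : ∀ i ∈ T, ∀ j ∈ I, j ∉ T → log (expVal β e j : ℝ) - log (expVal β e i : ℝ) ≤ -G)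
    {i₀ : ι} (hi₀ : i₀ ∈ T) : ∃ i ∈ T, β i ≠ β i₀ := by
  by_contra! hpure
  have hMB : 1 ≤ (M : ℝ) := by
    have : 1 ≤ M := by omega
    exact_mod_cast this
  have hMB' : B ≤ M * B := le_mul_of_one_le_left (by linarith) hMB
  have ha0 : ∀ i ∈ I, a i ≠ 0 := fun i hi => hnd.coeff_ne_zero hI hi
  by_cases hT : T = I
  · subst hT
    have : spread β T e ≤ B := spread_le ⟨i₀, hi₀⟩ fun i hi j hj => by
      rw [logSize_same_base hβ ((hpure i hi).trans (hpure j hj).symm)]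
      exact hin i hi j hj
    linarith
  · have hne := hnd.2 T (Finset.ssubset_iff_subset_ne.2 ⟨hTI, hT⟩) ⟨i₀, hi₀⟩
    rw [sum_eq_mul_sum_ratio hβ T (ha0 i₀ (hTI hi₀))] at hne
    have hS0 := right_ne_zero_of_mul hne
    have hsize := logSize_sum_ratio_le (e := e) hB ((Finset.card_le_card hTI).trans hM) hi₀ hβ hpure
      (fun i hi => ha i (hTI hi) i₀ (hTI hi₀)) (fun i hi => hin i hi i₀ hi₀)
    have htail := abs_tail_le hB hβ ha0 ha hM hTI hi₀ (hout i₀ hi₀)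
    have hsum := hnd.1
    rw [sum_eq_mul_sum_ratio hβ I (ha0 i₀ (hTI hi₀)), ← Finset.sum_sdiff hTI] at hsum
    have h0 := (mul_eq_zero.1 hsum).resolve_left (left_ne_zero_of_mul hne)
    rw [eq_neg_of_add_eq_zero_left h0] at htail
    push_cast at htail
    rw [abs_neg] at htail
    have h1 := exp_neg_logSize_le _ hS0
    push_cast at h1
    have h2 := exp_le_exp.1 (h1.trans htail)
    nlinarith

set_option maxHeartbeats 1000000 in
/-- A nondegenerate solution with a dominant set gives a multiplicative near-relation between
values for the two bases. -/
lemma exists_near_relation [DecidableEq ι] (hβ : ∀ i, 2 ≤ β i) {k l : ℕ} (hkl : k ≠ l)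
    (hβkl : ∀ i ∈ I, β i = k ∨ β i = l) (hI : 2 ≤ I.card) (hM : I.card ≤ M)
    (hnd : IsNondegSol β I a e) (hB : 1 ≤ B) (hG : 50 * M * B ≤ G)
    (hs : 20 * M * B < spread β I e) (ha : ∀ i ∈ I, ∀ j ∈ I, logSize (a i / a j) ≤ B)
    (hTI : T ⊆ I) (hT0 : T.Nonempty)
    (hin : ∀ i ∈ T, ∀ j ∈ T, |log (expVal β e i : ℝ) - log (expVal β e j : ℝ)| ≤ B)
    (hout : ∀ i ∈ T, ∀ j ∈ I, j ∉ T → log (expVal β e j : ℝ) - log (expVal β e i : ℝ) ≤ -G) :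
    ∃ i ∈ T, ∃ j ∈ T, β i = k ∧ β j = l ∧
      (∃ c : ℚ, c * (expVal β e i / expVal β e j) ≠ 1 ∧
        |((c * (expVal β e i / expVal β e j) : ℚ) : ℝ) - 1| ≤ exp (-(G / 2)) ∧
        logSize c ≤ 11 * M * B) ∧
      G / 4 ≤ logSize (expVal β e i / expVal β e j) := by
  have hMB : 1 ≤ (M : ℝ) := by
    have : 1 ≤ M := by omega
    exact_mod_cast this
  have hMB' : B ≤ M * B := le_mul_of_one_le_left (by linarith) hMB
  have ha0 : ∀ i ∈ I, a i ≠ 0 := fun i hi => hnd.coeff_ne_zero hI hi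
  obtain ⟨i, hi, j, hj, hik, hjl⟩ : ∃ i ∈ T, ∃ j ∈ T, β i = k ∧ β j = l := by
    obtain ⟨i₀, hi₀⟩ := hT0
    obtain ⟨j₀, hj₀, hne⟩ := dominant_mixed hβ hI hM hnd hB hG hs ha hTI hin hout hi₀
    rcases hβkl i₀ (hTI hi₀) with h1 | h1 <;> rcases hβkl j₀ (hTI hj₀) with h2 | h2
    · exact absurd (h2.trans h1.symm) hne
    · exact ⟨i₀, hi₀, j₀, hj₀, h1, h2⟩
    · exact ⟨j₀, hj₀, i₀, hi₀, h2, h1⟩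
    · exact absurd (h2.trans h1.symm) hne
  refine ⟨i, hi, j, hj, hik, hjl, ?_⟩
  set Tk := T.filter fun m => β m = k with hTk
  set Tl := T.filter fun m => ¬ β m = k with hTl
  have hiTk : i ∈ Tk := Finset.mem_filter.2 ⟨hi, hik⟩
  have hjTl : j ∈ Tl := Finset.mem_filter.2 ⟨hj, by rw [hjl]; exact hkl.symm⟩
  have hkT : Tk ⊆ T := Finset.filter_subset _ _
  have hlT : Tl ⊆ T := Finset.filter_subset _ _
  have hbk : ∀ m ∈ Tk, β m = β i := fun m hm => (Finset.mem_filter.1 hm).2.trans hik.symm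
  have hbl : ∀ m ∈ Tl, β m = β j := fun m hm => by
    rw [hjl]
    exact (hβkl m (hTI (hlT hm))).resolve_left (Finset.mem_filter.1 hm).2
  have hcardT := (Finset.card_le_card hTI).trans hM
  have hsk := logSize_sum_ratio_le (e := e) hB ((Finset.card_le_card hkT).trans hcardT) hiTk hβ hbk
    (fun m hm => ha m (hTI (hkT hm)) i (hTI hi)) (fun m hm => hin m (hkT hm) i hi)
  have hsl := logSize_sum_ratio_le (e := e) hB ((Finset.card_le_card hlT).trans hcardT) hjTl hβ hbl
    (fun m hm => ha m (hTI (hlT hm)) j (hTI hj)) (fun m hm => hin m (hlT hm) j hj)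
  have hiI := ha0 i (hTI hi)
  have hjI := ha0 j (hTI hj)
  have hzi := expVal_ne_zero hβ e i
  have hzj := expVal_ne_zero hβ e j
  have hksum := sum_eq_mul_sum_ratio (e := e) hβ Tk hiI
  have hlsum := sum_eq_mul_sum_ratio (e := e) hβ Tl hjI
  have hk0 : ∑ m ∈ Tk, a m * expVal β e m ≠ 0 := hnd.2 Tk (Finset.ssubset_iff_subset_ne.2
    ⟨hkT.trans hTI, fun h => absurd (h ▸ hTI hj : j ∈ Tk) fun h' =>
      (Finset.mem_filter.1 hjTl).2 (Finset.mem_filter.1 h').2⟩) ⟨i, hiTk⟩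
  have hl0 : ∑ m ∈ Tl, a m * expVal β e m ≠ 0 := hnd.2 Tl (Finset.ssubset_iff_subset_ne.2
    ⟨hlT.trans hTI, fun h => absurd (h ▸ hTI hi : i ∈ Tl) fun h' =>
      (Finset.mem_filter.1 h').2 hik⟩) ⟨j, hjTl⟩
  have hTsum : ∑ m ∈ T, a m * expVal β e m =
      ∑ m ∈ Tk, a m * expVal β e m + ∑ m ∈ Tl, a m * expVal β e m :=
    (Finset.sum_filter_add_sum_filter_not T _ _).symm
  set Sk := ∑ m ∈ Tk, a m / a i * (expVal β e m / expVal β e i) with hSk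
  set Sl := ∑ m ∈ Tl, a m / a j * (expVal β e m / expVal β e j) with hSl
  set u := expVal β e i / expVal β e j with hu
  have hSk0 : Sk ≠ 0 := right_ne_zero_of_mul (hksum ▸ hk0)
  have hSl0 : Sl ≠ 0 := right_ne_zero_of_mul (hlsum ▸ hl0)
  have hu0 : u ≠ 0 := div_ne_zero hzi hzj
  set c := -(a i / a j) * (Sk / Sl) with hc
  have hcsize : logSize c ≤ 11 * M * B := by
    refine (logSize_mul_le _ _).trans ?_
    rw [logSize_neg]
    have := logSize_div_le_add Sk Sl
    linarith [ha i (hTI hi) j (hTI hj)]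
  have hcu : c * u - 1 = -(∑ m ∈ T, a m * expVal β e m) / (a j * expVal β e j * Sl) := by
    rw [hTsum, hksum, hlsum, hc, hu]
    field_simp
    ring
  have hTI' : T ≠ I := by
    rintro rfl
    rw [hnd.1, neg_zero, zero_div, sub_eq_zero] at hcu
    have husize : logSize u ≤ 11 * M * B := by
      rw [eq_inv_of_mul_eq_one_right hcu, logSize_inv]
      exact hcsize
    have hmix : ∀ i' ∈ T, ∀ j' ∈ T, β i' = k → β j' = l →
        logSize (expVal β e i' / expVal β e j') ≤ 13 * M * B := by
      intro i' hi' j' hj' hik' hjl'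
      have hzi' := expVal_ne_zero hβ e i'
      have hzj' := expVal_ne_zero hβ e j'
      have h1 : expVal β e i' / expVal β e j' =
          (expVal β e i' / expVal β e i) * u * (expVal β e j / expVal β e j') := by
        rw [hu]; field_simp
      have h2 := logSize_mul_le ((expVal β e i' / expVal β e i) * u) (expVal β e j / expVal β e j')
      have h3 := logSize_mul_le (expVal β e i' / expVal β e i) u
      rw [← h1, logSize_same_base hβ (hjl.trans hjl'.symm)] at h2
      rw [logSize_same_base hβ (hik'.trans hik.symm)] at h3
      linarith [hin i' hi' i hi, hin j hj j' hj']
    have hpure : ∀ i' ∈ T, ∀ j' ∈ T, β i' = β j' →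
        logSize (expVal β e i' / expVal β e j') ≤ 13 * M * B := by
      intro i' hi' j' hj' h
      rw [logSize_same_base hβ h]
      linarith [hin i' hi' j' hj']
    have : spread β T e ≤ 13 * M * B := spread_le ⟨i, hi⟩ fun i' hi' j' hj' => by
      rcases hβkl i' hi' with h1 | h1 <;> rcases hβkl j' hj' with h2 | h2
      · exact hpure i' hi' j' hj' (h1.trans h2.symm)
      · exact hmix i' hi' j' hj' h1 h2
      · rw [logSize_div_comm]
        exact hmix j' hj' i' hi' h2 h1
      · exact hpure i' hi' j' hj' (h1.trans h2.symm)
    linarith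
  have hT0' := hnd.2 T (Finset.ssubset_iff_subset_ne.2 ⟨hTI, hTI'⟩) ⟨i, hi⟩
  have hden : a j * expVal β e j * Sl ≠ 0 := mul_ne_zero (mul_ne_zero hjI hzj) hSl0
  have hne1 : c * u ≠ 1 := fun h => by
    rw [h, sub_self, eq_comm, div_eq_zero_iff] at hcu
    exact hcu.elim (fun h => hT0' (neg_eq_zero.1 h)) hden
  have htail := abs_tail_le hB hβ ha0 ha hM hTI hj (hout j hj)
  have hsum := hnd.1
  rw [← Finset.sum_sdiff hTI] at hsum
  have hcu' : c * u - 1 = (∑ m ∈ I \ T, a m / a j * (expVal β e m / expVal β e j)) / Sl := by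
    rw [hcu, ← eq_neg_of_add_eq_zero_left hsum, sum_eq_mul_sum_ratio hβ (I \ T) hjI]
    exact mul_div_mul_left _ _ (mul_ne_zero hjI hzj)
  have habs : |((c * u : ℚ) : ℝ) - 1| ≤ exp (7 * M * B - G) := by
    have h1 : ((c * u : ℚ) : ℝ) - 1 = ((c * u - 1 : ℚ) : ℝ) := by push_cast; ring
    rw [h1, hcu', Rat.cast_div, abs_div]
    have h2 := (exp_le_exp.2 (neg_le_neg hsl)).trans (exp_neg_logSize_le Sl hSl0)
    calc _ ≤ exp (2 * M * B - G) / exp (-(5 * M * B)) := by gcongr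
      _ = exp (7 * M * B - G) := by rw [← exp_sub]; congr 1; ring
  refine ⟨⟨c, hne1, habs.trans (exp_le_exp.2 (by linarith)), hcsize⟩, ?_⟩
  have h1 := exp_le_exp.1 ((exp_neg_logSize_le_abs_sub_one hne1).trans habs)
  have h2 := logSize_mul_le c u
  linarith

end Structure

section Counting
open Real

variable {ι : Type*} {β : ι → ℕ} {I : Finset ι} {a : ι → ℚ} {F : Finset (ι → ℤ)} {c L M : ℕ}
  {R : ℝ} {k l : ℕ}

/-- Number of dyadic ranges that separate heights of essentially different behaviour. -/
def dyadicRange (M : ℕ) : ℕ := 200 * M * 6 ^ M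

/-- The scales used to find the dominant terms of a solution. -/
noncomputable def gapScale (M j : ℕ) : ℝ := ((2 : ℝ) ^ (100 * M * 6 ^ j))⁻¹

lemma gapScale_pos (M j : ℕ) : 0 < gapScale M j := by unfold gapScale; positivity

lemma gapScale_antitone (M : ℕ) : Antitone (gapScale M) := by
  intro i j hij
  unfold gapScale
  gcongr
  · norm_num
  · norm_num

lemma gapScale_succ (M j : ℕ) : gapScale M (j + 1) = gapScale M j ^ 6 := by
  unfold gapScale
  rw [inv_pow, ← pow_mul]
  congr 2
  ring

lemma gapScale_small (hM : 1 ≤ M) (j : ℕ) : 4 * 10 ^ 9 * M * gapScale M j ≤ 1 := by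
  unfold gapScale
  rw [← div_eq_mul_inv, div_le_one (by positivity)]
  have h1 : (M : ℝ) ≤ 2 ^ M := by exact_mod_cast Nat.lt_two_pow_self.le
  have h2 : (4 * 10 ^ 9 : ℝ) ≤ 2 ^ 99 := by norm_num
  calc (4 * 10 ^ 9 * M : ℝ) ≤ 2 ^ 99 * 2 ^ M := by gcongr
    _ = 2 ^ (99 + M) := (pow_add _ _ _).symm
    _ ≤ _ := by
      apply pow_le_pow_right₀ (by norm_num)
      have : 1 ≤ 6 ^ j := Nat.one_le_pow _ _ (by norm_num)
      nlinarith

lemma two_pow_le_gapScale_mul {r : ℕ} (hr : r < M) :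
    2 ^ 50 ≤ gapScale M (r + 1) * 2 ^ dyadicRange M := by
  unfold gapScale dyadicRange
  rw [inv_mul_eq_div, le_div_iff₀ (by positivity), ← pow_add]
  apply pow_le_pow_right₀ (by norm_num)
  have h1 : 6 ^ (r + 1) ≤ 6 ^ M := Nat.pow_le_pow_right (by norm_num) hr
  have h2 : 1 ≤ 6 ^ M := Nat.one_le_pow _ _ (by norm_num)
  have h3 : M * 6 ^ (r + 1) ≤ M * 6 ^ M := Nat.mul_le_mul_left _ h1
  have h4 : 1 ≤ M * 6 ^ M := Nat.mul_pos (by omega) h2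
  calc 50 + 100 * M * 6 ^ (r + 1) = 50 + 100 * (M * 6 ^ (r + 1)) := by ring
    _ ≤ 200 * (M * 6 ^ M) := by omega
    _ = _ := by ring

/-- Solutions of large height give approximate relations. -/
lemma exists_isApproxRelation [DecidableEq ι] (hβ : ∀ i, 2 ≤ β i) (hkl : k ≠ l)
    (hβkl : ∀ i ∈ I, β i = k ∨ β i = l) (hI : 2 ≤ I.card) (hM : I.card ≤ M) (hL : 1 ≤ L)
    (hF : IsNormalFamily β I a F L R) {e : ι → ℤ} (he : e ∈ F)
    (hH : 40 * L * R * 2 ^ dyadicRange M ≤ spread β I e) :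
    ∃ r < M, ∃ i j, β i = k ∧ β j = l ∧ IsApproxRelation (gapScale M r / 2)
      (11 * M * gapScale M r ^ 6) (spread β I e) ((k : ℚ) ^ e i / (l : ℚ) ^ e j) := by
  have hL0 : (1 : ℝ) ≤ L := by exact_mod_cast hL
  have hR : 1 / 2 ≤ R := by linarith [hF.log_two_le, Real.log_two_gt_d9]
  have hLR : 1 ≤ 2 * (L * R) := by nlinarith
  have hH0 : 0 < spread β I e := lt_of_lt_of_le (by positivity) hH
  obtain ⟨r, hr, T, hTI, hT0, hin, hout⟩ := exists_gap (I := I) (Finset.card_pos.1 (by omega))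
    (fun i => log (expVal β e i : ℝ)) hH0 (gapScale M) (gapScale_antitone M) (gapScale_pos M)
  have hrM : r < M := by omega
  have hM1 : 1 ≤ M := by omega
  have hM0 : (1 : ℝ) ≤ M := by exact_mod_cast hM1
  have hε0 := gapScale_pos M r
  have hsmall := gapScale_small hM1 r
  have hbig := two_pow_le_gapScale_mul hrM
  rw [gapScale_succ] at hin hout hbig
  set ε := gapScale M r
  set H := spread β I e
  have hε1 : ε ≤ 1 := by nlinarith
  have hε6 : 100 * M * ε ^ 6 ≤ ε := by
    calc 100 * M * ε ^ 6 = (100 * M * ε) * ε ^ 5 := by ring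
      _ ≤ 1 * ε ^ 5 := by gcongr; nlinarith
      _ ≤ ε ^ 1 := by rw [one_mul]; exact pow_le_pow_of_le_one hε0.le hε1 (by norm_num)
      _ = ε := pow_one ε
  have hε6' : ε ^ 6 ≤ M * ε ^ 6 := le_mul_of_one_le_left (by positivity) hM0
  have hB : 40 * L * R ≤ ε ^ 6 * H := by
    have h40 : 0 ≤ 40 * L * R := by positivity
    calc 40 * L * R ≤ 40 * L * R * (ε ^ 6 * 2 ^ dyadicRange M) := by
          apply le_mul_of_one_le_right h40
          linarith [show (1 : ℝ) ≤ 2 ^ 50 by norm_num]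
      _ = ε ^ 6 * (40 * L * R * 2 ^ dyadicRange M) := by ring
      _ ≤ _ := by gcongr
  have hHε := mul_le_mul_of_nonneg_right hε6 hH0.le
  have hHε' := mul_le_mul_of_nonneg_right hε6' hH0.le
  have hB0 : 0 < ε ^ 6 * H := by positivity
  have hHε1 := mul_le_mul_of_nonneg_right hε1 hH0.le
  have hMB : (M : ℝ) * (ε ^ 6 * H) = M * ε ^ 6 * H := by ring
  obtain ⟨i, hi, j, hj, hik, hjl, ⟨d, hd1, hd2, hd3⟩, hsz⟩ := exists_near_relation hβ hkl hβkl hI hM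
    (hF.isSolFamily.1 e he) (B := ε ^ 6 * H) (G := (ε - ε ^ 6) * H) (T := T)
    (by linarith) (by linarith) (by linarith)
    (fun i hi j hj => (hF.logSize_coeff_le i hi j hj).trans (by linarith)) hTI hT0 hin hout
  have hu : expVal β e i / expVal β e j = (k : ℚ) ^ e i / (l : ℚ) ^ e j := by
    rw [expVal, expVal, hik, hjl]
  have hlog := hin i hi j hj
  have hle := logSize_le_spread (β := β) e (hTI hi) (hTI hj)
  rw [← log_div (by exact_mod_cast expVal_ne_zero hβ e i)
    (by exact_mod_cast expVal_ne_zero hβ e j), ← Rat.cast_div] at hlog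
  rw [hu] at hd1 hd2 hsz hlog hle
  exact ⟨r, hrM, i, j, hik, hjl, ⟨d, hd1, hd2.trans (exp_le_exp.2 (by linarith)), by linarith⟩,
    by linarith, hle, by linarith⟩

lemma card_le_of_spread_range [Fintype ι] [DecidableEq ι] (hβ : ∀ i, 2 ≤ β i)
    (hM : L = (Fintype.card ι).factorial * Fintype.card ι)
    (hF : IsNormalFamily β I a F L R) (hI : 2 ≤ I.card) (hL : 1 ≤ L)
    (hc : ∀ p ⊆ F, IsNonspanning β I a p → p.card ≤ c) {Q : ℝ} (hQ : 40 * L * R ≤ Q) (w : ℕ)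
    {p : Finset (ι → ℤ)} (hpF : p ⊆ F)
    (hp : ∀ e ∈ p, Q ≤ spread β I e ∧ spread β I e < 2 ^ w * Q) :
    p.card ≤ w * ((2 * (400 * L) + 1) ^ (2 * Fintype.card ι) * c) := by
  have hR : 0 < R := (log_pos one_lt_two).trans_le hF.log_two_le
  have hQ0 : 0 ≤ Q := le_trans (by positivity) hQ
  classical
  induction w generalizing p with
  | zero =>
    have : p = ∅ := Finset.eq_empty_of_forall_notMem fun e he => by
      have := hp e he
      linarith
    simp [this]
  | succ w ih =>
    rw [← Finset.card_filter_add_card_filter_not fun e => spread β I e < 2 ^ w * Q, add_mul,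
      one_mul]
    refine add_le_add (ih ((Finset.filter_subset _ _).trans hpF) fun e he => ?_)
      (card_le_of_spread_window hβ hM hF hI hL hc (Q := 2 ^ w * Q) ?_
        ((Finset.filter_subset _ _).trans hpF) fun e he => ?_)
    · rw [Finset.mem_filter] at he
      exact ⟨(hp e he.1).1, he.2⟩
    · exact hQ.trans (le_mul_of_one_le_left hQ0 (one_le_pow₀ (by norm_num)))
    · rw [Finset.mem_filter, not_lt] at he
      have := (hp e he.1).2
      rw [pow_succ] at this
      exact ⟨he.2, by linarith⟩

/-- Solutions of large height in one class. -/
lemma card_le_of_class [Fintype ι] [DecidableEq ι] (hβ : ∀ i, 2 ≤ β i) (hk : 2 ≤ k) (hl : 2 ≤ l)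
    (hM : L = (Fintype.card ι).factorial * Fintype.card ι)
    (hF : IsNormalFamily β I a F L R) (hI : 2 ≤ I.card) (hL : 1 ≤ L)
    (hc : ∀ p ⊆ F, IsNonspanning β I a p → p.card ≤ c) {r : ℕ} (hr : r < Fintype.card ι) {i j : ι}
    {p : Finset (ι → ℤ)} (hpF : p ⊆ F)
    (hH : ∀ e ∈ p, 40 * L * R * 2 ^ dyadicRange (Fintype.card ι) ≤ spread β I e)
    (hp : ∀ e ∈ p, IsApproxRelation (gapScale (Fintype.card ι) r / 2)
      (11 * Fintype.card ι * gapScale (Fintype.card ι) r ^ 6) (spread β I e)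
      ((k : ℚ) ^ e i / (l : ℚ) ^ e j))
    (hs : ∀ e ∈ p, ∀ e' ∈ p, 0 ≤ e i * e' i) :
    p.card ≤ dyadicRange (Fintype.card ι) *
      ((2 * (400 * L) + 1) ^ (2 * Fintype.card ι) * c) := by
  rcases p.eq_empty_or_nonempty with rfl | hp0
  · simp
  obtain ⟨f, hf, hmin⟩ := p.exists_min_image (fun e => spread β I e) hp0
  have hL0 : (1 : ℝ) ≤ L := by exact_mod_cast hL
  have hR : 1 / 2 ≤ R := by linarith [hF.log_two_le, Real.log_two_gt_d9]
  have hLR : 1 ≤ 2 * (L * R) := by nlinarith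
  have hpw : (1 : ℝ) ≤ 2 ^ dyadicRange (Fintype.card ι) := one_le_pow₀ (by norm_num)
  refine card_le_of_spread_range hβ hM hF hI hL hc (Q := spread β I f) ?_ _ hpF
    fun e he => ⟨hmin e he, ?_⟩
  · exact le_trans (le_mul_of_one_le_right (by positivity) hpw) (hH f hf)
  have hM1 : 1 ≤ Fintype.card ι := by omega
  have hsmall := gapScale_small hM1 r
  have hε0 := gapScale_pos (Fintype.card ι) r
  have hbig := two_pow_le_gapScale_mul hr
  rw [gapScale_succ] at hbig
  have h1 := hp f hf
  have h2 := hp e he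
  have hHf := hH f hf
  set ε := gapScale (Fintype.card ι) r
  set M := Fintype.card ι
  have hM0 : (1 : ℝ) ≤ M := by exact_mod_cast hM1
  have hε1 : ε ≤ 1 := by nlinarith
  have hf0 : 2 ^ dyadicRange M ≤ spread β I f := by
    refine le_trans (le_mul_of_one_le_left (by positivity) ?_) hHf
    linarith
  have hη : 11 * M * ε ^ 6 ≤ (ε / 2) ^ 5 / 10 ^ 7 := by
    calc 11 * M * ε ^ 6 = (11 * M * ε) * ε ^ 5 := by ring
      _ ≤ (1 / (32 * 10 ^ 7)) * ε ^ 5 := by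
        gcongr
        linarith
      _ = _ := by ring
  have h3 := IsApproxRelation.lt_mul hk hl (half_pos hε0) (by linarith) (by positivity) hη
    (by
      rw [div_le_iff₀ (by positivity)]
      calc (10 : ℝ) ^ 10 ≤ (1 / 2 ^ 6) * 2 ^ 50 := by norm_num
        _ ≤ (1 / 2 ^ 6) * (ε ^ 6 * 2 ^ dyadicRange M) := by gcongr
        _ = 2 ^ dyadicRange M * (ε / 2) ^ 6 := by ring
        _ ≤ _ := by gcongr) h1 h2 (hs f hf e he)
  refine h3.trans_le (mul_le_mul_of_nonneg_right ?_ ((by positivity : (0 : ℝ) ≤ _).trans hf0))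
  rw [div_le_iff₀ (by positivity)]
  calc (10 : ℝ) ^ 9 ≤ (1 / 2 ^ 5) * 2 ^ 50 := by norm_num
    _ ≤ (1 / 2 ^ 5) * (ε ^ 6 * 2 ^ dyadicRange M) := by gcongr
    _ ≤ (1 / 2 ^ 5) * (ε ^ 5 * 2 ^ dyadicRange M) := by
      gcongr ?_ * (?_ * ?_)
      exact pow_le_pow_of_le_one hε0.le hε1 (by norm_num)
    _ = _ := by ring

/-- The base of the counting bound for equations in at most `M` terms. -/
def solConst (M : ℕ) : ℕ :=
  2 ^ M * (2 * (400 * (M.factorial * M)) + 1) ^ (2 * M) *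
    (1 + dyadicRange M + M * (M * (M * 2)) * dyadicRange M)

lemma one_le_solConst (M : ℕ) : 1 ≤ solConst M := by
  have : 0 < solConst M := by unfold solConst dyadicRange; positivity
  exact this

lemma card_le_of_isNormalFamily [Fintype ι] [DecidableEq ι] (hβ : ∀ i, 2 ≤ β i) (hk : 2 ≤ k)
    (hl : 2 ≤ l) (hkl : k ≠ l) (hβkl : ∀ i ∈ I, β i = k ∨ β i = l) (hI : 2 ≤ I.card)
    (hM : M = Fintype.card ι) (hF : IsNormalFamily β I a F (M.factorial * M) R)
    (hc : ∀ p ⊆ F, IsNonspanning β I a p → p.card ≤ c) :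
    F.card ≤ ((2 * (400 * (M.factorial * M)) + 1) ^ (2 * M) * c) *
      (1 + dyadicRange M + M * (M * (M * 2)) * dyadicRange M) := by
  classical
  subst hM
  set M := Fintype.card ι with hM
  set L := M.factorial * M with hL
  have hIM : I.card ≤ M := Finset.card_le_univ I
  have hL1 : 1 ≤ L := Nat.mul_pos M.factorial_pos (by omega)
  set c' := (2 * (400 * L) + 1) ^ (2 * M) * c with hc'
  set Q := 40 * (L : ℝ) * R with hQ
  have h1 : (F.filter fun e => spread β I e ≤ Q).card ≤ c' :=
    card_le_of_spread_lt hβ hF (Finset.card_pos.1 (by omega)) hL1 hc (Finset.filter_subset _ _)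
      fun e he => (Finset.mem_filter.1 he).2
  have h2 : (F.filter fun e => Q ≤ spread β I e ∧ spread β I e < 2 ^ dyadicRange M * Q).card ≤
      dyadicRange M * c' :=
    card_le_of_spread_range hβ rfl hF hI hL1 hc le_rfl _ (Finset.filter_subset _ _)
      fun e he => (Finset.mem_filter.1 he).2
  have h3 : (F.filter fun e => Q * 2 ^ dyadicRange M ≤ spread β I e).card ≤
      (M * (M * (M * 2))) * (dyadicRange M * c') := by
    have hcard : (Finset.range M ×ˢ ((Finset.univ : Finset ι) ×ˢ
        ((Finset.univ : Finset ι) ×ˢ (Finset.univ : Finset Bool)))).card = M * (M * (M * 2)) := by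
      simp [hM]
    rw [← hcard]
    refine card_le_mul_of_cover _ _ (fun (e : ι → ℤ) (y : ℕ × ι × ι × Bool) =>
      IsApproxRelation (gapScale M y.1 / 2) (11 * M * gapScale M y.1 ^ 6) (spread β I e)
        ((k : ℚ) ^ e y.2.1 / (l : ℚ) ^ e y.2.2.1) ∧ y.2.2.2 = decide (0 ≤ e y.2.1)) _ ?_ ?_
    · intro e he
      rw [Finset.mem_filter] at he
      obtain ⟨r, hr, i, j, -, -, h⟩ :=
        exists_isApproxRelation hβ hkl hβkl hI hIM hL1 hF he.1 he.2
      exact ⟨(r, i, j, decide (0 ≤ e i)), by simp [hr, le_or_gt], h, rfl⟩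
    · rintro ⟨r, i, j, b⟩ hy p hp hrel
      simp only [Finset.mem_product, Finset.mem_range, Finset.mem_univ, and_true] at hy
      refine card_le_of_class hβ hk hl rfl hF hI hL1 hc hy (i := i) (j := j)
        (hp.trans (Finset.filter_subset _ _)) (fun e he => (Finset.mem_filter.1 (hp he)).2)
        (fun e he => (hrel e he).1) fun e he e' he' => ?_
      have hb := (hrel e he).2.symm.trans (hrel e' he').2
      simp only [decide_eq_decide] at hb
      by_cases h : 0 ≤ e i
      · exact mul_nonneg h (hb.1 h)
      · have h' : ¬ 0 ≤ e' i := fun h' => h (hb.2 h')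
        exact mul_nonneg_of_nonpos_of_nonpos (by omega) (by omega)
  have hsub : F ⊆ (F.filter fun e => spread β I e ≤ Q) ∪
      ((F.filter fun e => Q ≤ spread β I e ∧ spread β I e < 2 ^ dyadicRange M * Q) ∪
        (F.filter fun e => Q * 2 ^ dyadicRange M ≤ spread β I e)) := by
    intro e he
    simp only [Finset.mem_union, Finset.mem_filter, he, true_and]
    rcases le_total (spread β I e) Q with h | h
    · exact Or.inl h
    · rcases lt_or_ge (spread β I e) (2 ^ dyadicRange M * Q) with h' | h'
      · exact Or.inr (Or.inl ⟨h, h'⟩)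
      · exact Or.inr (Or.inr (by rwa [mul_comm]))
  have h4 := (Finset.card_le_card hsub).trans ((Finset.card_union_le _ _).trans
    (add_le_add h1 ((Finset.card_union_le _ _).trans (add_le_add h2 h3))))
  refine h4.trans (le_of_eq (by ring))

/-- Bound for the number of nondegenerate solutions up to proportionality. -/
theorem solBound [Fintype ι] [DecidableEq ι] (hβ : ∀ i, 2 ≤ β i) (hk : 2 ≤ k) (hl : 2 ≤ l)
    (hkl : k ≠ l) (hβkl : ∀ i, β i = k ∨ β i = l) (N : ℕ) (hN : 2 ≤ N) :
    SolBound β N (solConst (Fintype.card ι) ^ (N - 2)) := by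
  induction N using Nat.strong_induction_on with
  | _ N ih =>
    intro I hI a F hF
    rcases hN.eq_or_lt with rfl | hN3
    · rw [Nat.sub_self, pow_zero]
      refine Finset.card_le_one.2 fun e he e' he' => hF.2 e he e' he' ?_
      obtain ⟨i, j, hij, rfl⟩ := Finset.card_eq_two.1 hI
      have h1 := (hF.1 e he).1
      have h2 := (hF.1 e' he').1
      have ha := (hF.1 e he).coeff_ne_zero (by omega) (i := i) (by simp)
      rw [Finset.sum_pair hij] at h1 h2
      have hji : expVal β e i * expVal β e' j = expVal β e j * expVal β e' i := by
        have hb := (hF.1 e he).coeff_ne_zero (by omega) (i := j) (by simp)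
        refine mul_left_cancel₀ (mul_ne_zero ha hb) ?_
        linear_combination (a j * expVal β e' j) * h1 - (a j * expVal β e j) * h2
      intro m hm n hn
      simp only [Finset.mem_insert, Finset.mem_singleton] at hm hn
      rcases hm with rfl | rfl <;> rcases hn with rfl | rfl
      · ring
      · exact hji
      · linear_combination -hji
      · ring
    · have hIM : I.card ≤ Fintype.card ι := Finset.card_le_univ I
      set M := Fintype.card ι with hM
      set K := solConst M with hK
      have hnon : ∀ (a : ι → ℚ) (F : Finset (ι → ℤ)), IsSolFamily β I a F →
          IsNonspanning β I a F → F.card ≤ 2 ^ N * K ^ (N - 3) := fun a F hF hns =>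
        card_le_of_isNonspanning hβ hN3 (fun n hn hnN => ih n hnN hn) hI hF hns
      have hKpow : K ^ (N - 2) = K * K ^ (N - 3) := by
        rw [← pow_succ']; congr 1; omega
      have h2N : 2 ^ N ≤ 2 ^ M := Nat.pow_le_pow_right (by norm_num) (by omega)
      rcases F.eq_empty_or_nonempty with rfl | hF0
      · simp
      by_cases hns : IsNonspanning β I a F
      · refine (hnon a F hF hns).trans ?_
        rw [hKpow]
        refine Nat.mul_le_mul_right _ (h2N.trans ?_)
        rw [hK, solConst, mul_assoc]
        exact Nat.le_mul_of_pos_right _ (by positivity)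
      · obtain ⟨a', F', R, hcard, hF'⟩ :=
          exists_isNormalFamily hβ (by omega) hIM hF0 hF hns
        rw [← hcard]
        refine (card_le_of_isNormalFamily hβ hk hl hkl (fun i _ => hβkl i) (by omega) hM hF'
          fun p hp hns => hnon a' p (hF'.isSolFamily.mono hp) hns).trans ?_
        rw [hKpow, hK, solConst]
        calc _ = 2 ^ N * ((2 * (400 * (M.factorial * M)) + 1) ^ (2 * M) *
              (1 + dyadicRange M + M * (M * (M * 2)) * dyadicRange M)) * K ^ (N - 3) := by
              rw [hK, solConst]; ring
          _ ≤ 2 ^ M * ((2 * (400 * (M.factorial * M)) + 1) ^ (2 * M) *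
              (1 + dyadicRange M + M * (M * (M * 2)) * dyadicRange M)) * K ^ (N - 3) := by gcongr
          _ = _ := by rw [hK, solConst]; ring

end Counting

section Words

lemma wordVal_eq_foldl_map (k : ℕ) (w : List (Fin k)) :
    wordVal k w = (w.map Fin.val).foldl (fun a c => k * a + c) 0 := by
  simp [wordVal, List.map_eq_flatMap]

lemma foldl_digits (k : ℕ) (w : List ℕ) (x : ℕ) :
    w.foldl (fun a c => k * a + c) x =
      x * k ^ w.length + w.foldl (fun a c => k * a + c) 0 := by
  induction w generalizing x with
  | nil => simp
  | cons c w ih =>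
    rw [List.foldl_cons, List.foldl_cons, ih, ih (k * 0 + c), List.length_cons]
    ring

lemma wordVal_append (k : ℕ) (x y : List (Fin k)) :
    wordVal k (x ++ y) = wordVal k x * k ^ y.length + wordVal k y := by
  simp only [wordVal_eq_foldl_map, List.map_append, List.foldl_append]
  rw [foldl_digits, List.length_map]

lemma wordPow_succ {α : Type*} (w : List α) (n : ℕ) : wordPow w (n + 1) = w ++ wordPow w n := by
  simp [wordPow, List.replicate_succ]

lemma length_wordPow {α : Type*} (w : List α) (n : ℕ) :
    (wordPow w n).length = w.length * n := by
  induction n with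
  | zero => simp [wordPow]
  | succ n ih => rw [wordPow_succ, List.length_append, ih]; ring

lemma wordVal_wordPow {k : ℕ} (hk : 2 ≤ k) (w : List (Fin k)) (hw : w ≠ []) (n : ℕ) :
    (wordVal k (wordPow w n) : ℚ) =
      wordVal k w / ((k : ℚ) ^ w.length - 1) * ((k : ℚ) ^ (w.length * n) - 1) := by
  have hL : (k : ℚ) ^ w.length - 1 ≠ 0 := by
    have h1 : 1 < k ^ w.length := Nat.one_lt_pow (by simpa using hw) (by omega)
    have h2 : (1 : ℚ) < (k : ℚ) ^ w.length := by exact_mod_cast h1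
    linarith
  induction n with
  | zero => simp [wordPow, wordVal]
  | succ n ih =>
    rw [wordPow_succ, wordVal_append, length_wordPow]
    push_cast
    rw [ih, mul_add, mul_one, pow_add]
    field_simp
    ring

lemma patternWord_succ {α : Type*} (s : ℕ) (v w : ℕ → List α) (n : ℕ → ℕ) :
    patternWord (s + 1) v w n =
      patternWord s v w n ++ (wordPow (w (s + 1)) (n (s + 1)) ++ v (s + 1)) := by
  simp [patternWord, List.range_succ]

/-- Values of pattern words are exponential sums with fixed coefficients. -/
lemma wordVal_patternWord {k : ℕ} (hk : 2 ≤ k) (s : ℕ) (v w : ℕ → List (Fin k))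
    (hw : ∀ i, 1 ≤ i → i ≤ s → w i ≠ []) :
    ∃ A : ℕ → ℚ, ∀ n : ℕ → ℕ, ∃ E : ℕ → ℕ, E s = 0 ∧
      (wordVal k (patternWord s v w n) : ℚ) = ∑ i ∈ Finset.range (s + 1), A i * (k : ℚ) ^ E i := by
  induction s with
  | zero => exact ⟨fun _ => wordVal k (v 0), fun n => ⟨fun _ => 0, rfl, by simp [patternWord]⟩⟩
  | succ s ih =>
    obtain ⟨A, hA⟩ := ih fun i hi his => hw i hi (by omega)
    set c : ℚ := wordVal k (w (s + 1)) / ((k : ℚ) ^ (w (s + 1)).length - 1) with hc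
    set g : ℚ := (k : ℚ) ^ (v (s + 1)).length with hg
    refine ⟨fun i => if i < s then A i * g else if i = s then (A s + c) * g else
      wordVal k (v (s + 1)) - c * g, fun n => ?_⟩
    obtain ⟨E, hE, hval⟩ := hA n
    refine ⟨fun i => if i ≤ s then E i + (w (s + 1)).length * n (s + 1) else 0, by simp, ?_⟩
    rw [patternWord_succ, wordVal_append, wordVal_append, List.length_append, length_wordPow]
    push_cast
    rw [hval, wordVal_wordPow hk _ (hw (s + 1) (by omega) le_rfl), Finset.sum_range_succ _ (s + 1),
      Finset.sum_range_succ _ s, Finset.sum_range_succ _ s, ← hc, hE, pow_add, ← hg]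
    have hsum : ∑ i ∈ Finset.range s, (if i < s then A i * g else if i = s then (A s + c) * g else
        wordVal k (v (s + 1)) - c * g) *
        (k : ℚ) ^ (if i ≤ s then E i + (w (s + 1)).length * n (s + 1) else 0) =
        (∑ i ∈ Finset.range s, A i * (k : ℚ) ^ E i) *
          (k : ℚ) ^ ((w (s + 1)).length * n (s + 1)) * g := by
      rw [Finset.sum_mul, Finset.sum_mul]
      refine Finset.sum_congr rfl fun i hi => ?_
      rw [Finset.mem_range] at hi
      rw [if_pos hi, if_pos hi.le, pow_add]
      ring
    rw [hsum]
    simp only [lt_irrefl, if_false, if_true, le_refl]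
    rw [if_neg (by omega), if_neg (by omega), if_neg (by omega)]
    ring

end Words

section Values

variable {ι : Type*} {β : ι → ℕ} {k l : ℕ}

lemma expVal_eq_of_isPropOn (hβ : ∀ i, 2 ≤ β i) (hkl : MultIndep k l) {J : Finset ι}
    {e e' : ι → ℤ} (h : IsPropOn β J e e') {i j : ι} (hi : i ∈ J) (hj : j ∈ J) (hik : β i = k)
    (hjl : β j = l) : ∀ m ∈ J, expVal β e m = expVal β e' m := by
  have h1 : (k : ℚ) ^ (e i - e' i) = (l : ℚ) ^ (e j - e' j) := by
    have h2 := h i hi j hj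
    have hi0 := expVal_ne_zero hβ e' i
    have hj0 := expVal_ne_zero hβ e' j
    rw [zpow_sub₀ (by have := hβ i; rw [hik] at this; positivity),
      zpow_sub₀ (by have := hβ j; rw [hjl] at this; positivity)]
    rw [expVal, expVal, expVal, expVal, hik, hjl] at *
    rw [div_eq_div_iff hi0 hj0]
    linear_combination h2
  have h2 : expVal β e i = expVal β e' i := by
    rw [expVal, expVal, sub_eq_zero.1 (hkl _ _ h1).1]
  intro m hm
  have h3 := h i hi m hm
  rw [h2] at h3
  refine mul_left_cancel₀ (expVal_ne_zero hβ e' i) ?_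
  linear_combination -h3

/-- The contribution of base `k` to a nondegenerate solution takes few values. -/
lemma exists_finset_nondeg [Fintype ι] [DecidableEq ι] (hβ : ∀ i, 2 ≤ β i) (hk : 2 ≤ k)
    (hl : 2 ≤ l) (hkl : MultIndep k l) (hne : k ≠ l) (hβkl : ∀ i, β i = k ∨ β i = l)
    (J : Finset ι) (a : ι → ℚ) :
    ∃ W : Finset ℚ, W.card ≤ solConst (Fintype.card ι) ^ Fintype.card ι ∧
      ∀ e, IsNondegSol β J a e → ∑ i ∈ J.filter (fun i => β i = k), a i * expVal β e i ∈ W := by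
  classical
  have hK : 1 ≤ solConst (Fintype.card ι) := one_le_solConst _
  set K := solConst (Fintype.card ι)
  by_cases hmix : (∃ i ∈ J, β i = k) ∧ ∃ j ∈ J, β j = l
  · obtain ⟨⟨i, hi, hik⟩, j, hj, hjl⟩ := hmix
    have hij : i ≠ j := by rintro rfl; exact hne (hik.symm.trans hjl)
    have hJ2 : 2 ≤ J.card := Finset.one_lt_card.2 ⟨i, hi, j, hj, hij⟩
    set V : Set ℚ := {x | ∃ e, IsNondegSol β J a e ∧
      x = ∑ i ∈ J.filter (fun i => β i = k), a i * expVal β e i} with hV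
    have hfin : ∀ W : Finset ℚ, (W : Set ℚ) ⊆ V → W.card ≤ K ^ Fintype.card ι := by
      intro W hW
      have hex : ∀ x : ℚ, ∃ e, x ∈ W → IsNondegSol β J a e ∧
          x = ∑ i ∈ J.filter (fun i => β i = k), a i * expVal β e i := by
        intro x
        by_cases hx : x ∈ W
        · obtain ⟨e, he⟩ := hW hx
          exact ⟨e, fun _ => he⟩
        · exact ⟨0, fun h => absurd h hx⟩
      choose g hg using hex
      have hprop : ∀ x ∈ W, ∀ y ∈ W, IsPropOn β J (g x) (g y) → x = y := by
        intro x hx y hy h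
        rw [(hg x hx).2, (hg y hy).2]
        refine Finset.sum_congr rfl fun m hm => ?_
        rw [expVal_eq_of_isPropOn hβ hkl h hi hj hik hjl m (Finset.mem_filter.1 hm).1]
      have hcard : (W.image g).card = W.card := Finset.card_image_of_injOn fun x hx y hy h => by
        refine hprop x hx y hy ?_
        rw [h]; exact IsPropOn.refl J _
      rw [← hcard]
      refine (solBound hβ hk hl hne hβkl J.card hJ2 J rfl a (W.image g) ⟨?_, ?_⟩).trans
        (Nat.pow_le_pow_right hK ((Nat.sub_le _ _).trans (Finset.card_le_univ J)))
      · intro e he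
        obtain ⟨x, hx, rfl⟩ := Finset.mem_image.1 he
        exact (hg x hx).1
      · intro e he e' he' h
        obtain ⟨x, hx, rfl⟩ := Finset.mem_image.1 he
        obtain ⟨y, hy, rfl⟩ := Finset.mem_image.1 he'
        rw [hprop x hx y hy h]
    have hVfin : V.Finite := by
      by_contra hinf
      obtain ⟨W, hW, hWc⟩ := Set.Infinite.exists_subset_card_eq hinf (K ^ Fintype.card ι + 1)
      have := hfin W hW
      omega
    refine ⟨hVfin.toFinset, hfin _ (by simp), fun e he => ?_⟩
    rw [Set.Finite.mem_toFinset]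
    exact ⟨e, he, rfl⟩
  · refine ⟨{0}, by simpa using Nat.one_le_pow _ _ hK, fun e he => Finset.mem_singleton.2 ?_⟩
    rw [not_and_or] at hmix
    rcases hmix with h | h
    · rw [Finset.filter_false_of_mem fun i hi hik => h ⟨i, hi, hik⟩, Finset.sum_empty]
    · rw [Finset.filter_true_of_mem fun i hi => (hβkl i).resolve_right fun hil => h ⟨i, hi, hil⟩]
      exact he.1

/-- The contribution of base `k` to a vanishing sum takes few values. -/
lemma exists_finset_values [Fintype ι] [DecidableEq ι] (hβ : ∀ i, 2 ≤ β i) (hk : 2 ≤ k)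
    (hl : 2 ≤ l) (hkl : MultIndep k l) (hne : k ≠ l) (hβkl : ∀ i, β i = k ∨ β i = l)
    (S : Finset ι) (a : ι → ℚ) :
    ∃ U : Finset ℚ,
      U.card ≤ (2 ^ Fintype.card ι * solConst (Fintype.card ι) ^ Fintype.card ι) ^ S.card ∧
      ∀ e, ∑ i ∈ S, a i * expVal β e i = 0 →
        ∑ i ∈ S.filter (fun i => β i = k), a i * expVal β e i ∈ U := by
  classical
  have hK : 1 ≤ solConst (Fintype.card ι) := one_le_solConst _
  set M := Fintype.card ι with hM
  set K := solConst M
  set c := 2 ^ M * K ^ M with hc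
  have hc1 : 1 ≤ c := Nat.mul_pos (by positivity) (Nat.pow_pos hK)
  induction S using Finset.strongInduction with
  | H S ih =>
    rcases S.eq_empty_or_nonempty with rfl | hS
    · exact ⟨{0}, by simp, by simp⟩
    choose W hWc hW using fun J : Finset ι => exists_finset_nondeg hβ hk hl hkl hne hβkl J a
    have hex : ∀ J : Finset ι, ∃ U : Finset ℚ, J ⊂ S → U.card ≤ c ^ J.card ∧
        ∀ e, ∑ i ∈ J, a i * expVal β e i = 0 →
          ∑ i ∈ J.filter (fun i => β i = k), a i * expVal β e i ∈ U := by
      intro J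
      by_cases h : J ⊂ S
      · obtain ⟨U, hU⟩ := ih J h
        exact ⟨U, fun _ => hU⟩
      · exact ⟨∅, fun h' => absurd h' h⟩
    choose U hU using hex
    refine ⟨(S.powerset.filter Finset.Nonempty).biUnion fun J =>
      (W J ×ˢ U (S \ J)).image fun x => x.1 + x.2, ?_, ?_⟩
    · refine (Finset.card_biUnion_le_card_mul _ _ (K ^ M * c ^ (S.card - 1))
        fun J hJ => ?_).trans ?_
      · rw [Finset.mem_filter, Finset.mem_powerset] at hJ
        have hss : S \ J ⊂ S := Finset.sdiff_ssubset hJ.1 hJ.2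
        refine Finset.card_image_le.trans ?_
        rw [Finset.card_product]
        refine Nat.mul_le_mul (hWc J) ((hU _ hss).1.trans (Nat.pow_le_pow_right hc1 ?_))
        have := Finset.card_lt_card hss
        omega
      · have h1 : (S.powerset.filter Finset.Nonempty).card ≤ 2 ^ M := by
          refine (Finset.card_filter_le _ _).trans ?_
          rw [Finset.card_powerset]
          exact Nat.pow_le_pow_right (by norm_num) (Finset.card_le_univ S)
        have hSc : c ^ S.card = c * c ^ (S.card - 1) := by
          rw [← pow_succ']
          congr 1
          have := Finset.card_pos.2 hS
          omega
        calc _ ≤ 2 ^ M * (K ^ M * c ^ (S.card - 1)) := Nat.mul_le_mul_right _ h1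
          _ = _ := by rw [hSc, hc, mul_assoc]
    · intro e he
      obtain ⟨J, hJS, hJ0, hJ⟩ := exists_minimal_vanishing S hS a e he
      refine Finset.mem_biUnion.2 ⟨J, by simp [hJS, hJ0], Finset.mem_image.2
        ⟨(∑ i ∈ J.filter (fun i => β i = k), a i * expVal β e i,
          ∑ i ∈ (S \ J).filter (fun i => β i = k), a i * expVal β e i), ?_, ?_⟩⟩
      · refine Finset.mem_product.2 ⟨hW J e hJ, (hU _ (Finset.sdiff_ssubset hJS hJ0)).2 e ?_⟩
        rw [← Finset.sum_sdiff hJS, hJ.1, add_zero] at he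
        exact he
      · simp only [Finset.sum_filter]
        rw [add_comm]
        exact Finset.sum_sdiff hJS

end Values

section Final

lemma solConst_le (M : ℕ) (hM : 4 ≤ M) : solConst M ≤ 2 ^ (5 * M ^ 3) := by
  have hM2 : M ≤ 2 ^ M := Nat.lt_two_pow_self.le
  have hfac : M.factorial ≤ 2 ^ (M * M) := by
    rw [pow_mul]
    exact (Nat.factorial_le_pow M).trans (Nat.pow_le_pow_left hM2 M)
  have h6 : 6 ^ M ≤ 2 ^ (3 * M) := by
    rw [pow_mul]
    exact Nat.pow_le_pow_left (by norm_num) M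
  have hfM : M.factorial * M ≤ 2 ^ (M * M + M) := by
    rw [pow_add]
    exact Nat.mul_le_mul hfac hM2
  have hx : 2 * (400 * (M.factorial * M)) + 1 ≤ 2 ^ (10 + (M * M + M)) := by
    have h1 : 1 ≤ 2 ^ (M * M + M) := Nat.one_le_two_pow
    rw [pow_add]
    omega
  have hD : dyadicRange M ≤ 2 ^ (8 + M + 3 * M) := by
    rw [dyadicRange, pow_add, pow_add]
    exact Nat.mul_le_mul (Nat.mul_le_mul (by norm_num) hM2) h6
  have hM3 : M * (M * (M * 2)) ≤ 2 ^ (3 * M + 1) := by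
    calc M * (M * (M * 2)) ≤ 2 ^ M * (2 ^ M * (2 ^ M * 2)) := by gcongr
      _ = _ := by ring
  have hlast : 1 + dyadicRange M + M * (M * (M * 2)) * dyadicRange M ≤ 2 ^ (11 + 7 * M) := by
    have h1 : M * (M * (M * 2)) * dyadicRange M ≤ 2 ^ (9 + 7 * M) := by
      calc _ ≤ 2 ^ (3 * M + 1) * 2 ^ (8 + M + 3 * M) := Nat.mul_le_mul hM3 hD
        _ = _ := by rw [← pow_add]; congr 1; ring
    have h2 : 2 ^ (8 + M + 3 * M) ≤ 2 ^ (9 + 7 * M) :=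
      Nat.pow_le_pow_right (by norm_num) (by omega)
    have h3 : 1 ≤ 2 ^ (9 + 7 * M) := Nat.one_le_two_pow
    have h4 : 2 ^ (11 + 7 * M) = 4 * 2 ^ (9 + 7 * M) := by ring
    omega
  calc solConst M ≤ 2 ^ M * (2 ^ (10 + (M * M + M))) ^ (2 * M) * 2 ^ (11 + 7 * M) :=
        Nat.mul_le_mul (Nat.mul_le_mul_left _ (Nat.pow_le_pow_left hx _)) hlast
    _ = 2 ^ (M + (10 + (M * M + M)) * (2 * M) + (11 + 7 * M)) := by
        rw [← pow_mul, ← pow_add, ← pow_add]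
    _ ≤ 2 ^ (5 * M ^ 3) := by
        refine Nat.pow_le_pow_right (by norm_num) ?_
        obtain ⟨m, rfl⟩ := Nat.exists_eq_add_of_le hM
        ring_nf
        nlinarith [Nat.zero_le (m ^ 3), Nat.zero_le (m ^ 2)]

lemma count_le (M : ℕ) (hM : 4 ≤ M) :
    (2 ^ M * solConst M ^ M) ^ M ≤ (8 * (M - 1)) ^ (10 * M ^ 5 - M) := by
  have hM5 : M ≤ M ^ 5 := Nat.le_self_pow (by norm_num) M
  have hM25 : M ^ 2 ≤ M ^ 5 := Nat.pow_le_pow_right (by omega) (by norm_num)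
  calc (2 ^ M * solConst M ^ M) ^ M ≤ (2 ^ M * (2 ^ (5 * M ^ 3)) ^ M) ^ M := by
        gcongr; exact solConst_le M hM
    _ = 2 ^ (M ^ 2 + 5 * M ^ 5) := by
        rw [← pow_mul, ← pow_add, ← pow_mul]; congr 1; ring
    _ ≤ 2 ^ (4 * (10 * M ^ 5 - M)) := Nat.pow_le_pow_right (by norm_num) (by omega)
    _ = 16 ^ (10 * M ^ 5 - M) := by rw [pow_mul]; norm_num
    _ ≤ _ := Nat.pow_le_pow_left (by omega) _

end Final

/-- If `k` and `ℓ` are multiplicatively independent, `s, t ≥ 1`,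
`X = {[v₀ w₁^{n₁} v₁ ⋯ w_s^{n_s} v_s]_k}` and
`Y = {[u₀ y₁^{m₁} u₁ ⋯ y_t^{m_t} u_t]_ℓ}`, then
`|X ∩ Y| ≤ (8(s+t+1))^{10(s+t+2)^5 - (s+t+2)}`. -/
theorem pattern_sets_intersection_bound
    (k l : ℕ) (hk : 2 ≤ k) (hl : 2 ≤ l) (hkl : MultIndep k l)
    (s t : ℕ) (hs : 1 ≤ s) (ht : 1 ≤ t)
    (v w : ℕ → List (Fin k)) (hw : ∀ i, 1 ≤ i → i ≤ s → w i ≠ [])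
    (u y : ℕ → List (Fin l)) (hy : ∀ j, 1 ≤ j → j ≤ t → y j ≠ [])
    (X Y : Set ℕ)
    (hX : X = Set.range fun n : ℕ → ℕ => wordVal k (patternWord s v w n))
    (hY : Y = Set.range fun m : ℕ → ℕ => wordVal l (patternWord t u y m)) :
    (X ∩ Y).Finite ∧
      (X ∩ Y).ncard ≤ (8 * (s + t + 1)) ^ (10 * (s + t + 2) ^ 5 - (s + t + 2)) := by
  have hne : k ≠ l := by
    rintro rfl
    exact one_ne_zero (hkl 1 1 rfl).1
  obtain ⟨A, hA⟩ := wordVal_patternWord hk s v w hw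
  obtain ⟨C, hC⟩ := wordVal_patternWord hl t u y hy
  set β : Fin (s + 1) ⊕ Fin (t + 1) → ℕ := Sum.elim (fun _ => k) (fun _ => l) with hβdef
  set a : Fin (s + 1) ⊕ Fin (t + 1) → ℚ := Sum.elim (fun i => A i) (fun j => -C j) with ha
  have hβ : ∀ i, 2 ≤ β i := by rintro (i | j) <;> simpa [hβdef]
  have hβkl : ∀ i, β i = k ∨ β i = l := by rintro (i | j) <;> simp [hβdef]
  obtain ⟨U, hUc, hU⟩ := exists_finset_values hβ hk hl hkl hne hβkl Finset.univ a
  have hcard : Fintype.card (Fin (s + 1) ⊕ Fin (t + 1)) = s + t + 2 := by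
    rw [Fintype.card_sum, Fintype.card_fin, Fintype.card_fin]; omega
  rw [Finset.card_univ, hcard] at hUc
  have hmem : ∀ n ∈ X ∩ Y, (n : ℚ) ∈ (U : Set ℚ) := by
    rintro n ⟨hnX, hnY⟩
    rw [hX] at hnX
    rw [hY] at hnY
    obtain ⟨p, hp⟩ := hnX
    obtain ⟨q, hq⟩ := hnY
    obtain ⟨E, -, hE⟩ := hA p
    obtain ⟨F, -, hF⟩ := hC q
    simp only at hp hq
    rw [hp, Finset.sum_range] at hE
    rw [hq, Finset.sum_range] at hF
    have h := hU (Sum.elim (fun i => (E i : ℤ)) fun j => (F j : ℤ)) (by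
      simp [ha, hβdef, expVal, ← hE, ← hF])
    rw [Finset.sum_filter] at h
    simpa [ha, hβdef, expVal, hne.symm, ← hE] using h
  have hinj : Set.InjOn (Nat.cast : ℕ → ℚ) (X ∩ Y) := Nat.cast_injective.injOn
  refine ⟨Set.Finite.of_injOn hmem hinj U.finite_toSet, ?_⟩
  refine (Set.ncard_le_ncard_of_injOn _ hmem hinj U.finite_toSet).trans ?_
  rw [Set.ncard_coe_finset]
  exact hUc.trans (count_le (s + t + 2) (by omega))
end

section
/- Let $k \ge 2$ be a natural number and let $S$ be a $k$-automatic subset of the natural numbers. Then either $S$ has positive lower density, i.e., $\liminf_{x \to \infty} \pi_S(x)/x > 0$, or there exists $\varepsilon > 0$ such that $\pi_S(x) = O(x^{1-\varepsilon})$ as $x \to \infty$. -/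
/-- The language of base-`k` expansions (without leading zeros) of the
elements of a set `S ⊆ ℕ`. -/
def NatReprLang (k : ℕ) (S : Set ℕ) : Language (Fin k) :=
  { w | (∀ c ∈ w.head?, (c : ℕ) ≠ 0) ∧ wordVal k w ∈ S }

/-- A set `S ⊆ ℕ` is `k`-automatic if the language of base-`k` expansions of
its elements is accepted by a DFA. -/
def IsAutomaticSet (k : ℕ) (S : Set ℕ) : Prop :=
  (NatReprLang k S).IsRegular

/-- The counting function `π_S(x) = #{n ∈ S : n ≤ x}`. -/
noncomputable def countFn (S : Set ℕ) (x : ℕ) : ℕ :=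
  {n ∈ S | n ≤ x}.ncard

section WordValue

variable {k : ℕ}

theorem wordVal_eq_ofDigits (w : List (Fin k)) :
    wordVal k w = Nat.ofDigits k (w.reverse.map Fin.val) := by
  induction w using List.reverseRecOn with
  | nil => simp [wordVal]
  | append_singleton w c ih =>
    have h : wordVal k (w ++ [c]) = k * wordVal k w + c := by simp [wordVal]
    rw [h, ih]
    simp [Nat.ofDigits_cons, add_comm]

theorem wordVal_lt_pow (hk : 2 ≤ k) (w : List (Fin k)) : wordVal k w < k ^ w.length := by
  rw [wordVal_eq_ofDigits]
  have h := Nat.ofDigits_lt_base_pow_length (b := k) (l := w.reverse.map Fin.val) (by omega)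
    (by simp only [List.mem_map]; rintro _ ⟨c, -, rfl⟩; exact c.2)
  simpa using h

/-- Distinct words without leading zeros represent distinct numbers. -/
theorem wordVal_injOn (hk : 2 ≤ k) :
    Set.InjOn (wordVal k) {w | ∀ c ∈ w.head?, (c : ℕ) ≠ 0} := by
  have key : ∀ w : List (Fin k), (∀ c ∈ w.head?, (c : ℕ) ≠ 0) →
      Nat.digits k (wordVal k w) = w.reverse.map Fin.val := by
    intro w hw
    rw [wordVal_eq_ofDigits]
    refine Nat.digits_ofDigits k (by omega) _ ?_ ?_
    · simp only [List.mem_map]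
      rintro _ ⟨c, -, rfl⟩
      exact c.2
    · intro h
      cases w with
      | nil => simp at h
      | cons c w => simpa using hw c
  intro v hv w hw h
  have hmap : v.reverse.map Fin.val = w.reverse.map Fin.val := by
    rw [← key v hv, ← key w hw, h]
  exact List.reverse_injective (List.map_injective_iff.2 Fin.val_injective hmap)

/-- Every number below `k ^ n` has an expansion without leading zeros of length at most `n`. -/
theorem exists_wordVal_eq (hk : 2 ≤ k) {m n : ℕ} (hm : m < k ^ n) :
    ∃ w : List (Fin k), (∀ c ∈ w.head?, (c : ℕ) ≠ 0) ∧ wordVal k w = m ∧ w.length ≤ n := by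
  let f : ℕ → Fin k := fun d => ⟨d % k, Nat.mod_lt _ (by omega)⟩
  have hf : (Nat.digits k m).map (fun d => (f d : ℕ)) = Nat.digits k m := by
    conv_rhs => rw [← List.map_id (Nat.digits k m)]
    refine List.map_congr_left fun d hd => ?_
    exact Nat.mod_eq_of_lt (Nat.digits_lt_base (by omega) hd)
  refine ⟨((Nat.digits k m).map f).reverse, ?_, ?_, ?_⟩
  · intro c hc
    rw [List.head?_reverse, List.getLast?_map] at hc
    rcases hd : (Nat.digits k m).getLast? with _ | d
    · simp [hd] at hc
    · simp only [hd, Option.map_some, Option.mem_some_iff] at hc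
      obtain ⟨hne, rfl⟩ := List.mem_getLast?_eq_getLast hd
      have hlast := List.getLast_mem hne
      subst hc
      change (Nat.digits k m).getLast hne % k ≠ 0
      rw [Nat.mod_eq_of_lt (Nat.digits_lt_base (by omega) hlast)]
      exact Nat.getLast_digit_ne_zero k (Nat.digits_ne_nil_iff_ne_zero.1 hne)
  · rw [wordVal_eq_ofDigits, List.reverse_reverse, List.map_map]
    exact (congrArg _ hf).trans (Nat.ofDigits_digits k m)
  · simpa using (Nat.digits_length_le_iff (by omega) m).2 hm

end WordValue

section Counting

/-- The words of length `n`. -/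
noncomputable def wordsOfLength (k n : ℕ) : Finset (List (Fin k)) :=
  (List.finite_length_eq (Fin k) n).toFinset

theorem mem_wordsOfLength {k n : ℕ} {w : List (Fin k)} :
    w ∈ wordsOfLength k n ↔ w.length = n := by
  simp [wordsOfLength]

theorem card_wordsOfLength (k n : ℕ) : (wordsOfLength k n).card = k ^ n := by
  have h := card_vector (α := Fin k) n
  rw [Fintype.card_fin] at h
  rw [← h, ← Fintype.card_coe]
  exact Fintype.card_congr (Equiv.subtypeEquivRight fun w => mem_wordsOfLength)

theorem countFn_le (S : Set ℕ) (x : ℕ) : countFn S x ≤ x + 1 := by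
  have h : {n ∈ S | n ≤ x} ⊆ (Finset.range (x + 1) : Set ℕ) := by
    intro n hn
    simpa [Nat.lt_succ_iff] using hn.2
  have := Set.ncard_le_ncard h (Finset.finite_toSet _)
  rwa [Set.ncard_coe_finset, Finset.card_range] at this

theorem card_le_countFn {S : Set ℕ} {x : ℕ} {s : Finset ℕ} (hs : ∀ n ∈ s, n ∈ S ∧ n ≤ x) :
    s.card ≤ countFn S x := by
  rw [← Set.ncard_coe_finset]
  exact Set.ncard_le_ncard (fun n hn => hs n hn)
    ((Set.finite_Iic x).subset fun n hn => hn.2)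

theorem countFn_le_card {S : Set ℕ} {x : ℕ} {s : Finset ℕ} (hs : ∀ n ∈ S, n ≤ x → n ∈ s) :
    countFn S x ≤ s.card := by
  rw [← Set.ncard_coe_finset]
  exact Set.ncard_le_ncard (fun n hn => hs n hn.1 hn.2) (Finset.finite_toSet _)

end Counting

section Asymptotics

theorem liminf_pos_of_pow_le {S : Set ℕ} {k : ℕ} (hk : 2 ≤ k) (d : ℕ)
    (h : ∀ m, k ^ m ≤ countFn S (k ^ (d + m))) :
    0 < Filter.liminf (fun x : ℕ => (countFn S x : ℝ) / x) Filter.atTop := by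
  have hk0 : (0 : ℝ) < k := by exact_mod_cast (by omega : 0 < k)
  have hc : (0 : ℝ) < 1 / (k : ℝ) ^ (d + 1) := by positivity
  refine lt_of_lt_of_le hc (Filter.le_liminf_of_le ?_ ?_)
  · refine Filter.IsBoundedUnder.isCoboundedUnder_ge ?_
    refine Filter.isBoundedUnder_of_eventually_le (a := (2 : ℝ)) ?_
    filter_upwards [Filter.eventually_ge_atTop 1] with x hx
    have hx' : (1 : ℝ) ≤ x := by exact_mod_cast hx
    rw [div_le_iff₀ (by linarith)]
    have : (countFn S x : ℝ) ≤ x + 1 := by exact_mod_cast countFn_le S x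
    linarith
  · filter_upwards [Filter.eventually_ge_atTop (k ^ d)] with x hx
    have hx0 : 0 < x := lt_of_lt_of_le (pow_pos (by omega) d) hx
    obtain ⟨m, hm⟩ := Nat.exists_eq_add_of_le (Nat.le_log_of_pow_le (by omega) hx)
    have hle : k ^ (d + m) ≤ x := hm ▸ Nat.pow_log_le_self k hx0.ne'
    have hlt : x < k ^ (d + m + 1) := hm ▸ Nat.lt_pow_succ_log_self (by omega) x
    have hmono : countFn S (k ^ (d + m)) ≤ countFn S x :=
      Set.ncard_le_ncard (fun n hn => ⟨hn.1, hn.2.trans hle⟩)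
        ((Set.finite_Iic x).subset fun n hn => hn.2)
    have h1 : (k : ℝ) ^ m ≤ countFn S x := by exact_mod_cast (h m).trans hmono
    have h2 : (x : ℝ) ≤ (k : ℝ) ^ (d + m + 1) := by exact_mod_cast hlt.le
    rw [div_le_div_iff₀ (by positivity) (by exact_mod_cast hx0), one_mul]
    calc (x : ℝ) ≤ (k : ℝ) ^ (d + m + 1) := h2
      _ = (k : ℝ) ^ m * (k : ℝ) ^ (d + 1) := by ring
      _ ≤ _ := by gcongr

/-- A sequence bounded by `k ^ n` that grows by a factor of at most `k ^ L - 1` over every `L`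
steps is exponentially smaller than `k ^ n`. -/
theorem exists_le_mul_pow {a : ℕ → ℕ} {k L : ℕ} (hk : 2 ≤ k) (hL : 0 < L)
    (ha : ∀ n, a n ≤ k ^ n) (hrec : ∀ n, a (n + L) ≤ (k ^ L - 1) * a n) :
    ∃ β : ℝ, 1 < β ∧ β < k ∧ ∀ n, (a n : ℝ) ≤ (k : ℝ) ^ L * β ^ n := by
  have hk1 : (2 : ℝ) ≤ k := by exact_mod_cast hk
  have hkL : (2 : ℝ) ≤ (k : ℝ) ^ L := hk1.trans (le_self_pow₀ (by linarith) hL.ne')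
  set β : ℝ := ((k : ℝ) ^ L - 1 / 2) ^ ((L : ℝ)⁻¹) with hβ
  have hβ0 : 0 ≤ β := Real.rpow_nonneg (by linarith) _
  have hβL : β ^ L = (k : ℝ) ^ L - 1 / 2 := Real.rpow_inv_natCast_pow (by linarith) hL.ne'
  have hβ1 : 1 < β := by
    refine lt_of_pow_lt_pow_left₀ L hβ0 ?_
    rw [one_pow, hβL]; linarith
  refine ⟨β, hβ1, lt_of_pow_lt_pow_left₀ L (by linarith) (by rw [hβL]; linarith), fun n => ?_⟩
  induction n using Nat.strong_induction_on with
  | _ n ih =>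
    rcases lt_or_ge n L with hn | hn
    · calc (a n : ℝ) ≤ (k : ℝ) ^ n := by exact_mod_cast ha n
        _ ≤ (k : ℝ) ^ L := pow_le_pow_right₀ (by linarith) hn.le
        _ ≤ _ := le_mul_of_one_le_right (by positivity) (one_le_pow₀ hβ1.le)
    · obtain ⟨m, rfl⟩ := Nat.exists_eq_add_of_le' hn
      have h1 : (a (m + L) : ℝ) ≤ ((k : ℝ) ^ L - 1) * a m := by
        have := hrec m
        have h1 : 1 ≤ k ^ L := Nat.one_le_pow _ _ (by omega)
        rw [← Nat.cast_le (α := ℝ)] at this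
        push_cast [h1] at this
        exact this
      have h2 := ih m (by omega)
      calc (a (m + L) : ℝ) ≤ ((k : ℝ) ^ L - 1) * a m := h1
        _ ≤ β ^ L * ((k : ℝ) ^ L * β ^ m) := by
          rw [hβL]
          exact mul_le_mul (by linarith) h2 (by positivity) (by linarith)
        _ = _ := by ring

theorem exists_le_mul_rpow {f a : ℕ → ℕ} {k L : ℕ} (hk : 2 ≤ k) (hL : 0 < L)
    (ha : ∀ n, a n ≤ k ^ n) (hrec : ∀ n, a (n + L) ≤ (k ^ L - 1) * a n)
    (hf : ∀ x n, x < k ^ n → f x ≤ ∑ j ∈ Finset.range (n + 1), a j) :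
    ∃ ε : ℝ, 0 < ε ∧ ∃ C : ℝ,
      ∀ᶠ x : ℕ in Filter.atTop, (f x : ℝ) ≤ C * (x : ℝ) ^ ((1 : ℝ) - ε) := by
  obtain ⟨β, hβ1, hβk, hβ⟩ := exists_le_mul_pow hk hL ha hrec
  have hk1 : (1 : ℝ) < k := by exact_mod_cast (by omega : 1 < k)
  have hlog1 : Real.logb k β < 1 := by
    rw [Real.logb_lt_iff_lt_rpow hk1 (by linarith), Real.rpow_one]; exact hβk
  have hlog0 : 0 < Real.logb k β := Real.logb_pos hk1 hβ1
  refine ⟨1 - Real.logb k β, by linarith, (k : ℝ) ^ L * (β ^ 2 / (β - 1)), ?_⟩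
  filter_upwards [Filter.eventually_ge_atTop 1] with x hx
  rw [sub_sub_cancel]
  set m := Nat.log k x
  have hle : (k : ℝ) ^ m ≤ x := by exact_mod_cast Nat.pow_log_le_self k (by omega)
  have hpow : β ^ m ≤ (x : ℝ) ^ Real.logb k β := by
    calc β ^ m = ((k : ℝ) ^ Real.logb k β) ^ m := by
          rw [Real.rpow_logb (by linarith) hk1.ne' (by linarith)]
      _ = ((k : ℝ) ^ m) ^ Real.logb k β := by
          rw [← Real.rpow_natCast, ← Real.rpow_natCast, ← Real.rpow_mul (by linarith),
            ← Real.rpow_mul (by linarith), mul_comm]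
      _ ≤ _ := Real.rpow_le_rpow (by positivity) hle hlog0.le
  have hsum : (f x : ℝ) ≤ ∑ j ∈ Finset.range (m + 2), (a j : ℝ) := by
    exact_mod_cast hf x (m + 1) (Nat.lt_pow_succ_log_self (by omega) x)
  have hβ' : 0 < β - 1 := by linarith
  calc (f x : ℝ) ≤ ∑ j ∈ Finset.range (m + 2), (k : ℝ) ^ L * β ^ j :=
        hsum.trans (Finset.sum_le_sum fun j _ => hβ j)
    _ = (k : ℝ) ^ L * ((β ^ (m + 2) - 1) / (β - 1)) := by
        rw [← Finset.mul_sum, geom_sum_eq hβ1.ne']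
    _ ≤ (k : ℝ) ^ L * (β ^ (m + 2) / (β - 1)) := by gcongr; linarith
    _ = (k : ℝ) ^ L * (β ^ 2 / (β - 1)) * β ^ m := by ring
    _ ≤ _ := by gcongr

end Asymptotics

section Automata

variable {k : ℕ} {σ : Type*}

/-- A state is live if an accepting state can be reached from it. -/
def DFA.IsLive {α : Type*} (M : DFA α σ) (s : σ) : Prop :=
  ∃ v, M.evalFrom s v ∈ M.accept

open Classical in
/-- The words of length `n` that lead to a live state. -/
noncomputable def DFA.liveWords (M : DFA (Fin k) σ) (n : ℕ) : Finset (List (Fin k)) :=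
  {w ∈ wordsOfLength k n | M.IsLive (M.eval w)}

theorem DFA.mem_liveWords {M : DFA (Fin k) σ} {n : ℕ} {w : List (Fin k)} :
    w ∈ M.liveWords n ↔ w.length = n ∧ M.IsLive (M.eval w) := by
  simp [DFA.liveWords, mem_wordsOfLength]

theorem DFA.IsLive.of_append {α : Type*} {M : DFA α σ} {s : σ} {u v : List α}
    (h : M.IsLive (M.evalFrom s (u ++ v))) : M.IsLive (M.evalFrom s u) := by
  obtain ⟨t, ht⟩ := h
  exact ⟨v ++ t, by rwa [← M.evalFrom_of_append, ← List.append_assoc, M.evalFrom_of_append]⟩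

/-- If no dead state is reachable from the state of `p`, a positive proportion of the words with
prefix `p` can be completed by words of bounded length to accepted words. -/
theorem exists_pow_le_countFn [Fintype σ] {S : Set ℕ} {M : DFA (Fin k) σ} (hk : 2 ≤ k)
    (hM : M.accepts = NatReprLang k S) {p : List (Fin k)}
    (hp : ∀ u, M.IsLive (M.eval (p ++ u))) :
    ∃ d, ∀ m, k ^ m ≤ countFn S (k ^ (d + m)) := by
  have hex : ∀ s, ∃ v, M.IsLive s → M.evalFrom s v ∈ M.accept := by
    intro s
    by_cases hs : M.IsLive s
    · exact hs.imp fun v hv _ => hv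
    · exact ⟨[], fun h => absurd h hs⟩
  choose v hv using hex
  let g : List (Fin k) → List (Fin k) := fun u => p ++ u ++ v (M.eval (p ++ u))
  have hg : ∀ u, g u ∈ NatReprLang k S := by
    intro u
    rw [← hM, M.mem_accepts]
    change M.evalFrom M.start (p ++ u ++ _) ∈ _
    rw [M.evalFrom_of_append]
    exact hv _ (hp u)
  let N := Finset.univ.sup fun s => (v s).length
  refine ⟨p.length + N, fun m => ?_⟩
  rw [← card_wordsOfLength k m]
  have hinj : Set.InjOn (fun u => wordVal k (g u)) (wordsOfLength k m) := by
    intro u hu u' hu' h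
    have h1 : g u = g u' := wordVal_injOn hk (hg u).1 (hg u').1 h
    simp only [g, List.append_assoc, List.append_cancel_left_eq] at h1
    rw [Finset.mem_coe, mem_wordsOfLength] at hu hu'
    exact (List.append_inj h1 (hu.trans hu'.symm)).1
  rw [← Finset.card_image_of_injOn hinj]
  refine card_le_countFn fun n hn => ?_
  obtain ⟨u, hu, rfl⟩ := Finset.mem_image.1 hn
  refine ⟨(hg u).2, (wordVal_lt_pow hk _).le.trans (Nat.pow_le_pow_right (by omega) ?_)⟩
  have hN : (v (M.eval (p ++ u))).length ≤ N :=
    Finset.le_sup (f := fun s => (v s).length) (Finset.mem_univ _)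
  rw [mem_wordsOfLength] at hu
  simp only [g, List.length_append]
  omega

theorem exists_dead_words_of_length [Fintype σ] {M : DFA (Fin k) σ} (hk : 2 ≤ k)
    (hp : ∀ p, ∃ u, ¬ M.IsLive (M.eval (p ++ u))) :
    ∃ L, 0 < L ∧ ∀ p, ∃ u, u.length = L ∧ ¬ M.IsLive (M.eval (p ++ u)) := by
  have hex : ∀ s, ∃ u, (∃ p, M.eval p = s) → ¬ M.IsLive (M.evalFrom s u) := by
    intro s
    by_cases hs : ∃ p, M.eval p = s
    · obtain ⟨p, rfl⟩ := hs
      obtain ⟨u, hu⟩ := hp p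
      exact ⟨u, fun _ => by rwa [DFA.eval, M.evalFrom_of_append] at hu⟩
    · exact ⟨[], fun h => absurd h hs⟩
  choose u hu using hex
  let N := Finset.univ.sup fun s => (u s).length
  refine ⟨N + 1, Nat.succ_pos _, fun p => ?_⟩
  have hN : (u (M.eval p)).length ≤ N :=
    Finset.le_sup (f := fun s => (u s).length) (Finset.mem_univ _)
  refine ⟨u (M.eval p) ++ List.replicate (N + 1 - (u (M.eval p)).length) ⟨0, by omega⟩, ?_, ?_⟩
  · simp only [List.length_append, List.length_replicate]
    omega
  · rw [DFA.eval, M.evalFrom_of_append]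
    exact fun h => hu _ ⟨p, rfl⟩ h.of_append

theorem card_liveWords_add_le {M : DFA (Fin k) σ} {L : ℕ}
    (hL : ∀ p, ∃ u, u.length = L ∧ ¬ M.IsLive (M.eval (p ++ u))) (n : ℕ) :
    (M.liveWords (n + L)).card ≤ (k ^ L - 1) * (M.liveWords n).card := by
  classical
  refine Finset.card_le_mul_card_image_of_maps_to (f := List.take n) ?_ _ ?_
  · intro w hw
    rw [DFA.mem_liveWords] at hw ⊢
    refine ⟨by simp [hw.1], DFA.IsLive.of_append (v := w.drop n) ?_⟩
    rw [List.take_append_drop]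
    exact hw.2
  · intro p _
    obtain ⟨u, hu, hdead⟩ := hL p
    have hcard : ((wordsOfLength k L).erase u).card = k ^ L - 1 := by
      rw [Finset.card_erase_of_mem (mem_wordsOfLength.2 hu), card_wordsOfLength]
    rw [← hcard]
    refine Finset.card_le_card_of_injOn (List.drop n) ?_ ?_
    · intro w hw
      simp only [Finset.coe_filter, Set.mem_ofPred_eq, DFA.mem_liveWords] at hw
      obtain ⟨⟨hlen, hlive⟩, rfl⟩ := hw
      rw [Finset.mem_coe, Finset.mem_erase, mem_wordsOfLength]
      refine ⟨?_, by simp [hlen]⟩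
      rintro rfl
      rw [List.take_append_drop] at hdead
      exact hdead hlive
    · intro w hw w' hw' h
      simp only [Finset.coe_filter, Set.mem_ofPred_eq] at hw hw'
      rw [← List.take_append_drop n w, ← List.take_append_drop n w', hw.2, hw'.2, h]

theorem countFn_le_sum_card_liveWords {S : Set ℕ} {M : DFA (Fin k) σ} (hk : 2 ≤ k)
    (hM : M.accepts = NatReprLang k S) {x n : ℕ} (hx : x < k ^ n) :
    countFn S x ≤ ∑ j ∈ Finset.range (n + 1), (M.liveWords j).card := by
  classical
  refine (countFn_le_card (s := ((Finset.range (n + 1)).biUnion M.liveWords).image (wordVal k))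
    ?_).trans (Finset.card_image_le.trans Finset.card_biUnion_le)
  intro m hm hmx
  obtain ⟨w, hw0, rfl, hlen⟩ := exists_wordVal_eq hk (hmx.trans_lt hx)
  have hacc : w ∈ M.accepts := hM ▸ ⟨hw0, hm⟩
  refine Finset.mem_image_of_mem _ (Finset.mem_biUnion.2 ⟨w.length, ?_, ?_⟩)
  · exact Finset.mem_range.2 (Nat.lt_succ_of_le hlen)
  · exact DFA.mem_liveWords.2 ⟨rfl, [], hacc⟩

end Automata

/-- A `k`-automatic set `S ⊆ ℕ` either has positive lower density, or
`π_S(x) = O(x^{1-ε})` for some `ε > 0`. -/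
theorem automatic_set_density_dichotomy
    (k : ℕ) (hk : 2 ≤ k) (S : Set ℕ) (hS : IsAutomaticSet k S) :
    0 < Filter.liminf (fun x : ℕ => (countFn S x : ℝ) / x) Filter.atTop ∨
      ∃ ε : ℝ, 0 < ε ∧ ∃ C : ℝ,
        ∀ᶠ x : ℕ in Filter.atTop, (countFn S x : ℝ) ≤ C * (x : ℝ) ^ ((1 : ℝ) - ε) := by
  obtain ⟨σ, _, M, hM⟩ := hS
  by_cases h : ∃ p, ∀ u, M.IsLive (M.eval (p ++ u))
  · obtain ⟨p, hp⟩ := h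
    obtain ⟨d, hd⟩ := exists_pow_le_countFn hk hM hp
    exact Or.inl (liminf_pos_of_pow_le hk d hd)
  · push Not at h
    obtain ⟨L, hL, hdead⟩ := exists_dead_words_of_length hk h
    refine Or.inr (exists_le_mul_rpow (a := fun n => (M.liveWords n).card) hk hL (fun n => ?_)
      (card_liveWords_add_le hdead) fun x n => countFn_le_sum_card_liveWords hk hM)
    rw [← card_wordsOfLength k n]
    exact Finset.card_le_card fun w hw => mem_wordsOfLength.2 (DFA.mem_liveWords.1 hw).1
end
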